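/- Let E be a Banach space, let 𝔐 be a B-admissible weight matrix, let U ⊆ E be open, and let j be a positive integer. If f : U → ℂ is a function such that f^j and f^{j+1} belong to the Beurling class E^{(𝔐)}(U), then f belongs to E^{(𝔐)}(U). -/

import Mathlib

open Set Filter Topology Metric
open scoped ENNReal NNReal Topology

noncomputable section

namespace JorisPaper

/-- The sequence `m` with `m_k = M_k / k!`. -/
def lc (M : ℕ → ℝ) (k : ℕ) : ℝ := M k / (Nat.factorial k : ℝ)

/-- A weight sequence: positive, log-convex, `M_0 = 1 ≤ M_1`, `M_k^{1/k} → ∞`. -/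
structure IsWeightSeq (M : ℕ → ℝ) : Prop where
  pos : ∀ k, 0 < M k
  first : M 0 = 1
  one_le : 1 ≤ M 1
  logconvex : ∀ k, 1 ≤ k → M k ^ 2 ≤ M (k - 1) * M (k + 1)
  root : Filter.Tendsto (fun k : ℕ => M k ^ ((1 : ℝ) / (k : ℝ))) atTop atTop

/-- `m_k^{1/k} → ∞`. -/
def RootsTendsto (m : ℕ → ℝ) : Prop :=
  Filter.Tendsto (fun k : ℕ => m k ^ ((1 : ℝ) / (k : ℝ))) atTop atTop

/-- `h_m(t) = inf_k m_k t^k` for `t > 0`, and `0` for `t ≤ 0`. -/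
def hfn (m : ℕ → ℝ) (t : ℝ) : ℝ := if t ≤ 0 then 0 else ⨅ k : ℕ, m k * t ^ k

/-- `Γ̄_m(t) = min {k | h_m(t) = m_k t^k}`. -/
def GammaUpper (m : ℕ → ℝ) (t : ℝ) : ℕ := sInf {k : ℕ | hfn m t = m k * t ^ k}

/-- `Γ̲_m(t) = min {k | m_{k+1}/m_k ≥ 1/t}`. -/
def GammaLower (m : ℕ → ℝ) (t : ℝ) : ℕ := sInf {k : ℕ | 1 / t ≤ m (k + 1) / m k}

/-- `mg(M,N) = sup_{j+k ≥ 1} (M_{j+k}/(N_j N_k))^{1/(j+k)}`, as an extended real. -/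
def mg (M N : ℕ → ℝ) : ℝ≥0∞ :=
  ⨆ (j : ℕ) (k : ℕ) (_ : 1 ≤ j + k),
    ENNReal.ofReal ((M (j + k) / (N j * N k)) ^ (((j : ℝ) + (k : ℝ))⁻¹))

/-- A weight matrix: a totally ordered (pointwise) family of weight sequences. -/
structure IsWeightMatrix (W : Set (ℕ → ℝ)) : Prop where
  weight : ∀ M ∈ W, IsWeightSeq M
  ordered : ∀ M ∈ W, ∀ N ∈ W, (∀ k, M k ≤ N k) ∨ (∀ k, N k ≤ M k)

/-- R-admissible weight matrix. -/
structure RAdmissible (W : Set (ℕ → ℝ)) : Prop where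
  matrix : IsWeightMatrix W
  roots : ∀ M ∈ W, RootsTendsto (lc M)
  gamma : ∀ M ∈ W, ∃ N ∈ W, ∃ C : ℝ, 1 ≤ C ∧
    ∀ t : ℝ, 0 < t → GammaUpper (lc N) (C * t) ≤ GammaLower (lc M) t
  mgrowth : ∀ M ∈ W, ∃ N ∈ W, mg M N < ⊤

/-- B-admissible weight matrix. -/
structure BAdmissible (W : Set (ℕ → ℝ)) : Prop where
  matrix : IsWeightMatrix W
  roots : ∀ M ∈ W, RootsTendsto (lc M)
  gamma : ∀ M ∈ W, ∃ N ∈ W, ∃ C : ℝ, 1 ≤ C ∧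
    ∀ t : ℝ, 0 < t → GammaUpper (lc M) (C * t) ≤ GammaLower (lc N) t
  mgrowth : ∀ M ∈ W, ∃ N ∈ W, mg N M < ⊤

/-- `‖f‖^M_{K,ρ} < ∞` (derivatives taken within `U`). -/
def SeqBoundedOn {E F : Type*} [NormedAddCommGroup E] [NormedSpace ℝ E]
    [NormedAddCommGroup F] [NormedSpace ℝ F]
    (M : ℕ → ℝ) (ρ : ℝ) (f : E → F) (U K : Set E) : Prop :=
  ∃ C : ℝ, ∀ x ∈ K, ∀ k : ℕ, ‖iteratedFDerivWithin ℝ k f U x‖ ≤ C * ρ ^ k * M k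

/-- `f ∈ B^M_ρ(V)`: smooth on `V` with global bounds `‖f‖^M_{V,ρ} < ∞`. -/
def GlobalClass {E F : Type*} [NormedAddCommGroup E] [NormedSpace ℝ E]
    [NormedAddCommGroup F] [NormedSpace ℝ F]
    (M : ℕ → ℝ) (ρ : ℝ) (f : E → F) (V : Set E) : Prop :=
  ContDiffOn ℝ (⊤ : ℕ∞) f V ∧ SeqBoundedOn M ρ f V V

/-- The Roumieu class `E^{{W}}(U)`. -/
def Roumieu {E F : Type*} [NormedAddCommGroup E] [NormedSpace ℝ E]
    [NormedAddCommGroup F] [NormedSpace ℝ F]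
    (W : Set (ℕ → ℝ)) (U : Set E) (f : E → F) : Prop :=
  ContDiffOn ℝ (⊤ : ℕ∞) f U ∧
    ∀ K ⊆ U, IsCompact K → ∃ M ∈ W, ∃ ρ : ℝ, 0 < ρ ∧ SeqBoundedOn M ρ f U K

/-- The Beurling class `E^{(W)}(U)`. -/
def Beurling {E F : Type*} [NormedAddCommGroup E] [NormedSpace ℝ E]
    [NormedAddCommGroup F] [NormedSpace ℝ F]
    (W : Set (ℕ → ℝ)) (U : Set E) (f : E → F) : Prop :=
  ContDiffOn ℝ (⊤ : ℕ∞) f U ∧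
    ∀ K ⊆ U, IsCompact K → ∀ M ∈ W, ∀ ρ : ℝ, 0 < ρ → SeqBoundedOn M ρ f U K

/-- The open ellipse `Ω_ε` with vertices `±cosh ε` and co-vertices `±i sinh ε`. -/
def Omega (ε : ℝ) : Set ℂ :=
  {z : ℂ | (z.re / Real.cosh ε) ^ 2 + (z.im / Real.sinh ε) ^ 2 < 1}

/-- `V_U = ⋃_{x ∈ U} (x + 𝔹)`. -/
def VU {E : Type*} [NormedAddCommGroup E] [NormedSpace ℝ E] (U : Set E) : Set E :=
  ⋃ x ∈ U, Metric.closedBall x 1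

/-- A weight function in the sense of Braun–Meise–Taylor. -/
structure IsWeightFunction (ω : ℝ → ℝ) : Prop where
  cont : ContinuousOn ω (Ici 0)
  mono : MonotoneOn ω (Ici 0)
  nonneg : ∀ t, 0 ≤ t → 0 ≤ ω t
  bigO : (fun t => ω (2 * t)) =O[atTop] ω
  littleO : ω =o[atTop] (fun t => t)
  logLittleO : Real.log =o[atTop] ω
  convex : ConvexOn ℝ (Ici 0) (fun t => ω (Real.exp t))

/-- The Young conjugate `φ*_ω(s) = sup_{t ≥ 0} (s t - ω(e^t))`. -/
def youngConj (ω : ℝ → ℝ) (s : ℝ) : ℝ :=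
  sSup {y : ℝ | ∃ t : ℝ, 0 ≤ t ∧ y = s * t - ω (Real.exp t)}

/-- The Roumieu class `E^{{ω}}(U)` for a weight function `ω`. -/
def RoumieuW {E F : Type*} [NormedAddCommGroup E] [NormedSpace ℝ E]
    [NormedAddCommGroup F] [NormedSpace ℝ F]
    (ω : ℝ → ℝ) (U : Set E) (f : E → F) : Prop :=
  ContDiffOn ℝ (⊤ : ℕ∞) f U ∧
    ∀ K ⊆ U, IsCompact K → ∃ C : ℝ, 0 < C ∧ ∃ ρ : ℝ, 0 < ρ ∧
      ∀ x ∈ K, ∀ k : ℕ, ‖iteratedFDerivWithin ℝ k f U x‖ ≤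
        C * Real.exp ((1 / ρ) * youngConj ω (ρ * k))

/-- The Beurling class `E^{(ω)}(U)` for a weight function `ω`. -/
def BeurlingW {E F : Type*} [NormedAddCommGroup E] [NormedSpace ℝ E]
    [NormedAddCommGroup F] [NormedSpace ℝ F]
    (ω : ℝ → ℝ) (U : Set E) (f : E → F) : Prop :=
  ContDiffOn ℝ (⊤ : ℕ∞) f U ∧
    ∀ K ⊆ U, IsCompact K → ∀ ρ : ℝ, 0 < ρ → ∃ C : ℝ, 0 < C ∧
      ∀ x ∈ K, ∀ k : ℕ, ‖iteratedFDerivWithin ℝ k f U x‖ ≤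
        C * Real.exp ((1 / ρ) * youngConj ω (ρ * k))

/-- Two constants estimate: an entire function bounded by `B` on the unit disc and by `ε` on the
real diameter. -/
lemma norm_pow_four_le_of_small_on_real {φ : ℂ → ℂ} (hφ : Differentiable ℂ φ) {B ε : ℝ}
    (hB : ∀ z : ℂ, ‖z‖ ≤ 1 → ‖φ z‖ ≤ B) (hε : ∀ x : ℝ, |x| ≤ 1 → ‖φ x‖ ≤ ε)
    {z : ℂ} (hz : ‖z‖ ≤ 1 / 3) : ‖φ z‖ ^ 4 ≤ ε * B ^ 3 := by
  set a := z.re with ha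
  set b := z.im with hb
  have hzz : a ^ 2 + b ^ 2 ≤ 1 / 9 := by
    have h1 := Complex.sq_norm z
    rw [Complex.normSq_apply] at h1
    have h2 : ‖z‖ ^ 2 ≤ (1 / 3) ^ 2 := pow_le_pow_left₀ (norm_nonneg _) hz 2
    nlinarith
  have hB0 : 0 ≤ B := (norm_nonneg _).trans (hB 0 (by simp))
  have hε0 : 0 ≤ ε := (norm_nonneg _).trans (hε 0 (by simp))
  by_cases hb0 : b = 0
  · have hzr : z = (a : ℂ) := by apply Complex.ext <;> simp [ha, ← hb, hb0]
    have ha1 : |a| ≤ 1 := by rw [abs_le]; constructor <;> nlinarith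
    have h1 := hε a ha1
    have h2 : ‖φ a‖ ≤ B := hB a (by simpa using ha1)
    rw [hzr]
    calc ‖φ a‖ ^ 4 = ‖φ a‖ * ‖φ a‖ ^ 3 := by ring
      _ ≤ ε * B ^ 3 := by gcongr
  set ψ : ℂ → ℂ := fun w => φ (z + w) * φ (z + Complex.I * w) * φ (z - w) * φ (z - Complex.I * w)
    with hψ
  set c := |b| with hc
  have hcpos : 0 < c := abs_pos.mpr hb0
  set Q : Set ℂ := Ioo (-c) c ×ℂ Ioo (-c) c with hQ
  have hdiff : Differentiable ℂ ψ := by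
    rw [hψ]; fun_prop
  have hbdd : Bornology.IsBounded Q :=
    (Metric.isBounded_Ioo _ _).reProdIm (Metric.isBounded_Ioo _ _)
  have hcb : c ^ 2 = b ^ 2 := sq_abs b
  have hac : |a| * c ≤ 1 / 18 := by
    have : |a| ^ 2 = a ^ 2 := sq_abs a
    nlinarith [sq_nonneg (|a| - c)]
  have key : ∀ x y : ℝ, |x| ≤ c → |y| ≤ c → ‖z + (x + y * Complex.I)‖ ≤ 1 := by
    intro x y hx hy
    have h1 := Complex.sq_norm (z + (x + y * Complex.I))
    rw [Complex.normSq_apply] at h1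
    have hr : (z + (x + y * Complex.I)).re = a + x := by simp [ha]
    have hi : (z + (x + y * Complex.I)).im = b + y := by simp [hb]
    rw [hr, hi] at h1
    have hax : a * x ≤ |a| * c := by
      calc a * x ≤ |a * x| := le_abs_self _
        _ = |a| * |x| := abs_mul _ _
        _ ≤ |a| * c := by gcongr
    have hby : b * y ≤ c * c := by
      calc b * y ≤ |b * y| := le_abs_self _
        _ = |b| * |y| := abs_mul _ _
        _ ≤ c * c := by gcongr
    have hx2 : x ^ 2 ≤ c ^ 2 := by rw [← sq_abs x]; gcongr
    have hy2 : y ^ 2 ≤ c ^ 2 := by rw [← sq_abs y]; gcongr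
    have : ‖z + (x + y * Complex.I)‖ ^ 2 ≤ 1 := by nlinarith
    nlinarith [norm_nonneg (z + (x + y * Complex.I))]
  have realside : ∀ x y : ℝ, |x| ≤ c → y = -b → ‖φ (z + (x + y * Complex.I))‖ ≤ ε := by
    intro x y hx hy
    have h1 : z + (x + y * Complex.I) = ((a + x : ℝ) : ℂ) := by
      apply Complex.ext <;> simp [ha, hb, hy]
    rw [h1]
    apply hε
    have hyc : |y| ≤ c := by rw [hy, abs_neg]
    have := key x y hx hyc
    rwa [h1, Complex.norm_real, Real.norm_eq_abs] at this
  have hfront : ∀ w ∈ frontier Q, ‖ψ w‖ ≤ ε * B ^ 3 := by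
    intro w hw
    rw [hQ, Complex.frontier_reProdIm, closure_Ioo (by linarith), frontier_Ioo (by linarith)] at hw
    have hw' : (|w.re| ≤ c ∧ |w.im| ≤ c) ∧ (w.re = c ∨ w.re = -c ∨ w.im = c ∨ w.im = -c) := by
      rcases hw with ⟨h1, h2⟩ | ⟨h1, h2⟩
      · simp only [mem_preimage, mem_Icc, mem_insert_iff, mem_singleton_iff] at h1 h2
        refine ⟨⟨abs_le.mpr h1, ?_⟩, by tauto⟩
        rcases h2 with h2 | h2 <;> rw [h2] <;> simp [abs_of_pos hcpos]
      · simp only [mem_preimage, mem_Icc, mem_insert_iff, mem_singleton_iff] at h1 h2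
        refine ⟨⟨?_, abs_le.mpr h2⟩, by tauto⟩
        rcases h1 with h1 | h1 <;> rw [h1] <;> simp [abs_of_pos hcpos]
    obtain ⟨⟨hx, hy⟩, hor⟩ := hw'
    have e1 : z + w = z + ((w.re : ℝ) + (w.im : ℝ) * Complex.I) := by rw [Complex.re_add_im]
    have e2 : z + Complex.I * w = z + (((-w.im : ℝ) : ℂ) + (w.re : ℝ) * Complex.I) := by
      apply Complex.ext <;> simp
    have e3 : z - w = z + (((-w.re : ℝ) : ℂ) + ((-w.im : ℝ) : ℂ) * Complex.I) := by
      apply Complex.ext <;> simp [sub_eq_add_neg]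
    have e4 : z - Complex.I * w = z + ((w.im : ℝ) + ((-w.re : ℝ) : ℂ) * Complex.I) := by
      apply Complex.ext <;> simp [sub_eq_add_neg]
    have hx' : |-w.re| ≤ c := by rwa [abs_neg]
    have hy' : |-w.im| ≤ c := by rwa [abs_neg]
    have b1 : ‖φ (z + w)‖ ≤ B := by rw [e1]; exact hB _ (key _ _ hx hy)
    have b2 : ‖φ (z + Complex.I * w)‖ ≤ B := by rw [e2]; exact hB _ (key _ _ hy' hx)
    have b3 : ‖φ (z - w)‖ ≤ B := by rw [e3]; exact hB _ (key _ _ hx' hy')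
    have b4 : ‖φ (z - Complex.I * w)‖ ≤ B := by rw [e4]; exact hB _ (key _ _ hy hx')
    have hsel : w.im = -b ∨ w.re = -b ∨ -w.im = -b ∨ -w.re = -b := by
      have h : c = b ∨ c = -b := abs_choice b
      clear_value c b
      grind
    simp only [hψ, norm_mul]
    rcases hsel with h | h | h | h
    · have := realside _ _ hx h
      rw [← e1] at this
      calc _ ≤ ε * B * B * B := by gcongr
        _ = _ := by ring
    · have := realside _ _ hy' h
      rw [← e2] at this
      calc _ ≤ B * ε * B * B := by gcongr
        _ = _ := by ring
    · have := realside _ _ hx' h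
      rw [← e3] at this
      calc _ ≤ B * B * ε * B := by gcongr
        _ = _ := by ring
    · have := realside _ _ hy h
      rw [← e4] at this
      calc _ ≤ B * B * B * ε := by gcongr
        _ = _ := by ring
  have h0 : (0 : ℂ) ∈ closure Q := by
    apply subset_closure
    rw [hQ, Complex.mem_reProdIm]
    simp [hcpos]
  have := Complex.norm_le_of_forall_mem_frontier_norm_le hbdd hdiff.diffContOnCl hfront h0
  simp only [hψ, mul_zero, add_zero, sub_zero, norm_mul] at this
  calc ‖φ z‖ ^ 4 = ‖φ z‖ * ‖φ z‖ * ‖φ z‖ * ‖φ z‖ := by ring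
    _ ≤ _ := this

/-- `V` has Wirtinger derivatives `∂V = a` and `∂̄V = b` at `w`. -/
def HasWirtingerAt (V : ℂ → ℂ) (a b w : ℂ) : Prop :=
  HasFDerivAt V (a • ContinuousLinearMap.id ℝ ℂ + b • (Complex.conjCLE : ℂ →L[ℝ] ℂ)) w

lemma HasWirtingerAt.continuousAt {V : ℂ → ℂ} {a b w : ℂ} (h : HasWirtingerAt V a b w) :
    ContinuousAt V w := HasFDerivAt.continuousAt h

lemma HasWirtingerAt.congr_deriv {V : ℂ → ℂ} {a b a' b' w : ℂ} (h : HasWirtingerAt V a b w)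
    (ha : a = a') (hb : b = b') : HasWirtingerAt V a' b' w := by
  subst ha hb; exact h

lemma HasDerivAt.hasWirtingerAt {V : ℂ → ℂ} {a w : ℂ} (h : HasDerivAt V a w) :
    HasWirtingerAt V a 0 w := by
  have h1 := h.hasFDerivAt.restrictScalars ℝ
  refine h1.congr_fderiv ?_
  ext <;> simp [mul_comm]

lemma HasWirtingerAt.conj {V : ℂ → ℂ} {a b w : ℂ} (h : HasWirtingerAt V a b w) :
    HasWirtingerAt (fun z => (starRingEnd ℂ) (V z)) ((starRingEnd ℂ) b) ((starRingEnd ℂ) a) w := by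
  have h1 := (Complex.conjCLE : ℂ →L[ℝ] ℂ).hasFDerivAt.comp w h
  refine HasFDerivAt.congr_fderiv (f := fun z => (starRingEnd ℂ) (V z)) h1 ?_
  ext <;> simp [add_comm]

lemma HasWirtingerAt.mul {V X : ℂ → ℂ} {a b c d w : ℂ} (h : HasWirtingerAt V a b w)
    (h' : HasWirtingerAt X c d w) :
    HasWirtingerAt (fun z => V z * X z) (a * X w + V w * c) (b * X w + V w * d) w := by
  have h1 := HasFDerivAt.fun_mul h h'
  refine HasFDerivAt.congr_fderiv h1 ?_
  ext <;> (simp; ring)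

lemma HasWirtingerAt.add_const {V : ℂ → ℂ} {a b w : ℂ} (h : HasWirtingerAt V a b w) (c : ℂ) :
    HasWirtingerAt (fun z => V z + c) a b w := HasFDerivAt.add_const c h

lemma HasWirtingerAt.comp_hasDerivAt {V : ℂ → ℂ} {a b w : ℂ} {f : ℂ → ℂ} {f' : ℂ}
    (hf : HasDerivAt f f' (V w)) (h : HasWirtingerAt V a b w) :
    HasWirtingerAt (fun z => f (V z)) (f' * a) (f' * b) w := by
  have h1 := (hf.hasFDerivAt.restrictScalars ℝ).comp w h
  refine HasFDerivAt.congr_fderiv (f := fun z => f (V z)) h1 ?_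
  ext <;> (simp; ring)

/-- Derivative of the mean over vertical periods in terms of `∂̄`. -/
lemma hasDerivAt_integral_of_wirtinger {V a b : ℂ → ℂ} (h : ∀ w, HasWirtingerAt V (a w) (b w) w)
    (ha : Continuous a) (hb : Continuous b)
    (hper : ∀ w, V (w + 2 * Real.pi * Complex.I) = V w) (σ : ℝ) :
    HasDerivAt (fun σ : ℝ => ∫ θ in (0 : ℝ)..(2 * Real.pi), V (σ + θ * Complex.I))
      (∫ θ in (0 : ℝ)..(2 * Real.pi), 2 * b (σ + θ * Complex.I)) σ := by
  have hV : Continuous V := continuous_iff_continuousAt.mpr fun w => (h w).continuousAt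
  have hσ : ∀ σ θ : ℝ, HasDerivAt (fun σ : ℝ => V (σ + θ * Complex.I))
      (a (σ + θ * Complex.I) + b (σ + θ * Complex.I)) σ := by
    intro σ θ
    have h1 : HasDerivAt (fun σ : ℝ => (σ : ℂ) + θ * Complex.I) 1 σ :=
      (Complex.ofRealCLM.hasDerivAt (x := σ)).add_const _
    have h0 : HasFDerivAt V _ ((fun σ : ℝ => (σ : ℂ) + θ * Complex.I) σ) := h (σ + θ * Complex.I)
    have h2 := h0.comp_hasDerivAt σ h1
    refine h2.congr_deriv ?_
    simp
  have hθ : ∀ σ θ : ℝ, HasDerivAt (fun θ : ℝ => V (σ + θ * Complex.I))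
      (Complex.I * (a (σ + θ * Complex.I) - b (σ + θ * Complex.I))) θ := by
    intro σ θ
    have h1 : HasDerivAt (fun θ : ℝ => (σ : ℂ) + θ * Complex.I) Complex.I θ := by
      have := ((Complex.ofRealCLM.hasDerivAt (x := θ)).mul_const Complex.I).const_add (σ : ℂ)
      simpa using this
    have h0 : HasFDerivAt V _ ((fun θ : ℝ => (σ : ℂ) + θ * Complex.I) θ) := h (σ + θ * Complex.I)
    have h2 := h0.comp_hasDerivAt θ h1
    refine h2.congr_deriv ?_
    simp; ring
  have hcont : ∀ f : ℂ → ℂ, Continuous f → Continuous fun θ : ℝ => f (σ + θ * Complex.I) := by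
    intro f hf; fun_prop
  have hzero : ∫ θ in (0 : ℝ)..(2 * Real.pi),
      Complex.I * (a (σ + θ * Complex.I) - b (σ + θ * Complex.I)) = 0 := by
    rw [intervalIntegral.integral_eq_sub_of_hasDerivAt (fun θ _ => hθ σ θ)]
    · have := hper σ
      push_cast
      simp [this]
    · apply Continuous.intervalIntegrable
      have h1 := hcont a ha
      have h2 := hcont b hb
      fun_prop
  obtain ⟨B, hB⟩ := ((isCompact_Icc (a := σ - 1) (b := σ + 1)).prod
      (isCompact_Icc (a := (0:ℝ)) (b := 2 * Real.pi))).exists_bound_of_continuousOn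
      (f := fun p : ℝ × ℝ => a (p.1 + p.2 * Complex.I) + b (p.1 + p.2 * Complex.I))
      (by fun_prop)
  have hmain := (intervalIntegral.hasDerivAt_integral_of_dominated_loc_of_deriv_le
    (μ := MeasureTheory.volume) (a := 0) (b := 2 * Real.pi) (x₀ := σ) (s := Icc (σ - 1) (σ + 1))
    (F := fun (σ : ℝ) (θ : ℝ) => V (σ + θ * Complex.I))
    (F' := fun (σ : ℝ) (θ : ℝ) => a (σ + θ * Complex.I) + b (σ + θ * Complex.I))
    (bound := fun _ => B) ?_ ?_ ?_ ?_ ?_ ?_ ?_).2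
  · refine hmain.congr_deriv ?_
    rw [intervalIntegral.integral_const_mul, intervalIntegral.integral_sub
      ((hcont a ha).intervalIntegrable _ _) ((hcont b hb).intervalIntegrable _ _),
      mul_eq_zero_iff_left Complex.I_ne_zero, sub_eq_zero] at hzero
    rw [intervalIntegral.integral_const_mul, intervalIntegral.integral_add
      ((hcont a ha).intervalIntegrable _ _) ((hcont b hb).intervalIntegrable _ _), hzero]
    ring
  · exact Icc_mem_nhds (by linarith) (by linarith)
  · refine Eventually.of_forall fun x => Continuous.aestronglyMeasurable ?_
    fun_prop
  · exact (hcont V hV).intervalIntegrable _ _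
  · exact ((hcont a ha).add (hcont b hb)).aestronglyMeasurable
  · refine Eventually.of_forall fun θ hθ' x hx => ?_
    rw [uIoc_of_le (by positivity)] at hθ'
    exact hB (x, θ) ⟨hx, ⟨hθ'.1.le, hθ'.2⟩⟩
  · exact intervalIntegrable_const
  · exact Eventually.of_forall fun θ _ x _ => hσ x θ

lemma norm_exp_add_mul_I (σ θ : ℝ) : ‖Complex.exp (σ + θ * Complex.I)‖ = Real.exp σ := by
  simp [Complex.norm_exp]

lemma exp_periodic_two_pi (w : ℂ) : Complex.exp (w + 2 * Real.pi * Complex.I) = Complex.exp w :=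
  Complex.exp_periodic w

/-- The pull back of a differentiable function to logarithmic coordinates. -/
lemma hasDerivAt_comp_exp {g : ℂ → ℂ} (hg : Differentiable ℂ g) (w : ℂ) :
    HasDerivAt (fun w => g (Complex.exp w)) (deriv g (Complex.exp w) * Complex.exp w) w :=
  (hg (Complex.exp w)).hasDerivAt.comp w (Complex.hasDerivAt_exp w)

lemma mul_conj_add_sq (a : ℂ) (s : ℝ) :
    a * (starRingEnd ℂ) a + (s : ℂ) ^ 2 = ((‖a‖ ^ 2 + s ^ 2 : ℝ) : ℂ) := by
  rw [Complex.mul_conj, Complex.normSq_eq_norm_sq]; push_cast; ring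

lemma hasDerivAt_re {P : ℝ → ℂ} {σ : ℝ} {d : ℂ} (h : HasDerivAt P d σ) :
    HasDerivAt (fun σ => (P σ).re) d.re σ :=
  Complex.reCLM.hasFDerivAt.comp_hasDerivAt σ h

lemma re_intervalIntegral {f : ℝ → ℂ} (hf : Continuous f) (a b : ℝ) :
    (∫ θ in a..b, f θ).re = ∫ θ in a..b, (f θ).re :=
  (Complex.reCLM.intervalIntegral_comp_comm (hf.intervalIntegrable a b)).symm

/-- Energy estimate for the regularised logarithm `log (|g|² + s²)` on circles. -/
lemma exists_energy {g : ℂ → ℂ} (hg : Differentiable ℂ g) {s : ℝ} (hs : 0 < s)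
    (hb : ∀ z : ℂ, ‖z‖ ≤ 2 → ‖g z‖ ≤ 1) :
    ∃ K : ℝ → ℝ, (∀ σ : ℝ, HasDerivAt K (∫ θ in (0 : ℝ)..(2 * Real.pi),
      4 * (s * ‖deriv g (Complex.exp (σ + θ * Complex.I)) * Complex.exp (σ + θ * Complex.I)‖ /
        (‖g (Complex.exp (σ + θ * Complex.I))‖ ^ 2 + s ^ 2)) ^ 2) σ) ∧
      Tendsto K atBot (𝓝 0) ∧
      K 0 ≤ 2 * Real.pi / Real.log 2 * (Real.log (1 + s ^ 2) - Real.log (s ^ 2)) := by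
  set γ : ℂ → ℂ := fun w => g (Complex.exp w) with hγ
  set γ' : ℂ → ℂ := fun w => deriv g (Complex.exp w) * Complex.exp w with hγ'
  set γ₂ : ℂ → ℂ := deriv γ' with hγ₂
  have hdg : Differentiable ℂ (deriv g) := by
    have h : ContDiff ℂ 2 g := hg.contDiff
    exact h.differentiable_deriv_two
  have hdγ' : Differentiable ℂ γ' := by rw [hγ']; fun_prop
  have hcγ : Continuous γ := by rw [hγ]; exact hg.continuous.comp Complex.continuous_exp
  have hcγ' : Continuous γ' := hdγ'.continuous
  have hcγ₂ : Continuous γ₂ := by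
    have h : ContDiff ℂ 2 γ' := hdγ'.contDiff
    exact h.differentiable_deriv_two.continuous
  have wγ : ∀ w, HasWirtingerAt γ (γ' w) 0 w := fun w =>
    HasDerivAt.hasWirtingerAt (hasDerivAt_comp_exp hg w)
  have wγ' : ∀ w, HasWirtingerAt γ' (γ₂ w) 0 w := fun w =>
    HasDerivAt.hasWirtingerAt (hdγ' w).hasDerivAt
  set cj := starRingEnd ℂ with hcj
  have hccj : Continuous cj := Complex.continuous_conj
  set N : ℂ → ℂ := fun w => γ w * cj (γ w) + (s : ℂ) ^ 2 with hN
  have hNr : ∀ w, N w = ((‖γ w‖ ^ 2 + s ^ 2 : ℝ) : ℂ) := fun w => mul_conj_add_sq _ _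
  have hNpos : ∀ w, 0 < ‖γ w‖ ^ 2 + s ^ 2 := fun w => by positivity
  have hN0 : ∀ w, N w ≠ 0 := fun w => by
    rw [hNr]; exact_mod_cast (hNpos w).ne'
  have hcN : Continuous N := by rw [hN]; fun_prop
  have wN : ∀ w, HasWirtingerAt N (γ' w * cj (γ w)) (γ w * cj (γ' w)) w := fun w => by
    refine (((wγ w).mul (wγ w).conj).add_const _).congr_deriv ?_ ?_ <;> simp [hcj]
  -- the logarithm
  have wL : ∀ w, HasWirtingerAt (fun w => Complex.log (N w)) ((N w)⁻¹ * (γ' w * cj (γ w)))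
      ((N w)⁻¹ * (γ w * cj (γ' w))) w := fun w => by
    refine HasWirtingerAt.comp_hasDerivAt (Complex.hasDerivAt_log ?_) (wN w)
    rw [hNr]
    exact Complex.ofReal_mem_slitPlane.mpr (hNpos w)
  set Ψ : ℂ → ℂ := fun w => 2 * (γ' w * cj (γ w) * (N w)⁻¹) with hΨ
  have hcinv : Continuous fun w => (N w)⁻¹ := hcN.inv₀ hN0
  have hcΨ : Continuous Ψ := by rw [hΨ]; fun_prop
  have hper : ∀ w, γ (w + 2 * Real.pi * Complex.I) = γ w := fun w => by
    simp only [hγ, exp_periodic_two_pi]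
  have hper' : ∀ w, γ' (w + 2 * Real.pi * Complex.I) = γ' w := fun w => by
    simp only [hγ', exp_periodic_two_pi]
  have hperN : ∀ w, N (w + 2 * Real.pi * Complex.I) = N w := fun w => by
    simp only [hN, hper]
  have dJ := hasDerivAt_integral_of_wirtinger wL (by fun_prop) (by fun_prop)
    (fun w => by rw [hperN])
  -- derivative of `Ψ`
  have wΨ : ∀ w, HasWirtingerAt Ψ
      (2 * (γ₂ w * cj (γ w) * (N w)⁻¹ + γ' w * cj (γ w) * (-(N w ^ 2)⁻¹ * (γ' w * cj (γ w)))))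
      (2 * ((s : ℂ) ^ 2 * (γ' w * cj (γ' w)) * (N w ^ 2)⁻¹)) w := fun w => by
    have h1 := ((wγ' w).mul (wγ w).conj).mul
      (HasWirtingerAt.comp_hasDerivAt (hasDerivAt_inv (hN0 w)) (wN w))
    have h2 := (HasDerivAt.hasWirtingerAt (hasDerivAt_const w (2 : ℂ))).mul h1
    refine h2.congr_deriv ?_ ?_
    · simp [hcj]
    · have e : γ w * cj (γ w) = N w - (s : ℂ) ^ 2 := by simp [hN]
      have := hN0 w
      simp only [zero_mul, zero_add]
      field_simp
      linear_combination (-cj (γ' w)) * e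
  have dK := hasDerivAt_integral_of_wirtinger wΨ (by fun_prop (disch := simpa using hN0))
    (by fun_prop (disch := simpa using hN0))
    (fun w => by simp only [hΨ, hper, hper', hperN])
  refine ⟨fun σ => (∫ θ in (0 : ℝ)..(2 * Real.pi), Ψ (σ + θ * Complex.I)).re, ?_, ?_, ?_⟩
  · intro σ
    refine (hasDerivAt_re (dK σ)).congr_deriv ?_
    rw [re_intervalIntegral (by fun_prop (disch := simpa using fun _ => hN0 _))]
    refine intervalIntegral.integral_congr fun θ _ => ?_
    change (2 * (2 * ((s : ℂ) ^ 2 * (γ' _ * cj (γ' _)) * (N _ ^ 2)⁻¹))).re = 4 * (s * ‖γ' _‖ /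
        (‖γ _‖ ^ 2 + s ^ 2)) ^ 2
    rw [hcj, Complex.mul_conj, Complex.normSq_eq_norm_sq, hNr, ← Complex.ofReal_pow,
      ← Complex.ofReal_pow, ← Complex.ofReal_mul, ← Complex.ofReal_inv, ← Complex.ofReal_mul,
      show (2 : ℂ) = ((2 : ℝ) : ℂ) by simp, ← Complex.ofReal_mul, ← Complex.ofReal_mul,
      Complex.ofReal_re]
    have := (hNpos (σ + θ * Complex.I)).ne'
    field_simp
    ring
  · obtain ⟨B, hB⟩ := (isCompact_closedBall (0 : ℂ) 1).exists_bound_of_continuousOn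
      hdg.continuous.continuousOn
    have hB0 : 0 ≤ B := (norm_nonneg _).trans (hB 0 (by simp))
    have hbound : ∀ᶠ σ : ℝ in atBot, ‖(∫ θ in (0 : ℝ)..(2 * Real.pi), Ψ (σ + θ * Complex.I)).re‖ ≤
        2 * (B * (s ^ 2)⁻¹) * |2 * Real.pi - 0| * Real.exp σ := by
      filter_upwards [eventually_le_atBot 0] with σ hσ
      refine (Complex.abs_re_le_norm _).trans ?_
      have : ∀ θ ∈ uIoc (0 : ℝ) (2 * Real.pi), ‖Ψ (σ + θ * Complex.I)‖ ≤
          2 * (B * (s ^ 2)⁻¹) * Real.exp σ := by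
        intro θ _
        have hle : ‖Complex.exp (σ + θ * Complex.I)‖ ≤ 1 := by
          rw [norm_exp_add_mul_I]; exact Real.exp_le_one_iff.mpr hσ
        have e1 : ‖γ (σ + θ * Complex.I)‖ ≤ 1 := hb _ (hle.trans (by norm_num))
        have e2 : ‖γ' (σ + θ * Complex.I)‖ ≤ B * Real.exp σ := by
          simp only [hγ', norm_mul, norm_exp_add_mul_I]
          gcongr
          exact hB _ (by simpa using hle)
        have e3 : ‖(N (σ + θ * Complex.I))⁻¹‖ ≤ (s ^ 2)⁻¹ := by
          rw [hNr, norm_inv, Complex.norm_real, Real.norm_of_nonneg (hNpos _).le]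
          gcongr
          nlinarith [sq_nonneg ‖γ (σ + θ * Complex.I)‖]
        simp only [hΨ, norm_mul, hcj, RCLike.norm_conj, Complex.norm_ofNat]
        calc _ ≤ 2 * (B * Real.exp σ * 1 * (s ^ 2)⁻¹) := by gcongr
          _ = _ := by ring
      refine (intervalIntegral.norm_integral_le_of_norm_le_const this).trans_eq ?_
      ring
    refine squeeze_zero_norm' hbound ?_
    have := (Real.tendsto_exp_atBot.const_mul (2 * (B * (s ^ 2)⁻¹) * |2 * Real.pi - 0|))
    simpa using this
  · set J : ℝ → ℝ := fun σ =>
      (∫ θ in (0 : ℝ)..(2 * Real.pi), Complex.log (N (σ + θ * Complex.I))).re with hJ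
    set K : ℝ → ℝ := fun σ => (∫ θ in (0 : ℝ)..(2 * Real.pi), Ψ (σ + θ * Complex.I)).re with hK
    have hJ' : ∀ σ, HasDerivAt J (K σ) σ := fun σ => by
      refine (hasDerivAt_re (dJ σ)).congr_deriv ?_
      rw [hK]
      simp only
      rw [re_intervalIntegral (by fun_prop (disch := simpa using fun _ => hN0 _)),
        re_intervalIntegral (by fun_prop)]
      refine intervalIntegral.integral_congr fun θ _ => ?_
      have e : cj (Ψ (σ + θ * Complex.I)) = 2 * ((N (σ + θ * Complex.I))⁻¹ *
          (γ (σ + θ * Complex.I) * cj (γ' (σ + θ * Complex.I)))) := by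
        simp only [hΨ, map_mul, map_inv₀, hNr, hcj, Complex.conj_ofReal, Complex.conj_conj,
          map_ofNat]
        ring
      rw [← e, hcj, Complex.conj_re]
    have hKm : Monotone K := by
      refine monotone_of_hasDerivAt_nonneg (fun σ => hasDerivAt_re (dK σ)) fun σ => ?_
      rw [re_intervalIntegral (by fun_prop (disch := simpa using fun _ => hN0 _))]
      refine intervalIntegral.integral_nonneg (by positivity) fun θ _ => ?_
      rw [hcj, Complex.mul_conj, hNr, ← Complex.ofReal_pow,
        ← Complex.ofReal_pow, ← Complex.ofReal_mul, ← Complex.ofReal_inv, ← Complex.ofReal_mul,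
        show (2 : ℂ) = ((2 : ℝ) : ℂ) by simp, ← Complex.ofReal_mul, ← Complex.ofReal_mul,
        Complex.ofReal_re]
      have := Complex.normSq_nonneg (γ' (σ + θ * Complex.I))
      have := hNpos (σ + θ * Complex.I)
      positivity
    have hl2 : 0 < Real.log 2 := Real.log_pos (by norm_num)
    obtain ⟨c, hc, hc'⟩ := exists_hasDerivAt_eq_slope J K hl2
      (fun x _ => (hJ' x).continuousAt.continuousWithinAt) (fun x _ => hJ' x)
    have hJre : ∀ σ : ℝ, J σ = ∫ θ in (0 : ℝ)..(2 * Real.pi),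
        Real.log (‖γ (σ + θ * Complex.I)‖ ^ 2 + s ^ 2) := fun σ => by
      have : (fun θ : ℝ => Complex.log (N (σ + θ * Complex.I))) =
          fun θ : ℝ => ((Real.log (‖γ (σ + θ * Complex.I)‖ ^ 2 + s ^ 2) : ℝ) : ℂ) := by
        funext θ
        rw [hNr, Complex.ofReal_log (hNpos _).le]
      simp only [hJ, this]
      rw [intervalIntegral.integral_ofReal, Complex.ofReal_re]
    have hcl : ∀ σ : ℝ, Continuous fun θ : ℝ => Real.log (‖γ (σ + θ * Complex.I)‖ ^ 2 + s ^ 2) :=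
      fun σ => Continuous.log (by fun_prop) (fun θ => (hNpos _).ne')
    have hJ0 : 2 * Real.pi * Real.log (s ^ 2) ≤ J 0 := by
      rw [hJre]
      have h := intervalIntegral.integral_mono_on (a := 0) (b := 2 * Real.pi)
        (μ := MeasureTheory.volume)
        (f := fun _ => Real.log (s ^ 2)) (by positivity) intervalIntegrable_const
        ((hcl 0).intervalIntegrable _ _) (fun θ _ => by
          apply Real.log_le_log (by positivity)
          nlinarith [sq_nonneg ‖γ ((0 : ℝ) + θ * Complex.I)‖])
      rwa [intervalIntegral.integral_const, smul_eq_mul, sub_zero] at h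
    have hJ2 : J (Real.log 2) ≤ 2 * Real.pi * Real.log (1 + s ^ 2) := by
      rw [hJre]
      have h := intervalIntegral.integral_mono_on (a := 0) (b := 2 * Real.pi)
        (μ := MeasureTheory.volume)
        (g := fun _ => Real.log (1 + s ^ 2)) (by positivity)
        ((hcl (Real.log 2)).intervalIntegrable _ _) intervalIntegrable_const (fun θ _ => by
          apply Real.log_le_log (hNpos _)
          have : ‖γ ((Real.log 2 : ℝ) + θ * Complex.I)‖ ≤ 1 := by
            apply hb
            rw [norm_exp_add_mul_I, Real.exp_log (by norm_num)]
          nlinarith [norm_nonneg (γ ((Real.log 2 : ℝ) + θ * Complex.I))])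
      simpa using h
    calc K 0 ≤ K c := hKm hc.1.le
      _ = (J (Real.log 2) - J 0) / (Real.log 2 - 0) := hc'
      _ ≤ (2 * Real.pi * Real.log (1 + s ^ 2) - 2 * Real.pi * Real.log (s ^ 2)) /
          Real.log 2 := by rw [sub_zero]; gcongr
      _ = _ := by ring

/-- The regularised quotient `h ḡ / (|g|² + s²)`. -/
def regQuot (g h : ℂ → ℂ) (s : ℝ) (z : ℂ) : ℂ :=
  h z * (starRingEnd ℂ) (g z) / ((‖g z‖ ^ 2 + s ^ 2 : ℝ) : ℂ)

lemma continuous_regQuot {g h : ℂ → ℂ} (hg : Continuous g) (hh : Continuous h) {s : ℝ}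
    (hs : 0 < s) : Continuous (regQuot g h s) := by
  unfold regQuot
  have hc : Continuous (starRingEnd ℂ) := Complex.continuous_conj
  refine Continuous.div (by fun_prop) (by fun_prop) fun z => ?_
  have : 0 < ‖g z‖ ^ 2 + s ^ 2 := by positivity
  exact_mod_cast this.ne'

lemma norm_regQuot {g h : ℂ → ℂ} {s : ℝ} (z : ℂ) :
    ‖regQuot g h s z‖ = ‖h z‖ * ‖g z‖ / (‖g z‖ ^ 2 + s ^ 2) := by
  have h0 : 0 ≤ ‖g z‖ ^ 2 + s ^ 2 := by positivity
  rw [regQuot, norm_div, norm_mul, RCLike.norm_conj, Complex.norm_real, Real.norm_of_nonneg h0]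

/-- Powers of the regularised quotient nearly annihilate boundary values of holomorphic
functions. -/
lemma norm_integral_regQuot_pow_mul_le {g h p : ℂ → ℂ} (hg : Differentiable ℂ g)
    (hh : Differentiable ℂ h) (hp : Differentiable ℂ p) {s τ A : ℝ} (hs : 0 < s) (hτ : 0 ≤ τ)
    (hA : 0 ≤ A) (hb : ∀ z : ℂ, ‖z‖ ≤ 2 → ‖g z‖ ≤ 1)
    (h1 : ∀ z : ℂ, ‖z‖ ≤ 1 → ‖h z‖ * s ≤ A * τ * (‖g z‖ ^ 2 + s ^ 2))
    (h2 : ∀ z : ℂ, ‖z‖ ≤ 1 → ‖h z‖ * ‖g z‖ ≤ A * (‖g z‖ ^ 2 + s ^ 2))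
    (hp2 : ∀ σ : ℝ, σ ≤ 0 →
      ∫ θ in (0 : ℝ)..(2 * Real.pi), ‖p (Complex.exp (σ + θ * Complex.I))‖ ^ 2 ≤ 1)
    (k : ℕ) :
    ‖∫ θ in (0 : ℝ)..(2 * Real.pi), regQuot g h s (Complex.exp (θ * Complex.I)) ^ (k + 1) *
      (p (Complex.exp (θ * Complex.I)) * Complex.exp (θ * Complex.I))‖ ≤
    (k + 1) * A ^ (k + 1) * τ *
      (2 * Real.pi / Real.log 2 * (Real.log (1 + s ^ 2) - Real.log (s ^ 2)) / 4 + 1 / 2) := by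
  obtain ⟨K, hK, hK0, hKb⟩ := exists_energy hg hs hb
  set γ : ℂ → ℂ := fun w => g (Complex.exp w) with hγ
  set γ' : ℂ → ℂ := fun w => deriv g (Complex.exp w) * Complex.exp w with hγ'
  set χ : ℂ → ℂ := fun w => h (Complex.exp w) with hχ
  set χ' : ℂ → ℂ := fun w => deriv h (Complex.exp w) * Complex.exp w with hχ'
  set P : ℂ → ℂ := fun w => p (Complex.exp w) * Complex.exp w with hP
  set cj := starRingEnd ℂ with hcj
  have hccj : Continuous cj := Complex.continuous_conj
  have hcd : ∀ f : ℂ → ℂ, Differentiable ℂ f → Continuous (deriv f) := fun f hf => by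
    have h : ContDiff ℂ 2 f := hf.contDiff
    exact h.differentiable_deriv_two.continuous
  have hcγ : Continuous γ := hg.continuous.comp Complex.continuous_exp
  have hcχ : Continuous χ := hh.continuous.comp Complex.continuous_exp
  have hcγ' : Continuous γ' := ((hcd g hg).comp Complex.continuous_exp).mul Complex.continuous_exp
  have hcχ' : Continuous χ' := ((hcd h hh).comp Complex.continuous_exp).mul Complex.continuous_exp
  have hdP : Differentiable ℂ P := by rw [hP]; fun_prop
  have hcP' : Continuous (deriv P) := hcd P hdP
  set N : ℂ → ℂ := fun w => γ w * cj (γ w) + (s : ℂ) ^ 2 with hN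
  have hNr : ∀ w, N w = ((‖γ w‖ ^ 2 + s ^ 2 : ℝ) : ℂ) := fun w => mul_conj_add_sq _ _
  have hNpos : ∀ w, 0 < ‖γ w‖ ^ 2 + s ^ 2 := fun w => by positivity
  have hN0 : ∀ w, N w ≠ 0 := fun w => by
    rw [hNr]; exact_mod_cast (hNpos w).ne'
  have hcN : Continuous N := by rw [hN]; fun_prop
  have wγ : ∀ w, HasWirtingerAt γ (γ' w) 0 w := fun w =>
    HasDerivAt.hasWirtingerAt (hasDerivAt_comp_exp hg w)
  have wχ : ∀ w, HasWirtingerAt χ (χ' w) 0 w := fun w =>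
    HasDerivAt.hasWirtingerAt (hasDerivAt_comp_exp hh w)
  have wP : ∀ w, HasWirtingerAt P (deriv P w) 0 w := fun w =>
    HasDerivAt.hasWirtingerAt (hdP w).hasDerivAt
  have wN : ∀ w, HasWirtingerAt N (γ' w * cj (γ w)) (γ w * cj (γ' w)) w := fun w => by
    refine (((wγ w).mul (wγ w).conj).add_const _).congr_deriv ?_ ?_ <;> simp [hcj]
  set v : ℂ → ℂ := fun w => χ w * cj (γ w) * (N w)⁻¹ with hv
  have hcinv : Continuous fun w => (N w)⁻¹ := hcN.inv₀ hN0
  have hcv : Continuous v := by rw [hv]; fun_prop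
  have wv : ∀ w, HasWirtingerAt v
      (χ' w * cj (γ w) * (N w)⁻¹ + χ w * cj (γ w) * (-(N w ^ 2)⁻¹ * (γ' w * cj (γ w))))
      ((s : ℂ) ^ 2 * (χ w * cj (γ' w)) * (N w ^ 2)⁻¹) w := fun w => by
    have h1 := ((wχ w).mul (wγ w).conj).mul
      (HasWirtingerAt.comp_hasDerivAt (hasDerivAt_inv (hN0 w)) (wN w))
    refine h1.congr_deriv ?_ ?_
    · simp [hcj]
    · have e : γ w * cj (γ w) = N w - (s : ℂ) ^ 2 := by simp [hN]
      have := hN0 w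
      simp only [zero_mul, zero_add]
      field_simp
      linear_combination (-χ w) * e
  have wW := fun w =>
    (HasWirtingerAt.comp_hasDerivAt (hasDerivAt_pow (k + 1) (v w)) (wv w)).mul (wP w)
  have hvq : ∀ w, v w = regQuot g h s (Complex.exp w) := fun w => by
    rw [regQuot, div_eq_mul_inv, hv]; simp only [hNr]; rfl
  have hperv : ∀ w, v (w + 2 * Real.pi * Complex.I) = v w := fun w => by
    simp only [hvq, exp_periodic_two_pi]
  have hperP : ∀ w, P (w + 2 * Real.pi * Complex.I) = P w := fun w => by
    simp only [hP, exp_periodic_two_pi]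
  have hcP : Continuous P := hdP.continuous
  have dI := hasDerivAt_integral_of_wirtinger wW (by fun_prop (disch := simpa using hN0))
    (by fun_prop (disch := simpa using hN0)) (fun w => by simp only [hperv, hperP])
  set I : ℝ → ℂ := fun σ : ℝ => ∫ θ in (0 : ℝ)..(2 * Real.pi),
    v (σ + θ * Complex.I) ^ (k + 1) * P (σ + θ * Complex.I) with hI
  set c := (k + 1) * A ^ (k + 1) * τ with hc
  have hc0 : 0 ≤ c := by positivity
  set Φ : ℝ → ℝ := fun σ => c * (K σ / 4 + Real.exp (2 * σ) / 2) with hΦ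
  have hvA : ∀ w : ℂ, ‖Complex.exp w‖ ≤ 1 → ‖v w‖ ≤ A := fun w hw => by
    rw [hvq, norm_regQuot, div_le_iff₀ (hNpos w)]
    exact h2 _ hw
  set Kd : ℝ → ℝ := fun σ => ∫ θ in (0 : ℝ)..(2 * Real.pi),
      4 * (s * ‖γ' (σ + θ * Complex.I)‖ / (‖γ (σ + θ * Complex.I)‖ ^ 2 + s ^ 2)) ^ 2 with hKd
  have hK' : ∀ σ, HasDerivAt K (Kd σ) σ := hK
  have hexpd : ∀ σ : ℝ, HasDerivAt (fun σ : ℝ => Real.exp (2 * σ)) (Real.exp (2 * σ) * 2) σ :=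
    fun σ => by
      simpa using ((hasDerivAt_id σ).const_mul 2).exp
  have hΦ' : ∀ σ, HasDerivAt Φ (c * (Kd σ / 4 + Real.exp (2 * σ))) σ := fun σ => by
    refine ((((hK' σ).div_const 4).add ((hexpd σ).div_const 2)).const_mul c).congr_deriv ?_
    ring
  have hcq : ∀ σ : ℝ, Continuous fun θ : ℝ =>
      (s * ‖γ' (σ + θ * Complex.I)‖ / (‖γ (σ + θ * Complex.I)‖ ^ 2 + s ^ 2)) ^ 2 := fun σ => by
    refine (Continuous.div (by fun_prop) (by fun_prop) fun θ => (hNpos _).ne').pow 2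
  have hcp : ∀ σ : ℝ, Continuous fun θ : ℝ => ‖p (Complex.exp (σ + θ * Complex.I))‖ ^ 2 :=
    fun σ => by have := hp.continuous; fun_prop
  have hI' : ∀ σ : ℝ, ∃ I' : ℂ, HasDerivAt I I' σ ∧
      (σ ≤ 0 → ‖I'‖ ≤ c * (Kd σ / 4 + Real.exp (2 * σ))) := by
    intro σ
    refine ⟨_, dI σ, fun hσ => ?_⟩
    have hpt : ∀ θ : ℝ, ‖2 * ((((k + 1 : ℕ) : ℂ) * v (σ + θ * Complex.I) ^ (k + 1 - 1) *
        ((s : ℂ) ^ 2 * (χ (σ + θ * Complex.I) * cj (γ' (σ + θ * Complex.I))) *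
          (N (σ + θ * Complex.I) ^ 2)⁻¹)) * P (σ + θ * Complex.I) +
          v (σ + θ * Complex.I) ^ (k + 1) * 0)‖ ≤
        c * ((s * ‖γ' (σ + θ * Complex.I)‖ / (‖γ (σ + θ * Complex.I)‖ ^ 2 + s ^ 2)) ^ 2 +
          Real.exp (2 * σ) * ‖p (Complex.exp (σ + θ * Complex.I))‖ ^ 2) := by
      intro θ
      set w : ℂ := σ + θ * Complex.I with hw
      have hew : ‖Complex.exp w‖ ≤ 1 := by
        rw [hw, norm_exp_add_mul_I]; exact Real.exp_le_one_iff.mpr hσ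
      have hn := hNpos w
      have e1 := hvA w hew
      have e2 : ‖χ w‖ * s / (‖γ w‖ ^ 2 + s ^ 2) ≤ A * τ := by
        rw [div_le_iff₀ hn]; exact h1 _ hew
      have e3 : ‖P w‖ = Real.exp σ * ‖p (Complex.exp w)‖ := by
        rw [hP]; simp only; rw [norm_mul, hw, norm_exp_add_mul_I, mul_comm]
      rw [mul_zero, add_zero, hNr]
      simp only [norm_mul, norm_inv, norm_pow, Complex.norm_real, Real.norm_of_nonneg hn.le, hcj,
        RCLike.norm_conj, Complex.norm_natCast, Complex.norm_ofNat, Real.norm_of_nonneg hs.le, e3,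
        Nat.add_sub_cancel]
      set x := s * ‖γ' w‖ / (‖γ w‖ ^ 2 + s ^ 2) with hx
      have hx0 : 0 ≤ x := by positivity
      set y := Real.exp σ * ‖p (Complex.exp w)‖ with hy
      have hy0 : 0 ≤ y := by positivity
      have e4 : Real.exp (2 * σ) * ‖p (Complex.exp w)‖ ^ 2 = y ^ 2 := by
        rw [hy, mul_pow, ← Real.exp_nat_mul]; simp
      rw [e4]
      calc _ = 2 * (((k + 1 : ℕ) : ℝ) * ‖v w‖ ^ k * (‖χ w‖ * s / (‖γ w‖ ^ 2 + s ^ 2))) * (x * y) := by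
            rw [hx]; field_simp
        _ ≤ 2 * (((k + 1 : ℕ) : ℝ) * A ^ k * (A * τ)) * (x * y) := by gcongr
        _ = c * (2 * x * y) := by rw [hc]; push_cast; ring
        _ ≤ c * (x ^ 2 + y ^ 2) := by gcongr; nlinarith [sq_nonneg (x - y)]
    refine (intervalIntegral.norm_integral_le_of_norm_le (by positivity)
      (Eventually.of_forall fun θ _ => hpt θ) ?_).trans ?_
    · exact (((hcq σ).add ((hcp σ).const_mul _)).const_mul c).intervalIntegrable _ _
    · rw [intervalIntegral.integral_const_mul, intervalIntegral.integral_add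
        ((hcq σ).intervalIntegrable _ _) (((hcp σ).const_mul _).intervalIntegrable _ _),
        intervalIntegral.integral_const_mul, hKd]
      simp only
      rw [intervalIntegral.integral_const_mul]
      gcongr
      · rw [mul_div_cancel_left₀ _ (by norm_num)]
      · have := hp2 σ hσ
        nlinarith [Real.exp_pos (2 * σ)]
  choose I' hI'1 hI'2 using hI'
  have hmain : ∀ a : ℝ, a ≤ 0 → ‖I 0‖ ≤ ‖I a‖ + Φ 0 - Φ a := by
    intro a ha
    have := image_norm_le_of_norm_deriv_right_le_deriv_boundary (f := I) (f' := I')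
      (a := a) (b := 0)
      (B := fun x => ‖I a‖ + Φ x - Φ a) (B' := fun σ => c * (Kd σ / 4 + Real.exp (2 * σ)))
      (fun x _ => (hI'1 x).continuousAt.continuousWithinAt)
      (fun x _ => (hI'1 x).hasDerivWithinAt) (by simp)
      (fun x => ((hΦ' x).const_add _).sub_const _) (fun x hx => hI'2 x hx.2.le)
    exact this (right_mem_Icc.mpr ha)
  have hΦlim : Tendsto Φ atBot (𝓝 0) := by
    have h1 : Tendsto (fun σ : ℝ => Real.exp (2 * σ)) atBot (𝓝 0) :=
      Real.tendsto_exp_atBot.comp (tendsto_id.const_mul_atBot (by norm_num))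
    have := ((hK0.div_const 4).add (h1.div_const 2)).const_mul c
    simpa using this
  have hIlim : Tendsto (fun a => ‖I a‖) atBot (𝓝 0) := by
    obtain ⟨B, hB⟩ := (isCompact_closedBall (0 : ℂ) 1).exists_bound_of_continuousOn
      hp.continuous.continuousOn
    have hB0 : 0 ≤ B := (norm_nonneg _).trans (hB 0 (by simp))
    refine squeeze_zero_norm' (a := fun σ => A ^ (k + 1) * B * |2 * Real.pi - 0| * Real.exp σ) ?_ ?_
    · filter_upwards [eventually_le_atBot 0] with σ hσ
      rw [norm_norm]
      have : ∀ θ ∈ uIoc (0 : ℝ) (2 * Real.pi),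
          ‖v (σ + θ * Complex.I) ^ (k + 1) * P (σ + θ * Complex.I)‖ ≤
          A ^ (k + 1) * (B * Real.exp σ) := by
        intro θ _
        have hew : ‖Complex.exp (σ + θ * Complex.I)‖ ≤ 1 := by
          rw [norm_exp_add_mul_I]; exact Real.exp_le_one_iff.mpr hσ
        have hPn : ‖P (σ + θ * Complex.I)‖ =
            ‖p (Complex.exp (σ + θ * Complex.I))‖ * Real.exp σ := by
          rw [← norm_exp_add_mul_I σ θ, ← norm_mul]
        rw [norm_mul, norm_pow, hPn]
        gcongr
        · exact hvA _ hew
        · exact hB _ (by simpa using hew)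
      refine (intervalIntegral.norm_integral_le_of_norm_le_const this).trans_eq ?_
      ring
    · have := (Real.tendsto_exp_atBot.const_mul (A ^ (k + 1) * B * |2 * Real.pi - 0|))
      simpa using this
  have hfin : ‖I 0‖ ≤ 0 + Φ 0 - 0 :=
    ge_of_tendsto ((hIlim.add_const (Φ 0)).sub hΦlim) (by
      filter_upwards [eventually_le_atBot 0] with a ha using hmain a ha)
  have hI0 : I 0 = ∫ θ in (0 : ℝ)..(2 * Real.pi),
      regQuot g h s (Complex.exp (θ * Complex.I)) ^ (k + 1) *
      (p (Complex.exp (θ * Complex.I)) * Complex.exp (θ * Complex.I)) := by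
    rw [hI]; simp only [hvq, hP, Complex.ofReal_zero, zero_add]
  rw [← hI0]
  refine hfin.trans ?_
  rw [zero_add, sub_zero, hΦ]
  simp only [mul_zero, Real.exp_zero]
  gcongr

lemma integral_exp_int_mul_I (n : ℤ) :
    ∫ θ in (0 : ℝ)..(2 * Real.pi), Complex.exp (n * (θ * Complex.I)) =
      if n = 0 then 2 * (Real.pi : ℂ) else 0 := by
  split_ifs with h
  · simp [h]
  · have hc : (n : ℂ) * Complex.I ≠ 0 := mul_ne_zero (by exact_mod_cast h) Complex.I_ne_zero
    have : ∀ θ : ℝ, Complex.exp (n * (θ * Complex.I)) = Complex.exp (n * Complex.I * θ) := by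
      intro θ; congr 1; ring
    simp_rw [this]
    rw [integral_exp_mul_complex hc]
    have h2 : Complex.exp (n * Complex.I * ((2 * Real.pi : ℝ) : ℂ)) = 1 := by
      rw [← Complex.exp_int_mul_two_pi_mul_I n]; congr 1; push_cast; ring
    rw [h2]; simp

/-- A trigonometric polynomial. -/
def trigSum (S : Finset ℤ) (a : ℤ → ℂ) (θ : ℝ) : ℂ :=
  ∑ n ∈ S, a n * Complex.exp (n * (θ * Complex.I))

lemma continuous_trigSum (S : Finset ℤ) (a : ℤ → ℂ) : Continuous (trigSum S a) := by
  unfold trigSum; fun_prop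

lemma conj_exp_int (n : ℤ) (θ : ℝ) : (starRingEnd ℂ) (Complex.exp (n * (θ * Complex.I))) =
    Complex.exp ((-n : ℤ) * (θ * Complex.I)) := by
  rw [← Complex.exp_conj]
  congr 1
  simp

lemma integral_trigSum_mul_conj {S T : Finset ℤ} (hT : T ⊆ S) (a b : ℤ → ℂ) :
    ∫ θ in (0 : ℝ)..(2 * Real.pi), trigSum S a θ * (starRingEnd ℂ) (trigSum T b θ) =
      2 * Real.pi * ∑ n ∈ T, a n * (starRingEnd ℂ) (b n) := by
  have hexp : ∀ θ : ℝ, trigSum S a θ * (starRingEnd ℂ) (trigSum T b θ) =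
      ∑ m ∈ T, ∑ n ∈ S, a n * (starRingEnd ℂ) (b m) *
        Complex.exp ((n - m : ℤ) * (θ * Complex.I)) := by
    intro θ
    simp only [trigSum, map_sum, map_mul, conj_exp_int]
    rw [Finset.sum_mul_sum, Finset.sum_comm]
    refine Finset.sum_congr rfl fun m _ => Finset.sum_congr rfl fun n _ => ?_
    rw [show ((n - m : ℤ) : ℂ) * (θ * Complex.I) = n * (θ * Complex.I) + (-m : ℤ) * (θ * Complex.I)
      by push_cast; ring, Complex.exp_add]
    ring
  simp_rw [hexp]
  rw [intervalIntegral.integral_finsetSum fun m _ => (by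
    apply Continuous.intervalIntegrable; fun_prop), Finset.mul_sum]
  refine Finset.sum_congr rfl fun m hm => ?_
  rw [intervalIntegral.integral_finsetSum fun n _ => (by
    apply Continuous.intervalIntegrable; fun_prop)]
  simp_rw [intervalIntegral.integral_const_mul, integral_exp_int_mul_I, sub_eq_zero]
  rw [Finset.sum_eq_single m]
  · simp; ring
  · intro n _ hn; simp [hn]
  · intro h; exact absurd (hT hm) h

lemma integral_norm_trigSum_sq (S : Finset ℤ) (a : ℤ → ℂ) :
    ∫ θ in (0 : ℝ)..(2 * Real.pi), ‖trigSum S a θ‖ ^ 2 = 2 * Real.pi * ∑ n ∈ S, ‖a n‖ ^ 2 := by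
  have h := integral_trigSum_mul_conj (subset_refl S) a a
  simp_rw [Complex.mul_conj, Complex.normSq_eq_norm_sq] at h
  rw [intervalIntegral.integral_ofReal] at h
  exact_mod_cast h

lemma exists_trigSum_near {v : ℂ → ℂ} (hv : Continuous v) {ε : ℝ} (hε : 0 < ε) :
    ∃ (S : Finset ℤ) (a : ℤ → ℂ), ∀ θ : ℝ,
      ‖v (Complex.exp (θ * Complex.I)) - trigSum S a θ‖ ≤ ε := by
  have : Fact (0 < 2 * Real.pi) := ⟨by positivity⟩
  let f : C(AddCircle (2 * Real.pi), ℂ) :=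
    ⟨fun x => v (AddCircle.toCircle x),
      hv.comp (continuous_subtype_val.comp AddCircle.continuous_toCircle)⟩
  have hf : f ∈ (Submodule.span ℂ (range (fourier (T := 2 * Real.pi)))).topologicalClosure := by
    rw [span_fourier_closure_eq_top]; trivial
  have hf' : f ∈ closure ((Submodule.span ℂ (range (fourier (T := 2 * Real.pi)))) : Set _) := hf
  obtain ⟨q, hq, hfq⟩ := Metric.mem_closure_iff.mp hf' ε hε
  obtain ⟨c, rfl⟩ := (Finsupp.mem_span_range_iff_exists_finsupp).mp hq
  refine ⟨c.support, c, fun θ => ?_⟩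
  have h1 := (f - (c.sum fun i a => a • fourier i)).norm_coe_le_norm (θ : AddCircle (2 * Real.pi))
  rw [← dist_eq_norm] at h1
  refine le_trans (le_of_eq ?_) (h1.trans hfq.le)
  congr 1
  rw [ContinuousMap.sub_apply]
  congr 1
  · change v _ = v _
    rw [AddCircle.toCircle_apply_mk]
    congr 1
    rw [Circle.coe_exp]
    congr 2
    have := Real.pi_ne_zero
    push_cast
    field_simp
  · rw [Finsupp.sum, ContinuousMap.sum_apply]
    refine Finset.sum_congr rfl fun n _ => ?_
    rw [ContinuousMap.smul_apply, fourier_coe_apply, smul_eq_mul]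
    congr 2
    have : (Real.pi : ℂ) ≠ 0 := by exact_mod_cast Real.pi_ne_zero
    push_cast
    field_simp

/-- A function on the unit circle which nearly annihilates boundary values of holomorphic functions
is close to the boundary values of an entire function. -/
lemma exists_entire_near_of_pairing {v : ℂ → ℂ} (hv : Continuous v) {κ : ℝ} (hκ : 0 < κ)
    (H : ∀ p : ℂ → ℂ, Differentiable ℂ p → (∀ σ : ℝ, σ ≤ 0 →
      ∫ θ in (0 : ℝ)..(2 * Real.pi), ‖p (Complex.exp (σ + θ * Complex.I))‖ ^ 2 ≤ 1) →
      ‖∫ θ in (0 : ℝ)..(2 * Real.pi), v (Complex.exp (θ * Complex.I)) *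
        (p (Complex.exp (θ * Complex.I)) * Complex.exp (θ * Complex.I))‖ ≤ κ) :
    ∃ u : ℂ → ℂ, Differentiable ℂ u ∧ ∫ θ in (0 : ℝ)..(2 * Real.pi),
      ‖u (Complex.exp (θ * Complex.I)) - v (Complex.exp (θ * Complex.I))‖ ^ 2 ≤ 16 * κ ^ 2 := by
  obtain ⟨S, c, hq⟩ := exists_trigSum_near hv (ε := κ / 16) (by positivity)
  set Sm := S.filter (· < 0) with hSm
  set Sp := S.filter (¬ · < 0) with hSp
  set u : ℂ → ℂ := fun z => ∑ n ∈ Sp, c n * z ^ n.toNat with hu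
  set p : ℂ → ℂ := fun z => ∑ n ∈ Sm, (starRingEnd ℂ) (c n) * z ^ (-n - 1).toNat with hp
  have hud : Differentiable ℂ u := by rw [hu]; fun_prop
  have hpd : Differentiable ℂ p := by rw [hp]; fun_prop
  refine ⟨u, hud, ?_⟩
  have hpi := Real.pi_pos
  have hpi2 := Real.pi_lt_d2
  set L := 2 * Real.pi * ∑ n ∈ Sm, ‖c n‖ ^ 2 with hL
  have hL0 : 0 ≤ L := by positivity
  have hue : ∀ θ : ℝ, u (Complex.exp (θ * Complex.I)) = trigSum Sp c θ := fun θ => by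
    simp only [hu, trigSum]
    refine Finset.sum_congr rfl fun n hn => ?_
    have hn0 : 0 ≤ n := not_lt.mp (Finset.mem_filter.mp hn).2
    rw [← Complex.exp_nat_mul, show ((n.toNat : ℕ) : ℂ) = (n : ℂ) by
      exact_mod_cast congrArg (Int.cast : ℤ → ℂ) (Int.toNat_of_nonneg hn0)]
  have hsplit : ∀ θ, trigSum S c θ = trigSum Sm c θ + trigSum Sp c θ := fun θ =>
    (Finset.sum_filter_add_sum_filter_not S (· < 0) _).symm
  have hpe : ∀ σ θ : ℝ, p (Complex.exp (σ + θ * Complex.I)) * Complex.exp (θ * Complex.I) =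
      (starRingEnd ℂ) (trigSum Sm (fun n => c n * (Real.exp ((-n - 1) * σ) : ℝ)) θ) := fun σ θ => by
    simp only [hp, trigSum, map_sum, map_mul, conj_exp_int, Finset.sum_mul, Complex.conj_ofReal]
    refine Finset.sum_congr rfl fun n hn => ?_
    have hn0 : 0 ≤ -n - 1 := by have := (Finset.mem_filter.mp hn).2; omega
    have hcast : (((-n - 1).toNat : ℕ) : ℂ) = -n - 1 := by
      have := congrArg (Int.cast : ℤ → ℂ) (Int.toNat_of_nonneg hn0)
      push_cast at this; exact this
    rw [← Complex.exp_nat_mul, hcast, mul_assoc, mul_assoc, ← Complex.exp_add, Complex.ofReal_exp,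
      ← Complex.exp_add]
    congr 2
    push_cast; ring
  have hpn : ∀ σ : ℝ, σ ≤ 0 →
      ∫ θ in (0 : ℝ)..(2 * Real.pi), ‖p (Complex.exp (σ + θ * Complex.I))‖ ^ 2 ≤ L := by
    intro σ hσ
    have e : ∀ θ : ℝ, ‖p (Complex.exp (σ + θ * Complex.I))‖ =
        ‖trigSum Sm (fun n => c n * (Real.exp ((-n - 1) * σ) : ℝ)) θ‖ := fun θ => by
      rw [← RCLike.norm_conj (trigSum _ _ _), ← hpe, norm_mul,
        Complex.norm_exp_ofReal_mul_I, mul_one]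
    simp_rw [e]
    rw [integral_norm_trigSum_sq, hL]
    gcongr with n hn
    rw [norm_mul, Complex.norm_real, Real.norm_of_nonneg (Real.exp_pos _).le]
    refine mul_le_of_le_one_right (norm_nonneg _) (Real.exp_le_one_iff.mpr ?_)
    have hn0 : (0 : ℝ) ≤ -n - 1 := by
      have := (Finset.mem_filter.mp hn).2
      have h : (0 : ℤ) ≤ -n - 1 := by omega
      exact_mod_cast h
    nlinarith
  have hpe0 : ∀ θ : ℝ, p (Complex.exp (θ * Complex.I)) * Complex.exp (θ * Complex.I) =
      (starRingEnd ℂ) (trigSum Sm c θ) := fun θ => by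
    have := hpe 0 θ
    simpa using this
  have hcm := continuous_trigSum Sm c
  have hcS := continuous_trigSum S c
  have hccj : Continuous (starRingEnd ℂ) := Complex.continuous_conj
  have hcv : Continuous fun θ : ℝ => v (Complex.exp (θ * Complex.I)) := by fun_prop
  have hcu : Continuous fun θ : ℝ => u (Complex.exp (θ * Complex.I)) := by
    have := hud.continuous; fun_prop
  have hLint : ∫ θ in (0 : ℝ)..(2 * Real.pi), ‖trigSum Sm c θ‖ ^ 2 = L :=
    integral_norm_trigSum_sq _ _
  have hLb : L ≤ 2 * κ ^ 2 := by
    rcases hL0.eq_or_lt with h0 | hpos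
    · rw [← h0]; positivity
    set l := Real.sqrt L with hl
    have hlpos : 0 < l := Real.sqrt_pos.mpr hpos
    have hll : l ^ 2 = L := Real.sq_sqrt hL0
    have h1 := H (fun z => (l : ℂ)⁻¹ * p z) (by fun_prop) (by
      intro σ hσ
      simp_rw [norm_mul, norm_inv, Complex.norm_real, Real.norm_of_nonneg hlpos.le, mul_pow]
      rw [intervalIntegral.integral_const_mul, inv_pow, hll, inv_mul_le_iff₀ hpos, mul_one]
      exact hpn σ hσ)
    have h2 : ‖∫ θ in (0 : ℝ)..(2 * Real.pi), v (Complex.exp (θ * Complex.I)) *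
        (starRingEnd ℂ) (trigSum Sm c θ)‖ ≤ κ * l := by
      simp_rw [mul_assoc, hpe0, mul_left_comm _ ((l : ℂ)⁻¹)] at h1
      rw [intervalIntegral.integral_const_mul, norm_mul, norm_inv, Complex.norm_real,
        Real.norm_of_nonneg hlpos.le, inv_mul_le_iff₀ hlpos] at h1
      linarith
    have h3 : ‖∫ θ in (0 : ℝ)..(2 * Real.pi), (v (Complex.exp (θ * Complex.I)) - trigSum S c θ) *
        (starRingEnd ℂ) (trigSum Sm c θ)‖ ≤ κ / 16 * (4 * l) := by
      refine (intervalIntegral.norm_integral_le_of_norm_le (by positivity)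
        (g := fun θ => κ / 16 * ((‖trigSum Sm c θ‖ ^ 2 * l⁻¹ + l) / 2))
        (Eventually.of_forall fun θ _ => ?_) ?_).trans ?_
      · rw [norm_mul, RCLike.norm_conj]
        gcongr
        · exact hq θ
        · have : 0 ≤ (‖trigSum Sm c θ‖ - l) ^ 2 * l⁻¹ := by positivity
          have e : (‖trigSum Sm c θ‖ - l) ^ 2 * l⁻¹ =
            ‖trigSum Sm c θ‖ ^ 2 * l⁻¹ + l - 2 * ‖trigSum Sm c θ‖ := by field_simp; ring
          linarith
      · apply Continuous.intervalIntegrable; fun_prop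
      · rw [intervalIntegral.integral_const_mul, intervalIntegral.integral_div,
          intervalIntegral.integral_add
          (by apply Continuous.intervalIntegrable; fun_prop) intervalIntegrable_const,
          intervalIntegral.integral_mul_const, hLint, intervalIntegral.integral_const, ← hll]
        gcongr
        rw [show l ^ 2 * l⁻¹ = l by field_simp, smul_eq_mul]
        nlinarith
    have h4 := integral_trigSum_mul_conj (Finset.filter_subset (· < 0) S) c c
    have h5 : ∫ θ in (0 : ℝ)..(2 * Real.pi), trigSum S c θ * (starRingEnd ℂ) (trigSum Sm c θ) =
        (L : ℂ) := by
      rw [h4, hL]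
      simp_rw [Complex.mul_conj, Complex.normSq_eq_norm_sq]
      push_cast; rfl
    have h6 : (L : ℂ) = (∫ θ in (0 : ℝ)..(2 * Real.pi), v (Complex.exp (θ * Complex.I)) *
        (starRingEnd ℂ) (trigSum Sm c θ)) - ∫ θ in (0 : ℝ)..(2 * Real.pi),
          (v (Complex.exp (θ * Complex.I)) - trigSum S c θ) * (starRingEnd ℂ) (trigSum Sm c θ) := by
      rw [← intervalIntegral.integral_sub (by apply Continuous.intervalIntegrable; fun_prop)
        (by apply Continuous.intervalIntegrable; fun_prop), ← h5]
      congr 1; funext θ; ring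
    have h7 : L ≤ κ * l + κ / 16 * (4 * l) := by
      have : ‖(L : ℂ)‖ ≤ κ * l + κ / 16 * (4 * l) := by
        rw [h6]; exact (norm_sub_le _ _).trans (add_le_add h2 h3)
      rwa [Complex.norm_real, Real.norm_of_nonneg hL0] at this
    have h8 : l ≤ 5 / 4 * κ := by
      rw [← hll] at h7
      nlinarith
    rw [← hll]; nlinarith
  calc _ ≤ ∫ θ in (0 : ℝ)..(2 * Real.pi), (2 * (κ / 16) ^ 2 + 2 * ‖trigSum Sm c θ‖ ^ 2) := by
        refine intervalIntegral.integral_mono_on (by positivity)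
          (by apply Continuous.intervalIntegrable; fun_prop)
          (by apply Continuous.intervalIntegrable; fun_prop) fun θ _ => ?_
        have e : u (Complex.exp (θ * Complex.I)) - v (Complex.exp (θ * Complex.I)) =
            -(v (Complex.exp (θ * Complex.I)) - trigSum S c θ) - trigSum Sm c θ := by
          rw [hue, hsplit]; ring
        have h1 : ‖u (Complex.exp (θ * Complex.I)) - v (Complex.exp (θ * Complex.I))‖ ≤
            κ / 16 + ‖trigSum Sm c θ‖ := by
          rw [e]
          refine (norm_sub_le _ _).trans ?_
          rw [norm_neg]
          gcongr
          exact hq θ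
        have h2 := pow_le_pow_left₀ (norm_nonneg _) h1 2
        nlinarith [sq_nonneg (κ / 16 - ‖trigSum Sm c θ‖)]
    _ = 2 * Real.pi * (2 * (κ / 16) ^ 2) + 2 * L := by
        rw [intervalIntegral.integral_add intervalIntegrable_const
          (by apply Continuous.intervalIntegrable; fun_prop), intervalIntegral.integral_const,
          intervalIntegral.integral_const_mul, hLint, smul_eq_mul, sub_zero]
    _ ≤ 16 * κ ^ 2 := by nlinarith [sq_nonneg κ]

/-- Values of an entire function in the half disc are controlled by the boundary mean. -/
lemma norm_le_integral_circle {w : ℂ → ℂ} (hw : Differentiable ℂ w) {z : ℂ} (hz : ‖z‖ ≤ 1 / 2) :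
    ‖w z‖ ≤ ∫ θ in (0 : ℝ)..(2 * Real.pi), ‖w (Complex.exp (θ * Complex.I))‖ := by
  have h := (hw.diffContOnCl (s := ball 0 1)).circleIntegral_sub_inv_smul
    (mem_ball_zero_iff.mpr (hz.trans_lt (by norm_num)))
  rw [circleIntegral] at h
  have hpi := Real.pi_gt_three
  have hcw := hw.continuous
  have hn : ‖(2 * (Real.pi : ℂ) * Complex.I) • w z‖ ≤
      ∫ θ in (0 : ℝ)..(2 * Real.pi), 2 * ‖w (Complex.exp (θ * Complex.I))‖ := by
    rw [← h]
    refine intervalIntegral.norm_integral_le_of_norm_le (by positivity)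
      (Eventually.of_forall fun θ _ => ?_) (by apply Continuous.intervalIntegrable; fun_prop)
    rw [deriv_circleMap, norm_smul, norm_smul]
    have e : circleMap 0 1 θ = Complex.exp (θ * Complex.I) := by simp [circleMap]
    have h1 : ‖Complex.exp (θ * Complex.I)‖ = 1 := Complex.norm_exp_ofReal_mul_I θ
    rw [e, norm_mul, Complex.norm_I, mul_one, norm_inv, h1, one_mul]
    gcongr
    have h2 : 1 / 2 ≤ ‖Complex.exp (θ * Complex.I) - z‖ := by
      have := norm_sub_norm_le (Complex.exp (θ * Complex.I)) z
      linarith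
    rw [inv_le_comm₀ (by linarith) (by norm_num)]
    linarith
  rw [intervalIntegral.integral_const_mul, norm_smul] at hn
  simp only [norm_mul, Complex.norm_I, mul_one, Complex.norm_real, Complex.norm_ofNat,
    Real.norm_of_nonneg Real.pi_pos.le] at hn
  nlinarith [norm_nonneg (w z)]

/-- Algebraic bounds for the regularised quotient. -/
lemma regQuot_bounds {j : ℕ} (hj : 1 ≤ j) {a b : ℂ} {C τ : ℝ} (hC : 1 ≤ C) (hτ : 0 < τ)
    (hτ1 : τ ≤ 1) (ha : ‖a‖ ≤ 1)
    (hab : ‖a ^ (j + 1) - b ^ j‖ ≤ C * (τ ^ j) ^ (j + 1)) :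
    ‖b‖ * τ ^ j ≤ (4 + 4 * C ^ 2) * τ * (‖a‖ ^ 2 + (τ ^ j) ^ 2) ∧
      ‖b‖ * ‖a‖ ≤ (4 + 4 * C ^ 2) * (‖a‖ ^ 2 + (τ ^ j) ^ 2) := by
  set s := τ ^ j with hs
  have hs0 : 0 < s := by positivity
  have hs1 : s ≤ 1 := pow_le_one₀ hτ.le hτ1
  set N := ‖a‖ ^ 2 + s ^ 2 with hN
  have hN0 : 0 < N := by positivity
  have hN2 : N ≤ 2 := by nlinarith [norm_nonneg a]
  have haN : ‖a‖ ^ 2 ≤ N := by nlinarith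
  have hsN : s ^ 2 ≤ N := by nlinarith [sq_nonneg ‖a‖]
  have h1 : ‖b‖ ^ j ≤ ‖a‖ ^ (j + 1) + C * s ^ (j + 1) := by
    have := norm_sub_norm_le (b ^ j) (a ^ (j + 1))
    rw [norm_pow, norm_pow, norm_sub_rev] at this
    linarith
  have h2 : ‖b‖ ^ (2 * j) ≤ (2 + 2 * C ^ 2) * N ^ (j + 1) := by
    have e1 : ‖a‖ ^ (2 * (j + 1)) ≤ N ^ (j + 1) := by rw [pow_mul]; gcongr
    have e2 : s ^ (2 * (j + 1)) ≤ N ^ (j + 1) := by rw [pow_mul]; gcongr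
    calc ‖b‖ ^ (2 * j) = (‖b‖ ^ j) ^ 2 := by ring
      _ ≤ (‖a‖ ^ (j + 1) + C * s ^ (j + 1)) ^ 2 := by gcongr
      _ ≤ 2 * ‖a‖ ^ (2 * (j + 1)) + 2 * C ^ 2 * s ^ (2 * (j + 1)) := by
          have : 0 ≤ (‖a‖ ^ (j + 1) - C * s ^ (j + 1)) ^ 2 := sq_nonneg _
          have e : 2 * ‖a‖ ^ (2 * (j + 1)) + 2 * C ^ 2 * s ^ (2 * (j + 1)) =
            (‖a‖ ^ (j + 1) + C * s ^ (j + 1)) ^ 2 + (‖a‖ ^ (j + 1) - C * s ^ (j + 1)) ^ 2 := by ring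
          linarith
      _ ≤ 2 * N ^ (j + 1) + 2 * C ^ 2 * N ^ (j + 1) := by gcongr
      _ = _ := by ring
  have hA : 2 * (2 + 2 * C ^ 2) ≤ (4 + 4 * C ^ 2) ^ (2 * j) := by
    have : (1 : ℝ) ≤ 4 + 4 * C ^ 2 := by nlinarith
    calc 2 * (2 + 2 * C ^ 2) = (4 + 4 * C ^ 2) ^ 1 := by ring
      _ ≤ _ := pow_le_pow_right₀ this (by omega)
  have hj0 : 2 * j ≠ 0 := by omega
  constructor
  · refine le_of_pow_le_pow_left₀ hj0 (by positivity) ?_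
    obtain ⟨i, rfl⟩ : ∃ i, j = i + 1 := ⟨j - 1, by omega⟩
    have e3 : s ^ (2 * i) ≤ N ^ i := by rw [pow_mul]; gcongr
    calc (‖b‖ * s) ^ (2 * (i + 1)) = ‖b‖ ^ (2 * (i + 1)) * (s ^ (2 * i) * s ^ 2) := by ring
      _ ≤ ((2 + 2 * C ^ 2) * N ^ (i + 1 + 1)) * (N ^ i * s ^ 2) := by gcongr
      _ = (2 + 2 * C ^ 2) * τ ^ (2 * (i + 1)) * N ^ (2 * (i + 1)) := by rw [hs]; ring
      _ ≤ (4 + 4 * C ^ 2) ^ (2 * (i + 1)) * τ ^ (2 * (i + 1)) * N ^ (2 * (i + 1)) := by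
          gcongr
          nlinarith
      _ = _ := by rw [mul_pow, mul_pow]
  · refine le_of_pow_le_pow_left₀ hj0 (by positivity) ?_
    calc (‖b‖ * ‖a‖) ^ (2 * j) = ‖b‖ ^ (2 * j) * (‖a‖ ^ 2) ^ j := by ring
      _ ≤ ((2 + 2 * C ^ 2) * N ^ (j + 1)) * N ^ j := by gcongr
      _ = (N * (2 + 2 * C ^ 2)) * N ^ (2 * j) := by ring
      _ ≤ (2 * (2 + 2 * C ^ 2)) * N ^ (2 * j) := by gcongr
      _ ≤ (4 + 4 * C ^ 2) ^ (2 * j) * N ^ (2 * j) := by gcongr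
      _ = _ := by rw [mul_pow]

lemma regQuot_mul_sub_le {g h : ℂ → ℂ} {z : ℂ} {s A : ℝ} (hs : 0 < s)
    (h1 : ‖h z‖ * s ≤ A * (‖g z‖ ^ 2 + s ^ 2)) : ‖g z * regQuot g h s z - h z‖ ≤ A * s := by
  have hN : 0 < ‖g z‖ ^ 2 + s ^ 2 := by positivity
  have hN' : ((‖g z‖ ^ 2 + s ^ 2 : ℝ) : ℂ) ≠ 0 := by exact_mod_cast hN.ne'
  have e : g z * regQuot g h s z - h z = -(h z * (s : ℂ) ^ 2) / ((‖g z‖ ^ 2 + s ^ 2 : ℝ) : ℂ) := by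
    rw [regQuot, eq_div_iff hN', sub_mul, mul_div_assoc', div_mul_cancel₀ _ hN', ← mul_conj_add_sq]
    ring
  rw [e, norm_div, norm_neg, norm_mul, norm_pow, Complex.norm_real, Complex.norm_real,
    Real.norm_of_nonneg hs.le, Real.norm_of_nonneg hN.le, div_le_iff₀ hN]
  nlinarith

lemma regQuot_pow_sub_le {g h : ℂ → ℂ} {z : ℂ} {s C : ℝ} {j : ℕ} (hs : 0 < s)
    (hab : ‖g z ^ (j + 1) - h z ^ j‖ ≤ C * s ^ (j + 1)) :
    ‖regQuot g h s z ^ j - g z‖ ≤ (j + C) * s := by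
  have hN : 0 < ‖g z‖ ^ 2 + s ^ 2 := by positivity
  have hN' : ((‖g z‖ ^ 2 + s ^ 2 : ℝ) : ℂ) ≠ 0 := by exact_mod_cast hN.ne'
  have hC : 0 ≤ C := by
    have := (norm_nonneg _).trans hab
    exact nonneg_of_mul_nonneg_left this (by positivity)
  set N := ‖g z‖ ^ 2 + s ^ 2 with hNd
  set x := ‖g z‖ ^ 2 / N with hx
  have hx0 : 0 ≤ x := by positivity
  have hx1 : 1 - x = s ^ 2 / N := by rw [hx]; field_simp; rw [hNd]; ring
  have hgs : ‖g z‖ * s ≤ N := by rw [hNd]; nlinarith [sq_nonneg (‖g z‖ - s), norm_nonneg (g z)]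
  have e : regQuot g h s z ^ j - g z = g z * ((x : ℂ) ^ j - 1) -
      (g z ^ (j + 1) - h z ^ j) * (starRingEnd ℂ) (g z) ^ j / (N : ℂ) ^ j := by
    have hxc : (x : ℂ) = g z * (starRingEnd ℂ) (g z) / N := by
      rw [Complex.mul_conj, Complex.normSq_eq_norm_sq, hx]; push_cast; rfl
    rw [hxc, regQuot, ← hNd, div_pow, div_pow, mul_pow, mul_pow]
    field_simp
    ring
  have hbern : 1 - x ^ j ≤ j * (1 - x) := by
    have := one_add_mul_le_pow (a := x - 1) (by linarith) j
    rw [add_sub_cancel] at this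
    linarith
  have hxle : x ≤ 1 := by
    have : 0 ≤ s ^ 2 / N := by positivity
    linarith
  have hxp : x ^ j ≤ 1 := pow_le_one₀ hx0 hxle
  have hn1 : ‖(x : ℂ) ^ j - 1‖ = 1 - x ^ j := by
    rw [← Complex.ofReal_pow, ← Complex.ofReal_one, ← Complex.ofReal_sub, Complex.norm_real,
      Real.norm_of_nonpos (by linarith)]; ring
  rw [e]
  refine (norm_sub_le _ _).trans ?_
  rw [norm_mul, hn1, norm_div, norm_mul, norm_pow, norm_pow, RCLike.norm_conj, Complex.norm_real,
    Real.norm_of_nonneg hN.le, add_mul]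
  refine add_le_add ?_ ?_
  · calc ‖g z‖ * (1 - x ^ j) ≤ ‖g z‖ * (j * (s ^ 2 / N)) := by rw [← hx1]; gcongr
      _ = j * s * ((‖g z‖ * s) / N) := by ring
      _ ≤ j * s * 1 := by gcongr; exact (div_le_one hN).mpr hgs
      _ = j * s := by ring
  · calc _ ≤ C * s ^ (j + 1) * ‖g z‖ ^ j / N ^ j := by gcongr
      _ = C * s * ((‖g z‖ * s) / N) ^ j := by rw [div_pow]; ring
      _ ≤ C * s * 1 := by
        gcongr
        exact pow_le_one₀ (by positivity) ((div_le_one hN).mpr hgs)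
      _ = C * s := by ring

lemma pairing_const_le {μ : ℝ} (hμ : 0 < μ) (hμ1 : μ ≤ 1) (j : ℕ) :
    μ ^ 2 * (2 * Real.pi / Real.log 2 *
      (Real.log (1 + ((μ ^ 2) ^ j) ^ 2) - Real.log (((μ ^ 2) ^ j) ^ 2)) / 4 + 1 / 2) ≤
    μ * (2 * Real.pi / Real.log 2 * (1 + 4 * j) / 4 + 1 / 2) := by
  have hl2 : 0 < Real.log 2 := Real.log_pos (by norm_num)
  have e1 : Real.log (((μ ^ 2) ^ j) ^ 2) = 4 * j * Real.log μ := by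
    rw [← pow_mul, ← pow_mul, Real.log_pow]; push_cast; ring
  have e2 : Real.log (1 + ((μ ^ 2) ^ j) ^ 2) ≤ 1 := by
    have h : ((μ ^ 2) ^ j) ^ 2 ≤ 1 := pow_le_one₀ (by positivity)
      (pow_le_one₀ (by positivity) (pow_le_one₀ hμ.le hμ1))
    have := Real.log_le_sub_one_of_pos (x := 1 + ((μ ^ 2) ^ j) ^ 2) (by positivity)
    linarith
  have e3 : -Real.log μ ≤ 1 / μ := by
    have := Real.log_le_sub_one_of_pos (x := μ⁻¹) (by positivity)
    rw [Real.log_inv] at this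
    rw [one_div]; linarith
  have e4 : μ * -Real.log μ ≤ 1 := by
    calc μ * -Real.log μ ≤ μ * (1 / μ) := by gcongr
      _ = 1 := by field_simp
  have e5 : μ * (Real.log (1 + ((μ ^ 2) ^ j) ^ 2) - Real.log (((μ ^ 2) ^ j) ^ 2)) ≤ 1 + 4 * j := by
    rw [e1]
    calc μ * (Real.log (1 + ((μ ^ 2) ^ j) ^ 2) - 4 * j * Real.log μ)
        = μ * Real.log (1 + ((μ ^ 2) ^ j) ^ 2) + 4 * j * (μ * -Real.log μ) := by ring
      _ ≤ 1 * 1 + 4 * j * 1 := by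
        gcongr
        exact Real.log_nonneg (by nlinarith [sq_nonneg ((μ ^ 2) ^ j)])
      _ = _ := by ring
  calc _ = μ * (2 * Real.pi / Real.log 2 * (μ *
      (Real.log (1 + ((μ ^ 2) ^ j) ^ 2) - Real.log (((μ ^ 2) ^ j) ^ 2))) / 4 + μ * (1 / 2)) := by ring
    _ ≤ _ := by gcongr; nlinarith

/-- Entire approximations of all powers of the regularised quotient. -/
lemma exists_entire_powers {j : ℕ} (hj : 1 ≤ j) (C : ℝ) (hC : 1 ≤ C) :
    ∃ A : ℝ, 1 ≤ A ∧ ∀ (g h : ℂ → ℂ), Differentiable ℂ g → Differentiable ℂ h → ∀ μ : ℝ, 0 < μ →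
      μ ≤ 1 → (∀ z : ℂ, ‖z‖ ≤ 2 → ‖g z‖ ≤ 1) →
      (∀ z : ℂ, ‖z‖ ≤ 1 → ‖g z ^ (j + 1) - h z ^ j‖ ≤ C * ((μ ^ 2) ^ j) ^ (j + 1)) →
      ∃ (v : ℂ → ℂ) (u : ℕ → ℂ → ℂ), Continuous v ∧ (∀ k, Differentiable ℂ (u k)) ∧
        (∀ k < j, ∫ θ in (0 : ℝ)..(2 * Real.pi), ‖u k (Complex.exp (θ * Complex.I)) -
          v (Complex.exp (θ * Complex.I)) ^ (k + 1)‖ ^ 2 ≤ 16 * (A * μ) ^ 2) ∧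
        (∀ z, ‖z‖ ≤ 1 → ‖v z‖ ≤ A ∧ ‖g z * v z - h z‖ ≤ A * μ ∧ ‖v z ^ j - g z‖ ≤ A * μ) := by
  set A₀ := 4 + 4 * C ^ 2 with hA₀
  have hA₀1 : 1 ≤ A₀ := by nlinarith
  set c := 2 * Real.pi / Real.log 2 * (1 + 4 * j) / 4 + 1 / 2 with hc
  have hl2 : 0 < Real.log 2 := Real.log_pos (by norm_num)
  have hc0 : 0 < c := by positivity
  set A₁ := j * A₀ ^ j * c with hA₁
  have hA₁0 : 0 ≤ A₁ := by positivity
  refine ⟨A₀ + A₁ + (j + C), by nlinarith [(Nat.cast_nonneg j : (0 : ℝ) ≤ j)], ?_⟩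
  intro g h hg hh μ hμ hμ1 hb hφ
  set s := (μ ^ 2) ^ j with hs
  have hs0 : 0 < s := by positivity
  have hμ2 : μ ^ 2 ≤ 1 := pow_le_one₀ hμ.le hμ1
  have hsμ : s ≤ μ := by
    calc s ≤ (μ ^ 2) ^ 1 := pow_le_pow_of_le_one (by positivity) hμ2 hj
      _ ≤ μ := by nlinarith
  have hbd : ∀ z : ℂ, ‖z‖ ≤ 1 → _ := fun z hz =>
    regQuot_bounds hj hC (by positivity : 0 < μ ^ 2) hμ2
    (hb z (hz.trans (by norm_num))) (hφ z hz)
  have hcv := continuous_regQuot hg.continuous hh.continuous hs0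
  have hex : ∀ k : ℕ, ∃ u : ℂ → ℂ, Differentiable ℂ u ∧ (k < j →
      ∫ θ in (0 : ℝ)..(2 * Real.pi), ‖u (Complex.exp (θ * Complex.I)) -
          regQuot g h s (Complex.exp (θ * Complex.I)) ^ (k + 1)‖ ^ 2 ≤
          16 * ((A₀ + A₁ + (j + C)) * μ) ^ 2) := by
    intro k
    by_cases hk : k < j
    · obtain ⟨u, hu, hu2⟩ := exists_entire_near_of_pairing (hcv.pow (k + 1))
        (κ := (A₀ + A₁ + (j + C)) * μ) (by positivity) (fun p hp hp2 => by
          refine (norm_integral_regQuot_pow_mul_le hg hh hp hs0 (by positivity : 0 ≤ μ ^ 2)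
            (by positivity : 0 ≤ A₀) hb (fun z hz => (hbd z hz).1) (fun z hz => (hbd z hz).2)
            hp2 k).trans ?_
          have hkj : ((k : ℝ) + 1) ≤ j := by exact_mod_cast hk
          rw [mul_assoc]
          calc _ ≤ j * A₀ ^ j * (μ * c) := by
                refine mul_le_mul ?_ (pairing_const_le hμ hμ1 j) ?_ (by positivity)
                · gcongr
                  exact hk
                · have : Real.log (s ^ 2) ≤ Real.log (1 + s ^ 2) :=
                    Real.log_le_log (by positivity) (by linarith)
                  have := sub_nonneg.mpr this
                  positivity
            _ = A₁ * μ := by ring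
            _ ≤ _ := by gcongr; linarith [(Nat.cast_nonneg j : (0 : ℝ) ≤ j)])
      exact ⟨u, hu, fun _ => hu2⟩
    · exact ⟨0, differentiable_const 0, fun h => absurd h hk⟩
  choose u hu hu2 using hex
  refine ⟨regQuot g h s, u, hcv, hu, fun k hk => hu2 k hk, fun z hz => ⟨?_, ?_, ?_⟩⟩
  · rw [norm_regQuot, div_le_iff₀ (by positivity)]
    refine (hbd z hz).2.trans (mul_le_mul_of_nonneg_right ?_ (by positivity))
    linarith [(Nat.cast_nonneg j : (0 : ℝ) ≤ j)]
  · refine (regQuot_mul_sub_le (A := A₀ * μ ^ 2) hs0 (hbd z hz).1).trans ?_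
    calc A₀ * μ ^ 2 * s ≤ A₀ * 1 * μ := by gcongr
      _ ≤ _ := by
        rw [mul_one]; gcongr; linarith [(Nat.cast_nonneg j : (0 : ℝ) ≤ j)]
  · exact (regQuot_pow_sub_le hs0 (hφ z hz)).trans
      (mul_le_mul (by linarith) hsμ hs0.le (by positivity))

lemma integral_le_of_integral_sq_le {e : ℝ → ℝ} (he : Continuous e) {κ : ℝ} (hκ : 0 < κ)
    (h : ∫ θ in (0 : ℝ)..(2 * Real.pi), e θ ^ 2 ≤ 16 * κ ^ 2) :
    ∫ θ in (0 : ℝ)..(2 * Real.pi), e θ ≤ 12 * κ := by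
  have hpi := Real.pi_lt_d2
  calc _ ≤ ∫ θ in (0 : ℝ)..(2 * Real.pi), (e θ ^ 2 * (κ⁻¹ / 2) + κ / 2) := by
        refine intervalIntegral.integral_mono_on (by positivity) (he.intervalIntegrable _ _)
          (by apply Continuous.intervalIntegrable; fun_prop) fun θ _ => ?_
        have : 0 ≤ (e θ - κ) ^ 2 * (κ⁻¹ / 2) := by positivity
        have e1 : (e θ - κ) ^ 2 * (κ⁻¹ / 2) = e θ ^ 2 * (κ⁻¹ / 2) + κ / 2 - e θ := by
          field_simp; ring
        linarith
    _ = (∫ θ in (0 : ℝ)..(2 * Real.pi), e θ ^ 2) * (κ⁻¹ / 2) + 2 * Real.pi * (κ / 2) := by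
        rw [intervalIntegral.integral_add (by apply Continuous.intervalIntegrable; fun_prop)
          intervalIntegrable_const, intervalIntegral.integral_mul_const,
          intervalIntegral.integral_const, smul_eq_mul, sub_zero]
    _ ≤ 16 * κ ^ 2 * (κ⁻¹ / 2) + 2 * Real.pi * (κ / 2) := by gcongr
    _ = 8 * κ + Real.pi * κ := by field_simp; ring
    _ ≤ 12 * κ := by nlinarith

lemma integral_mul_le_of_integral_sq_le {e f : ℝ → ℝ} (he : Continuous e)
    (hf : Continuous f) {κ : ℝ}
    (h : ∫ θ in (0 : ℝ)..(2 * Real.pi), e θ ^ 2 ≤ 16 * κ ^ 2)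
    (h' : ∫ θ in (0 : ℝ)..(2 * Real.pi), f θ ^ 2 ≤ 16 * κ ^ 2) :
    ∫ θ in (0 : ℝ)..(2 * Real.pi), e θ * f θ ≤ 16 * κ ^ 2 := by
  calc _ ≤ ∫ θ in (0 : ℝ)..(2 * Real.pi), (e θ ^ 2 * (1 / 2) + f θ ^ 2 * (1 / 2)) := by
        refine intervalIntegral.integral_mono_on (by positivity)
          (by apply Continuous.intervalIntegrable; fun_prop)
          (by apply Continuous.intervalIntegrable; fun_prop) fun θ _ => ?_
        nlinarith [sq_nonneg (e θ - f θ)]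
    _ = _ := by
        rw [intervalIntegral.integral_add (by apply Continuous.intervalIntegrable; fun_prop)
          (by apply Continuous.intervalIntegrable; fun_prop), intervalIntegral.integral_mul_const,
          intervalIntegral.integral_mul_const]
    _ ≤ _ := by linarith

/-- An approximate `j`-th root of `g` which is also an approximate quotient `h / g`. -/
lemma exists_entire_root {j : ℕ} (hj : 1 ≤ j) (C : ℝ) (hC : 1 ≤ C) :
    ∃ B : ℝ, 1 ≤ B ∧ ∀ (g h : ℂ → ℂ), Differentiable ℂ g → Differentiable ℂ h → ∀ μ : ℝ, 0 < μ →
      μ ≤ 1 → (∀ z : ℂ, ‖z‖ ≤ 2 → ‖g z‖ ≤ 1) →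
      (∀ z : ℂ, ‖z‖ ≤ 1 → ‖g z ^ (j + 1) - h z ^ j‖ ≤ C * ((μ ^ 2) ^ j) ^ (j + 1)) →
      ∃ u : ℂ → ℂ, Differentiable ℂ u ∧ ∀ z : ℂ, ‖z‖ ≤ 1 / 2 →
        ‖u z‖ ≤ B ∧ ‖u z ^ j - g z‖ ≤ B * μ ∧ ‖g z * u z - h z‖ ≤ B * μ := by
  obtain ⟨A, hA, H⟩ := exists_entire_powers hj C hC
  set Q := 52 * A ^ (j + 1) with hQ
  have hQ0 : 0 ≤ Q := by positivity
  refine ⟨j * (19 * A) ^ j * Q + 19 * A, by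
    have : 0 ≤ j * (19 * A) ^ j * Q := by positivity
    linarith, ?_⟩
  intro g h hg hh μ hμ hμ1 hb hφ
  obtain ⟨v, u, hcv, hu, huv, hv⟩ := H g h hg hh μ hμ hμ1 hb hφ
  have hpi := Real.pi_lt_d2
  have hpi0 := Real.pi_pos
  set κ := A * μ with hκ
  have hκ0 : 0 < κ := by positivity
  have hκA : κ ≤ A := by rw [hκ]; nlinarith
  have hn1 : ∀ θ : ℝ, ‖Complex.exp (θ * Complex.I)‖ = 1 := Complex.norm_exp_ofReal_mul_I
  set e : ℕ → ℝ → ℝ := fun k θ => ‖u k (Complex.exp (θ * Complex.I)) -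
          v (Complex.exp (θ * Complex.I)) ^ (k + 1)‖ with he
  have hce : ∀ k, Continuous (e k) := fun k => by
    have := (hu k).continuous
    rw [he]; fun_prop
  have he0 : ∀ k θ, 0 ≤ e k θ := fun k θ => norm_nonneg _
  have he1 : ∀ k < j, ∫ θ in (0 : ℝ)..(2 * Real.pi), e k θ ≤ 12 * κ := fun k hk =>
    integral_le_of_integral_sq_le (hce k) hκ0 (huv k hk)
  have bound : ∀ (w : ℂ → ℂ) (k : ℕ) (b : ℝ), Differentiable ℂ w → k < j →
      (∀ θ : ℝ, ‖w (Complex.exp (θ * Complex.I))‖ ≤ e k θ + b) → 0 ≤ b →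
      ∀ z, ‖z‖ ≤ 1 / 2 → ‖w z‖ ≤ 12 * κ + 7 * b := by
    intro w k b hw hk hwe hb0 z hz
    have hcw := hw.continuous
    calc ‖w z‖ ≤ _ := norm_le_integral_circle hw hz
      _ ≤ ∫ θ in (0 : ℝ)..(2 * Real.pi), (e k θ + b) :=
        intervalIntegral.integral_mono_on (by positivity)
          (by apply Continuous.intervalIntegrable; fun_prop)
          (((hce k).add continuous_const).intervalIntegrable _ _) fun θ _ => hwe θ
      _ = (∫ θ in (0 : ℝ)..(2 * Real.pi), e k θ) + 2 * Real.pi * b := by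
        rw [intervalIntegral.integral_add ((hce k).intervalIntegrable _ _) intervalIntegrable_const,
          intervalIntegral.integral_const, smul_eq_mul, sub_zero]
      _ ≤ 12 * κ + 7 * b := by
        have := he1 k hk
        nlinarith
  have hu0 : ∀ z, ‖z‖ ≤ 1 / 2 → ‖u 0 z‖ ≤ 19 * A := fun z hz => by
    refine (bound (u 0) 0 A (hu 0) (by omega) (fun θ => ?_) (by linarith) z hz).trans (by linarith)
    have h1 := norm_sub_norm_le (u 0 (Complex.exp (θ * Complex.I)))
      (v (Complex.exp (θ * Complex.I)) ^ (0 + 1))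
    have h2 := (hv _ (hn1 θ).le).1
    rw [zero_add, pow_one] at h1
    simp only [he, zero_add, pow_one]
    linarith
  have hquot : ∀ z, ‖z‖ ≤ 1 / 2 → ‖g z * u 0 z - h z‖ ≤ 19 * A * μ := fun z hz => by
    refine (bound (fun z => g z * u 0 z - h z) 0 (A * μ) ((hg.mul (hu 0)).sub hh) (by omega)
      (fun θ => ?_) hκ0.le z hz).trans (by linarith)
    set ζ := Complex.exp (θ * Complex.I) with hζ
    have h2 := (hv ζ (hn1 θ).le).2.1
    have h3 := hb ζ ((hn1 θ).le.trans (by norm_num))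
    have e1 : g ζ * u 0 ζ - h ζ = g ζ * (u 0 ζ - v ζ) + (g ζ * v ζ - h ζ) := by ring
    simp only [he, zero_add, pow_one]
    rw [e1]
    refine (norm_add_le _ _).trans (add_le_add ?_ h2)
    rw [norm_mul]
    exact mul_le_of_le_one_left (norm_nonneg _) h3
  have hlast : ∀ z, ‖z‖ ≤ 1 / 2 → ‖u (j - 1) z - g z‖ ≤ 19 * A * μ := fun z hz => by
    refine (bound (fun z => u (j - 1) z - g z) (j - 1) (A * μ) ((hu _).sub hg) (by omega)
      (fun θ => ?_) hκ0.le z hz).trans (by linarith)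
    set ζ := Complex.exp (θ * Complex.I) with hζ
    have h2 := (hv ζ (hn1 θ).le).2.2
    have e1 : u (j - 1) ζ - g ζ = (u (j - 1) ζ - v ζ ^ (j - 1 + 1)) + (v ζ ^ j - g ζ) := by
      rw [Nat.sub_add_cancel hj]; ring
    rw [e1]
    exact (norm_add_le _ _).trans (add_le_add le_rfl h2)
  have hmul : ∀ k, k + 1 < j → ∀ z, ‖z‖ ≤ 1 / 2 → ‖u 0 z * u k z - u (k + 1) z‖ ≤ Q * μ := by
    intro k hk z hz
    have hd : Differentiable ℂ fun z => u 0 z * u k z - u (k + 1) z :=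
      ((hu 0).mul (hu k)).sub (hu (k + 1))
    have hcd := hd.continuous
    have hAk : A ^ (k + 1) ≤ A ^ j := pow_le_pow_right₀ hA hk.le
    have hA1 : A ≤ A ^ j := le_self_pow₀ hA (by omega)
    have hcn : Continuous fun θ : ℝ => ‖u 0 (Complex.exp (θ * Complex.I)) *
        u k (Complex.exp (θ * Complex.I)) - u (k + 1) (Complex.exp (θ * Complex.I))‖ :=
      (hcd.comp (g := fun z => u 0 z * u k z - u (k + 1) z)
        (f := fun θ : ℝ => Complex.exp (θ * Complex.I)) (by fun_prop)).norm
    have c0 := hce 0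
    have ck := hce k
    have ck1 := hce (k + 1)
    calc _ ≤ _ := norm_le_integral_circle hd hz
      _ ≤ ∫ θ in (0 : ℝ)..(2 * Real.pi), (e 0 θ * e k θ + (A ^ j * e k θ + (A ^ j * e 0 θ +
          e (k + 1) θ))) := by
        refine intervalIntegral.integral_mono_on (by positivity)
          (hcn.intervalIntegrable _ _)
          (by apply Continuous.intervalIntegrable; fun_prop) fun θ _ => ?_
        set ζ := Complex.exp (θ * Complex.I) with hζ
        have h2 := (hv ζ (hn1 θ).le).1
        have e1 : u 0 ζ * u k ζ - u (k + 1) ζ = (u 0 ζ - v ζ ^ (0 + 1)) * (u k ζ - v ζ ^ (k + 1)) +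
          (v ζ * (u k ζ - v ζ ^ (k + 1)) + (v ζ ^ (k + 1) * (u 0 ζ - v ζ ^ (0 + 1)) -
            (u (k + 1) ζ - v ζ ^ (k + 1 + 1)))) := by ring
        rw [e1]
        refine (norm_add_le _ _).trans (add_le_add (norm_mul_le _ _) ?_)
        refine (norm_add_le _ _).trans (add_le_add ?_ ?_)
        · rw [norm_mul]
          exact mul_le_mul_of_nonneg_right (h2.trans hA1) (norm_nonneg _)
        refine (norm_sub_le _ _).trans (add_le_add ?_ le_rfl)
        rw [norm_mul, norm_pow]
        refine mul_le_mul_of_nonneg_right ?_ (norm_nonneg _)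
        exact (pow_le_pow_left₀ (norm_nonneg _) h2 _).trans hAk
      _ = (∫ θ in (0 : ℝ)..(2 * Real.pi), e 0 θ * e k θ) +
          (A ^ j * (∫ θ in (0 : ℝ)..(2 * Real.pi), e k θ) +
          (A ^ j * (∫ θ in (0 : ℝ)..(2 * Real.pi), e 0 θ) +
          ∫ θ in (0 : ℝ)..(2 * Real.pi), e (k + 1) θ)) := by
        rw [intervalIntegral.integral_add (by apply Continuous.intervalIntegrable; fun_prop)
          (by apply Continuous.intervalIntegrable; fun_prop),
          intervalIntegral.integral_add (by apply Continuous.intervalIntegrable; fun_prop)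
          (by apply Continuous.intervalIntegrable; fun_prop),
          intervalIntegral.integral_add (by apply Continuous.intervalIntegrable; fun_prop)
          (by apply Continuous.intervalIntegrable; fun_prop),
          intervalIntegral.integral_const_mul, intervalIntegral.integral_const_mul]
      _ ≤ 16 * κ ^ 2 + (A ^ j * (12 * κ) + (A ^ j * (12 * κ) + 12 * κ)) := by
        gcongr
        · exact integral_mul_le_of_integral_sq_le c0 ck (huv 0 (by omega)) (huv k (by omega))
        · exact he1 k (by omega)
        · exact he1 0 (by omega)
        · exact he1 (k + 1) hk
      _ ≤ 16 * (A ^ j * κ) + (A ^ j * (12 * κ) + (A ^ j * (12 * κ) + A ^ j * (12 * κ))) := by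
        have : 1 ≤ A ^ j := hA.trans hA1
        have a1 : κ * κ ≤ A ^ j * κ := mul_le_mul_of_nonneg_right (hκA.trans hA1) hκ0.le
        have a2 : 12 * κ ≤ A ^ j * (12 * κ) := le_mul_of_one_le_left (by positivity) this
        rw [sq]
        linarith
      _ = Q * μ := by rw [hQ, hκ]; ring
  have hpow : ∀ k, k < j → ∀ z, ‖z‖ ≤ 1 / 2 → ‖u 0 z ^ (k + 1) - u k z‖ ≤
      k * (19 * A) ^ k * Q * μ := by
    intro k
    induction k with
    | zero => intro _ z _; simp
    | succ k ih =>
      intro hk z hz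
      have h1 := ih (by omega) z hz
      have h2 := hmul k hk z hz
      have e1 : u 0 z ^ (k + 1 + 1) - u (k + 1) z = u 0 z * (u 0 z ^ (k + 1) - u k z) +
        (u 0 z * u k z - u (k + 1) z) := by ring
      rw [e1]
      have h3 : 1 ≤ (19 * A) ^ (k + 1) := one_le_pow₀ (by linarith)
      calc _ ≤ ‖u 0 z‖ * ‖u 0 z ^ (k + 1) - u k z‖ + ‖u 0 z * u k z - u (k + 1) z‖ := by
            rw [← norm_mul]; exact norm_add_le _ _
        _ ≤ (19 * A) * (k * (19 * A) ^ k * Q * μ) + Q * μ := by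
            gcongr
            exact hu0 z hz
        _ ≤ (19 * A) * (k * (19 * A) ^ k * Q * μ) + (19 * A) ^ (k + 1) * (Q * μ) := by
            exact add_le_add le_rfl (le_mul_of_one_le_left (by positivity) h3)
        _ = _ := by push_cast; ring
  have hjQ : 0 ≤ j * (19 * A) ^ j * Q := by positivity
  refine ⟨u 0, hu 0, fun z hz => ⟨(hu0 z hz).trans (by linarith), ?_, ?_⟩⟩
  · have h1 := hpow (j - 1) (by omega) z hz
    have h2 := hlast z hz
    rw [Nat.sub_add_cancel hj] at h1
    have e1 : u 0 z ^ j - g z = (u 0 z ^ j - u (j - 1) z) + (u (j - 1) z - g z) := by ring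
    rw [e1, add_mul]
    refine (norm_add_le _ _).trans (add_le_add (h1.trans ?_) h2)
    gcongr
    · omega
    · linarith
    · omega
  · refine (hquot z hz).trans ?_
    gcongr
    linarith

lemma norm_pow_sub_pow_le {a b : ℂ} {r : ℝ} (ha : ‖a‖ ≤ r) (hb : ‖b‖ ≤ r) (hr : 1 ≤ r) (n : ℕ) :
    ‖a ^ n - b ^ n‖ ≤ n * r ^ n * ‖a - b‖ := by
  induction n with
  | zero => simp
  | succ n ih =>
    have e : a ^ (n + 1) - b ^ (n + 1) = a * (a ^ n - b ^ n) + (a - b) * b ^ n := by ring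
    have hr' : r ^ n ≤ r ^ (n + 1) := pow_le_pow_right₀ hr (by omega)
    calc _ ≤ ‖a‖ * ‖a ^ n - b ^ n‖ + ‖a - b‖ * ‖b‖ ^ n := by
          rw [e, ← norm_pow, ← norm_mul, ← norm_mul]; exact norm_add_le _ _
      _ ≤ r * (n * r ^ n * ‖a - b‖) + ‖a - b‖ * r ^ (n + 1) := by
          refine add_le_add (mul_le_mul ha ih (norm_nonneg _) (by linarith)) ?_
          exact mul_le_mul_of_nonneg_left
            ((pow_le_pow_left₀ (norm_nonneg _) hb n).trans hr') (norm_nonneg _)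
      _ = _ := by push_cast; ring

lemma exists_entire_near_root_unit {j : ℕ} (hj : 1 ≤ j) :
    ∃ B : ℝ, 1 ≤ B ∧ ∀ (g h : ℂ → ℂ) (F : ℝ → ℂ), Differentiable ℂ g → Differentiable ℂ h →
      ∀ ν : ℝ, 0 < ν → ν ≤ 1 → (∀ z : ℂ, ‖z‖ ≤ 1 → ‖g z‖ ≤ 1 ∧ ‖h z‖ ≤ 1) →
      (∀ s : ℝ, |s| ≤ 1 → ‖g s - F s ^ j‖ ≤ ν ^ (16 * j ^ 2 * (j + 1)) ∧
        ‖h s - F s ^ (j + 1)‖ ≤ ν ^ (16 * j ^ 2 * (j + 1))) →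
      ∃ u : ℂ → ℂ, Differentiable ℂ u ∧ (∀ z : ℂ, ‖z‖ ≤ 1 / 12 → ‖u z‖ ≤ B) ∧
        ∀ s : ℝ, |s| ≤ 1 / 12 → ‖u s - F s‖ ≤ B * ν := by
  set C₀ : ℝ := (j + 1) * 2 ^ (j + 1) + (j + 1) * 2 ^ (j + 1) with hC₀
  have hC1 : 1 ≤ C₀ := by
    have : (1 : ℝ) ≤ 2 ^ (j + 1) := one_le_pow₀ (by norm_num)
    have hj0 : (0 : ℝ) ≤ j := by positivity
    nlinarith
  obtain ⟨B, hB, H⟩ := exists_entire_root hj (8 * C₀) (by linarith)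
  refine ⟨2 * B + 4, by linarith, ?_⟩
  intro g h F hg hh ν hν hν1 hb ha
  set δ := ν ^ (16 * j ^ 2 * (j + 1)) with hδ
  have hδ0 : 0 < δ := by positivity
  have hδ1 : δ ≤ 1 := pow_le_one₀ hν.le hν1
  have hr : ∀ s : ℝ, |s| ≤ 1 → ‖(s : ℂ)‖ ≤ 1 := fun s hs => by simpa using hs
  have hF : ∀ s : ℝ, |s| ≤ 1 → ‖F s ^ j‖ ≤ 2 ∧ ‖F s ^ (j + 1)‖ ≤ 2 := fun s hs => by
    have h1 := norm_sub_norm_le (F s ^ j) (g s)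
    have h2 := norm_sub_norm_le (F s ^ (j + 1)) (h s)
    rw [norm_sub_rev] at h1 h2
    have h3 := hb s (hr s hs)
    have h4 := ha s hs
    constructor <;> linarith
  set φ : ℂ → ℂ := fun z => g z ^ (j + 1) - h z ^ j with hφ
  have hφd : Differentiable ℂ φ := (hg.pow _).sub (hh.pow _)
  have hφb : ∀ z : ℂ, ‖z‖ ≤ 1 → ‖φ z‖ ≤ 2 := fun z hz => by
    refine (norm_sub_le _ _).trans ?_
    rw [norm_pow, norm_pow]
    have h1 := pow_le_one₀ (norm_nonneg _) (hb z hz).1 (n := j + 1)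
    have h2 := pow_le_one₀ (norm_nonneg _) (hb z hz).2 (n := j)
    linarith
  have hφr : ∀ s : ℝ, |s| ≤ 1 → ‖φ s‖ ≤ C₀ * δ := fun s hs => by
    have h3 := hb s (hr s hs)
    have h4 := ha s hs
    have h5 := norm_pow_sub_pow_le (h3.1.trans one_le_two) (hF s hs).1 one_le_two (j + 1)
    have h6 := norm_pow_sub_pow_le (h3.2.trans one_le_two) (hF s hs).2 one_le_two j
    have e : φ s = (g s ^ (j + 1) - (F s ^ j) ^ (j + 1)) - (h s ^ j - (F s ^ (j + 1)) ^ j) := by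
      rw [← pow_mul, ← pow_mul, mul_comm]; simp only [hφ]; ring
    rw [e, hC₀, add_mul]
    refine (norm_sub_le _ _).trans (add_le_add (h5.trans ?_) (h6.trans ?_))
    · push_cast
      exact mul_le_mul_of_nonneg_left h4.1 (by positivity)
    · refine mul_le_mul ?_ h4.2 (norm_nonneg _) (by positivity)
      exact mul_le_mul (by linarith) (pow_le_pow_right₀ one_le_two (by omega)) (by positivity)
        (by positivity)
  set μ := ν ^ (2 * j) with hμ
  have hμ0 : 0 < μ := by positivity
  have hμ1 : μ ≤ 1 := pow_le_one₀ hν.le hν1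
  have hδμ : δ = (((μ ^ 2) ^ j) ^ (j + 1)) ^ 4 := by
    rw [hδ, hμ]; simp only [← pow_mul]; congr 1; ring
  have hδle : δ ≤ μ := by
    rw [hδ, hμ]
    refine pow_le_pow_of_le_one hν.le hν1 ?_
    nlinarith
  have hφs : ∀ z : ℂ, ‖z‖ ≤ 1 / 3 → ‖φ z‖ ≤ 8 * C₀ * ((μ ^ 2) ^ j) ^ (j + 1) := fun z hz => by
    have h1 := norm_pow_four_le_of_small_on_real hφd hφb hφr hz
    refine le_of_pow_le_pow_left₀ (n := 4) (by norm_num) (by positivity) (h1.trans ?_)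
    rw [mul_pow, ← hδμ]
    have : 8 * C₀ ≤ (8 * C₀) ^ 4 := le_self_pow₀ (by linarith) (by norm_num)
    calc C₀ * δ * 2 ^ 3 = 8 * C₀ * δ := by ring
      _ ≤ _ := mul_le_mul_of_nonneg_right this hδ0.le
  have hn6 : ∀ z : ℂ, ‖z / 6‖ = ‖z‖ / 6 := fun z => by simp
  obtain ⟨u, hu, hu'⟩ := H (fun z => g (z / 6)) (fun z => h (z / 6)) (by fun_prop) (by fun_prop)
    μ hμ0 hμ1 (fun z hz => (hb _ (by rw [hn6]; linarith)).1)
    (fun z hz => hφs (z / 6) (by rw [hn6]; linarith))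
  have hm6 : ∀ z : ℂ, ‖z‖ ≤ 1 / 12 → ‖6 * z‖ ≤ 1 / 2 := fun z hz => by
    rw [norm_mul, Complex.norm_ofNat]; linarith
  refine ⟨fun z => u (6 * z), by fun_prop, fun z hz =>
    ((hu' _ (hm6 z hz)).1).trans (by linarith), ?_⟩
  intro s hs
  obtain ⟨q1, q2, q3⟩ := hu' _ (hm6 s (by simpa using hs))
  simp only [mul_div_cancel_left₀ (s : ℂ) (by norm_num : (6 : ℂ) ≠ 0)] at q2 q3
  obtain ⟨p1, p2⟩ := ha s (hs.trans (by norm_num))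
  set v := u (6 * s) with hv
  show ‖v - F s‖ ≤ _
  have k1 : ‖v ^ j - F s ^ j‖ ≤ (B + 1) * μ := by
    have e : v ^ j - F s ^ j = (v ^ j - g s) + (g s - F s ^ j) := by ring
    rw [e]
    refine (norm_add_le _ _).trans ?_
    linarith
  have k2 : ‖F s‖ ^ j * ‖v - F s‖ ≤ (2 * B + 1) * μ := by
    have e : F s ^ j * (v - F s) = -((g s - F s ^ j) * v) + ((g s * v - h s) +
      (h s - F s ^ (j + 1))) := by ring
    rw [← norm_pow, ← norm_mul, e]
    have h1 : ‖-((g s - F s ^ j) * v)‖ ≤ μ * B := by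
      rw [norm_neg, norm_mul]
      exact mul_le_mul (p1.trans hδle) q1 (norm_nonneg _) hμ0.le
    have h2 := norm_add_le (-((g s - F s ^ j) * v)) ((g s * v - h s) + (h s - F s ^ (j + 1)))
    have h3 := norm_add_le (g s * v - h s) (h s - F s ^ (j + 1))
    linarith
  have hνj : ν ^ j ≤ ν := pow_le_of_le_one hν.le hν1 (by omega)
  have hμν : μ = ν ^ j * ν ^ j := by rw [hμ, two_mul, pow_add]
  rcases le_or_gt ν ‖F s‖ with hc | hc
  · have h1 : ν ^ j * ‖v - F s‖ ≤ ν ^ j * ((2 * B + 1) * ν ^ j) := by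
      calc _ ≤ ‖F s‖ ^ j * ‖v - F s‖ :=
            mul_le_mul_of_nonneg_right (pow_le_pow_left₀ hν.le hc _) (norm_nonneg _)
        _ ≤ _ := k2
        _ = _ := by rw [hμν]; ring
    have h2 := le_of_mul_le_mul_left h1 (by positivity)
    nlinarith
  · have h1 : ‖v‖ ^ j ≤ ((B + 2) * ν) ^ j := by
      have h2 := norm_sub_norm_le (v ^ j) (F s ^ j)
      rw [norm_pow, norm_pow] at h2
      have h3 : ‖F s‖ ^ j ≤ ν ^ j := pow_le_pow_left₀ (norm_nonneg _) hc.le _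
      have h4 : μ ≤ ν ^ j := by
        rw [hμν]; exact mul_le_of_le_one_left (by positivity) (pow_le_one₀ hν.le hν1)
      have h5 : B + 2 ≤ (B + 2) ^ j := le_self_pow₀ (by linarith) (by omega)
      have h6 : (B + 2) * ν ^ j ≤ (B + 2) ^ j * ν ^ j :=
        mul_le_mul_of_nonneg_right h5 (by positivity)
      rw [mul_pow]
      nlinarith
    have h2 := le_of_pow_le_pow_left₀ (by omega : j ≠ 0) (by positivity) h1
    have h3 := norm_sub_le v (F s)
    nlinarith

/-- If `g` and `h` approximate `F ^ j` and `F ^ (j + 1)` on a segment, then some entire function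
approximates `F` on a shorter segment. -/
lemma exists_entire_near_root {j : ℕ} (hj : 1 ≤ j) {A : ℝ} (hA : 1 ≤ A) :
    ∃ B : ℝ, 1 ≤ B ∧ ∀ (g h : ℂ → ℂ) (F : ℝ → ℂ), Differentiable ℂ g → Differentiable ℂ h →
      ∀ ν R : ℝ, 0 < ν → ν ≤ 1 → 0 < R → (∀ z : ℂ, ‖z‖ ≤ R → ‖g z‖ ≤ A ∧ ‖h z‖ ≤ A) →
      (∀ s : ℝ, |s| ≤ R → ‖g s - F s ^ j‖ ≤ A * ν ^ (16 * j ^ 2 * (j + 1)) ∧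
        ‖h s - F s ^ (j + 1)‖ ≤ A * ν ^ (16 * j ^ 2 * (j + 1))) →
      ∃ u : ℂ → ℂ, Differentiable ℂ u ∧ (∀ z : ℂ, ‖z‖ ≤ R / 12 → ‖u z‖ ≤ B) ∧
        ∀ s : ℝ, |s| ≤ R / 12 → ‖u s - F s‖ ≤ B * ν := by
  obtain ⟨B, hB, H⟩ := exists_entire_near_root_unit hj
  refine ⟨A * B, by nlinarith, ?_⟩
  intro g h F hg hh ν R hν hν1 hR hb ha
  have hA0 : (A : ℂ) ≠ 0 := by norm_cast; linarith
  have hAp : 0 < A := by linarith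
  have hnA : ‖(A : ℂ)‖ = A := by simp [abs_of_pos hAp]
  have hdiv : ∀ (w : ℂ) (n : ℕ) (r : ℝ), 1 ≤ n → ‖w‖ ≤ A * r → ‖w / (A : ℂ) ^ n‖ ≤ r := by
    intro w n r hn hw
    rw [norm_div, norm_pow, hnA, div_le_iff₀ (by positivity)]
    have h0 : 0 ≤ A * r := (norm_nonneg _).trans hw
    have hr : 0 ≤ r := nonneg_of_mul_nonneg_right h0 hAp
    have : A ≤ A ^ n := le_self_pow₀ hA (by omega)
    nlinarith
  have hRz : ∀ z : ℂ, ‖z‖ ≤ 1 → ‖(R : ℂ) * z‖ ≤ R := fun z hz => by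
    rw [norm_mul, Complex.norm_real, Real.norm_of_nonneg hR.le]; nlinarith
  obtain ⟨u, hu, hub, hua⟩ := H (fun z => g (R * z) / (A : ℂ) ^ j)
    (fun z => h (R * z) / (A : ℂ) ^ (j + 1)) (fun s => F (R * s) / A) (by fun_prop) (by fun_prop)
    ν hν hν1 (fun z hz => ⟨hdiv _ _ _ hj (by linarith [(hb _ (hRz z hz)).1]),
      hdiv _ _ _ (by omega) (by linarith [(hb _ (hRz z hz)).2])⟩) (fun s hs => by
      have h1 : |R * s| ≤ R := by rw [abs_mul, abs_of_pos hR]; nlinarith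
      have h2 := ha _ h1
      push_cast at h2
      constructor
      · simp only [div_pow, ← sub_div]
        exact hdiv _ _ _ hj h2.1
      · simp only [div_pow, ← sub_div]
        exact hdiv _ _ _ (by omega) h2.2)
  have hRc : (R : ℂ) ≠ 0 := by exact_mod_cast hR.ne'
  refine ⟨fun z => A * u (z / R), by fun_prop, fun z hz => ?_, fun s hs => ?_⟩
  · rw [norm_mul, hnA]
    refine mul_le_mul_of_nonneg_left (hub _ ?_) hAp.le
    rw [norm_div, Complex.norm_real, Real.norm_of_nonneg hR.le, div_le_iff₀ hR]
    linarith
  · have h1 := hua (s / R) (by rw [abs_div, abs_of_pos hR, div_le_iff₀ hR]; linarith)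
    have e1 : R * (s / R) = s := by field_simp
    rw [e1] at h1
    push_cast at h1
    have e2 : A * u (s / R) - F s = A * (u (s / R) - F s / A) := by field_simp
    rw [e2, norm_mul, hnA, mul_assoc]
    exact mul_le_mul_of_nonneg_left h1 hAp.le

/-- The `k`-th Taylor coefficient at the origin. -/
def taylorCoeff (u : ℂ → ℂ) (k : ℕ) : ℂ := (k.factorial : ℂ)⁻¹ * iteratedDeriv k u 0

/-- The remainder of the Taylor polynomial of degree `n` at the origin. -/
def taylorRem (n : ℕ) (u : ℂ → ℂ) (z : ℂ) : ℂ :=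
  u z - ∑ k ∈ Finset.range (n + 1), taylorCoeff u k * z ^ k

lemma taylorCoeff_sub {u v : ℂ → ℂ} (hu : Differentiable ℂ u) (hv : Differentiable ℂ v) (k : ℕ) :
    taylorCoeff (fun z => u z - v z) k = taylorCoeff u k - taylorCoeff v k := by
  rw [taylorCoeff, iteratedDeriv_fun_sub hu.contDiff.contDiffAt hv.contDiff.contDiffAt, mul_sub]
  rfl

lemma taylorRem_sub {u v : ℂ → ℂ} (hu : Differentiable ℂ u) (hv : Differentiable ℂ v) (n : ℕ)
    (z : ℂ) : taylorRem n (fun z => u z - v z) z = taylorRem n u z - taylorRem n v z := by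
  simp only [taylorRem, taylorCoeff_sub hu hv, sub_mul, Finset.sum_sub_distrib]
  ring

lemma norm_taylorCoeff_le {u : ℂ → ℂ} (hu : Differentiable ℂ u) {r K : ℝ} (hr : 0 < r)
    (hK : ∀ z : ℂ, ‖z‖ ≤ r → ‖u z‖ ≤ K) (k : ℕ) : ‖taylorCoeff u k‖ ≤ K / r ^ k := by
  have h := Complex.norm_iteratedDeriv_le_of_forall_mem_sphere_norm_le k hr (hu.diffContOnCl)
    (fun z hz => hK z (by simpa using (mem_sphere_zero_iff_norm.1 hz).le))
  rw [taylorCoeff, norm_mul, norm_inv, Complex.norm_natCast]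
  have hk : (0 : ℝ) < k.factorial := by positivity
  rw [inv_mul_le_iff₀ hk]
  exact h.trans (by rw [mul_div_assoc])

lemma norm_taylorRem_le {u : ℂ → ℂ} (hu : Differentiable ℂ u) {r K : ℝ} (hr : 0 < r)
    (hK : ∀ z : ℂ, ‖z‖ ≤ r → ‖u z‖ ≤ K) (n : ℕ) {z : ℂ} (hz : ‖z‖ ≤ r / 2) :
    ‖taylorRem n u z‖ ≤ 2 * K * (‖z‖ / r) ^ (n + 1) := by
  have hK0 : 0 ≤ K := (norm_nonneg _).trans (hK 0 (by simpa using hr.le))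
  have h0 : HasSum (fun k => taylorCoeff u k * z ^ k) (u z) := by
    have := Complex.hasSum_taylorSeries_of_entire hu (c := 0) (z := z)
    simp only [smul_eq_mul, sub_zero] at this
    have e : (fun k => taylorCoeff u k * z ^ k) =
        fun k => ((k.factorial : ℂ))⁻¹ * (z ^ k * iteratedDeriv k u 0) := by
      funext k; rw [taylorCoeff]; ring
    rwa [e]
  have h1 := (hasSum_nat_add_iff' (n + 1)).2 h0
  have hg : HasSum (fun k : ℕ => K * (‖z‖ / r) ^ (n + 1) * (1 / 2) ^ k)
      (K * (‖z‖ / r) ^ (n + 1) * 2) := hasSum_geometric_two.mul_left _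
  have h2 := tsum_of_norm_bounded hg (f := fun k => taylorCoeff u (k + (n + 1)) *
    z ^ (k + (n + 1))) (fun k => by
      rw [norm_mul, norm_pow]
      have hq : ‖z‖ / r ≤ 1 / 2 := by rw [div_le_iff₀ hr]; linarith
      calc _ ≤ K / r ^ (k + (n + 1)) * ‖z‖ ^ (k + (n + 1)) :=
            mul_le_mul_of_nonneg_right (norm_taylorCoeff_le hu hr hK _) (by positivity)
        _ = K * (‖z‖ / r) ^ (n + 1) * (‖z‖ / r) ^ k := by
            rw [mul_assoc, ← pow_add, div_pow, add_comm (n + 1)]; ring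
        _ ≤ _ := mul_le_mul_of_nonneg_left (pow_le_pow_left₀ (by positivity) hq k) (by positivity))
  rw [h1.tsum_eq] at h2
  calc _ ≤ _ := h2
    _ = _ := by ring

/-- A function which is approximated by entire functions at all dyadic scales has a Taylor
expansion at the origin. -/
lemma exists_expansion_of_dyadic {F : ℝ → ℂ} {u : ℕ → ℂ → ℂ} (hu : ∀ i, Differentiable ℂ (u i))
    {r B β : ℝ} (hr : 0 < r) (hβ : 0 ≤ β) (n : ℕ) (h0 : ∀ z : ℂ, ‖z‖ ≤ r → ‖u 0 z‖ ≤ B)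
    (hd : ∀ i, ∀ z : ℂ, ‖z‖ ≤ r / 2 ^ i → ‖u (i + 1) z - u i z‖ ≤ β * (r / 2 ^ i) ^ (n + 2))
    (hF : ∀ i, ∀ s : ℝ, |s| ≤ r / 2 ^ i → ‖u i s - F s‖ ≤ β * (r / 2 ^ i) ^ (n + 2)) :
    ∃ a : ℕ → ℂ, (∀ k ≤ n, ‖a k‖ ≤ B / r ^ k + 2 * β * r ^ (n + 2 - k)) ∧
      ∀ s : ℝ, |s| ≤ r / 2 → ‖F s - ∑ k ∈ Finset.range (n + 1), a k * (s : ℂ) ^ k‖ ≤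
        (2 * B / r ^ (n + 1) + 9 * β * r * 4 ^ (n + 1)) * |s| ^ (n + 1) := by
  have hB : 0 ≤ B := (norm_nonneg _).trans (h0 0 (by simpa using hr.le))
  have hri : ∀ i : ℕ, 0 < r / 2 ^ i := fun i => by positivity
  have hrr : ∀ i : ℕ, r / 2 ^ i ≤ r := fun i => div_le_self hr.le (one_le_pow₀ one_le_two)
  have hstep : ∀ k ≤ n, ∀ i, dist (taylorCoeff (u i) k) (taylorCoeff (u (i + 1)) k) ≤
      2 * β * r ^ (n + 2 - k) / 2 / 2 ^ i := by
    intro k hk i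
    rw [dist_comm, dist_eq_norm, ← taylorCoeff_sub (hu _) (hu _)]
    refine (norm_taylorCoeff_le ((hu _).sub (hu _)) (hri i) (hd i) k).trans ?_
    have e : n + 2 = (n + 2 - k) + k := by omega
    rw [e, pow_add, Nat.add_sub_cancel, ← mul_assoc, mul_div_cancel_right₀ _ (by positivity)]
    rw [div_pow, ← pow_mul]
    have h3 : (2 : ℝ) ^ i ≤ 2 ^ (i * (n + 2 - k)) := by
      refine pow_le_pow_right₀ one_le_two ?_
      nlinarith [Nat.one_le_iff_ne_zero.2 (by omega : n + 2 - k ≠ 0)]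
    calc _ ≤ β * (r ^ (n + 2 - k) / 2 ^ i) :=
          mul_le_mul_of_nonneg_left
            (div_le_div_of_nonneg_left (by positivity) (by positivity) h3) hβ
      _ = _ := by ring
  have hlim : ∀ k, ∃ a, k ≤ n → Tendsto (fun i => taylorCoeff (u i) k) atTop (𝓝 a) := by
    intro k
    by_cases hk : k ≤ n
    · obtain ⟨a, ha⟩ := cauchySeq_tendsto_of_complete (cauchySeq_of_le_geometric_two (hstep k hk))
      exact ⟨a, fun _ => ha⟩
    · exact ⟨0, fun h => absurd h hk⟩
  choose a ha using hlim
  have htail' : ∀ k ≤ n, ∀ i, ‖taylorCoeff (u i) k - a k‖ ≤ 2 * β * (r / 2 ^ i) ^ (n + 2 - k) := by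
    intro k hk i
    have hs : ∀ l, dist (taylorCoeff (u (i + l)) k) (taylorCoeff (u (i + l + 1)) k) ≤
        2 * β * (r / 2 ^ i) ^ (n + 2 - k) / 2 / 2 ^ l := by
      intro l
      rw [dist_comm, dist_eq_norm, ← taylorCoeff_sub (hu _) (hu _)]
      refine (norm_taylorCoeff_le ((hu _).sub (hu _)) (hri _) (hd _) k).trans ?_
      have e : n + 2 = (n + 2 - k) + k := by omega
      rw [e, pow_add (_ / _), Nat.add_sub_cancel, ← mul_assoc,
        mul_div_cancel_right₀ _ (by positivity), pow_add (2 : ℝ), ← div_div, div_pow _ ((2 : ℝ) ^ l),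
        ← pow_mul]
      have h3 : (2 : ℝ) ^ l ≤ 2 ^ (l * (n + 2 - k)) := by
        refine pow_le_pow_right₀ one_le_two ?_
        nlinarith [Nat.one_le_iff_ne_zero.2 (by omega : n + 2 - k ≠ 0)]
      calc _ ≤ β * ((r / 2 ^ i) ^ (n + 2 - k) / 2 ^ l) :=
            mul_le_mul_of_nonneg_left
              (div_le_div_of_nonneg_left (by positivity) (by positivity) h3) hβ
        _ = _ := by ring
    have hl : Tendsto (fun l => taylorCoeff (u (i + l)) k) atTop (𝓝 (a k)) := by
      have := (tendsto_add_atTop_iff_nat i).2 (ha k hk)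
      simpa [add_comm] using this
    have := dist_le_of_le_geometric_two_of_tendsto₀ hs hl
    rwa [dist_eq_norm, add_zero] at this
  refine ⟨a, fun k hk => ?_, fun s hs => ?_⟩
  · have h1 := htail' k hk 0
    have h2 := norm_taylorCoeff_le (hu 0) hr h0 k
    have h3 := norm_sub_norm_le (a k) (taylorCoeff (u 0) k)
    rw [norm_sub_rev] at h3
    rw [pow_zero, div_one] at h1
    linarith
  have hrem : ∀ i, |s| ≤ r / 2 ^ i / 2 → ‖taylorRem n (u i) s‖ ≤
      2 * B * (|s| / r) ^ (n + 1) + 4 * β * r * |s| ^ (n + 1) * (1 - 1 / 2 ^ i) := by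
    intro i
    induction i with
    | zero =>
      intro hs
      have := norm_taylorRem_le (hu 0) hr h0 n (z := (s : ℂ)) (by simpa using hs)
      simpa using this
    | succ i ih =>
      intro hs'
      have h1 : |s| ≤ r / 2 ^ i / 2 := by
        refine hs'.trans ?_
        rw [pow_succ, ← div_div]
        linarith [hri i]
      have h2 := norm_taylorRem_le ((hu (i + 1)).sub (hu i)) (hri i) (hd i) n (z := (s : ℂ))
        (by simpa using h1)
      have h3 : taylorRem n (u (i + 1)) s = taylorRem n (u i) s +
          taylorRem n (fun z => u (i + 1) z - u i z) s := by
        rw [taylorRem_sub (hu _) (hu _)]; ring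
      rw [h3]
      refine (norm_add_le _ _).trans ?_
      have h4 : 2 * (β * (r / 2 ^ i) ^ (n + 2)) * (‖(s : ℂ)‖ / (r / 2 ^ i)) ^ (n + 1) =
          2 * β * |s| ^ (n + 1) * (r * (1 / 2 ^ i)) := by
        rw [Complex.norm_real, Real.norm_eq_abs, div_pow |s|, pow_succ _ (n + 1)]
        field_simp
      have h5 : (1 : ℝ) / 2 ^ (i + 1) = 1 / 2 ^ i / 2 := by rw [pow_succ, div_div]
      have h6 := ih h1
      rw [h5]
      have h7 : 2 * β * |s| ^ (n + 1) * (r * (1 / 2 ^ i)) =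
        4 * β * r * |s| ^ (n + 1) * (1 / 2 ^ i / 2) := by ring
      have h2' := h2.trans_eq (h4.trans h7)
      simp only [Pi.sub_def] at h2'
      nlinarith
  have hsplit : ∀ i, |s| ≤ r / 2 ^ i / 2 → ‖F s - ∑ k ∈ Finset.range (n + 1), a k * (s : ℂ) ^ k‖ ≤
      2 * B * (|s| / r) ^ (n + 1) + 4 * β * r * |s| ^ (n + 1) + 5 * β * (r / 2 ^ i) ^ (n + 2) := by
    intro i hi
    have e : F s - ∑ k ∈ Finset.range (n + 1), a k * (s : ℂ) ^ k = -(u i s - F s) +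
        (taylorRem n (u i) s +
          ∑ k ∈ Finset.range (n + 1), (taylorCoeff (u i) k - a k) * (s : ℂ) ^ k) := by
      simp only [taylorRem, sub_mul, Finset.sum_sub_distrib]; ring
    have h1 := hF i s (hi.trans (by linarith [hri i]))
    have h2 := hrem i hi
    have h3 : ‖∑ k ∈ Finset.range (n + 1), (taylorCoeff (u i) k - a k) * (s : ℂ) ^ k‖ ≤
        4 * β * (r / 2 ^ i) ^ (n + 2) := by
      calc _ ≤ ∑ k ∈ Finset.range (n + 1), 2 * β * (r / 2 ^ i) ^ (n + 2) * (1 / 2) ^ k := by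
            refine norm_sum_le_of_le _ fun k hk => ?_
            have hk' : k ≤ n := by have := Finset.mem_range.1 hk; omega
            rw [norm_mul, norm_pow, Complex.norm_real, Real.norm_eq_abs]
            have e : n + 2 = (n + 2 - k) + k := by omega
            calc _ ≤ 2 * β * (r / 2 ^ i) ^ (n + 2 - k) * (r / 2 ^ i * (1 / 2)) ^ k :=
                  mul_le_mul (htail' k hk' i) (pow_le_pow_left₀ (abs_nonneg _) (by linarith) k)
                    (by positivity) (by positivity)
              _ = 2 * β * ((r / 2 ^ i) ^ (n + 2 - k) * (r / 2 ^ i) ^ k) * (1 / 2) ^ k := by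
                  rw [mul_pow]; ring
              _ = _ := by rw [← pow_add, ← e]
        _ = 2 * β * (r / 2 ^ i) ^ (n + 2) * ∑ k ∈ Finset.range (n + 1), (1 / 2) ^ k := by
            rw [Finset.mul_sum]
        _ ≤ 2 * β * (r / 2 ^ i) ^ (n + 2) * 2 :=
            mul_le_mul_of_nonneg_left (sum_geometric_two_le _) (by positivity)
        _ = _ := by ring
    rw [e]
    have h4 := norm_add_le (-(u i s - F s)) (taylorRem n (u i) s +
          ∑ k ∈ Finset.range (n + 1), (taylorCoeff (u i) k - a k) * (s : ℂ) ^ k)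
    have h5 := norm_add_le (taylorRem n (u i) s)
      (∑ k ∈ Finset.range (n + 1), (taylorCoeff (u i) k - a k) * (s : ℂ) ^ k)
    rw [norm_neg] at h4
    have h6 : 0 ≤ 4 * β * r * |s| ^ (n + 1) * (1 / 2 ^ i) := by positivity
    nlinarith
  rcases eq_or_ne s 0 with h | h
  · have hz : Tendsto (fun i : ℕ => 5 * β * (r / 2 ^ i) ^ (n + 2)) atTop (𝓝 0) := by
      have h1 : Tendsto (fun i : ℕ => r / 2 ^ i) atTop (𝓝 0) :=
        tendsto_const_nhds.div_atTop (tendsto_pow_atTop_atTop_of_one_lt one_lt_two)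
      simpa using (h1.pow (n + 2)).const_mul (5 * β)
    have hs0 : |s| = 0 := by simp [h]
    have := ge_of_tendsto' hz (b := ‖F s - ∑ k ∈ Finset.range (n + 1), a k * (s : ℂ) ^ k‖)
      fun i => by
        have := hsplit i (by rw [hs0]; linarith [hri i])
        simpa [hs0] using this
    exact this.trans (by positivity)
  · have hs0 : 0 < |s| := abs_pos.2 h
    obtain ⟨i, hi1, hi2⟩ := exists_nat_pow_near_of_lt_one (x := 2 * |s| / r) (by positivity)
      (by rw [div_le_one hr]; linarith) (by norm_num : (0 : ℝ) < 1 / 2) (by norm_num)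
    have k1 : |s| ≤ r / 2 ^ i / 2 := by
      rw [div_le_iff₀ hr, one_div, inv_pow] at hi2
      rw [div_eq_mul_inv r]; linarith
    have k2 : r / 2 ^ i ≤ 4 * |s| := by
      rw [lt_div_iff₀ hr, one_div, inv_pow, pow_succ, mul_inv] at hi1
      rw [div_eq_mul_inv r]; linarith
    refine (hsplit i k1).trans ?_
    have k3 : (r / 2 ^ i) ^ (n + 2) ≤ (4 * |s|) ^ (n + 1) * r := by
      rw [pow_succ _ (n + 1)]
      exact mul_le_mul (pow_le_pow_left₀ (hri i).le k2 _) (hrr i) (hri i).le (by positivity)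
    have k4 : (1 : ℝ) ≤ 4 ^ (n + 1) := one_le_pow₀ (by norm_num)
    have k5 : 5 * β * (r / 2 ^ i) ^ (n + 2) ≤ 5 * β * ((4 * |s|) ^ (n + 1) * r) :=
      mul_le_mul_of_nonneg_left k3 (by positivity)
    have k6 : 4 * β * r * |s| ^ (n + 1) ≤ 4 * β * r * |s| ^ (n + 1) * 4 ^ (n + 1) :=
      le_mul_of_one_le_right (by positivity) k4
    rw [div_pow]
    rw [mul_pow] at k5
    calc _ ≤ 2 * B * (|s| ^ (n + 1) / r ^ (n + 1)) + 4 * β * r * |s| ^ (n + 1) * 4 ^ (n + 1) +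
          5 * β * (4 ^ (n + 1) * |s| ^ (n + 1) * r) := by linarith
      _ = _ := by ring

lemma norm_le_of_small_on_real {φ : ℂ → ℂ} (hφ : Differentiable ℂ φ) {r B x : ℝ} (hr : 0 < r)
    (hx : 0 ≤ x) (hB : ∀ z : ℂ, ‖z‖ ≤ 3 * r → ‖φ z‖ ≤ B)
    (hε : ∀ s : ℝ, |s| ≤ 3 * r → ‖φ s‖ ≤ B * x ^ 4)
    {z : ℂ} (hz : ‖z‖ ≤ r) : ‖φ z‖ ≤ B * x := by
  have hB0 : 0 ≤ B := (norm_nonneg _).trans (hB 0 (by simpa using hr.le))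
  have h3r : ‖((3 * r : ℝ) : ℂ)‖ = 3 * r := by
    rw [Complex.norm_real, Real.norm_of_nonneg (by positivity)]
  have h := norm_pow_four_le_of_small_on_real (φ := fun w => φ ((3 * r : ℝ) * w)) (by fun_prop)
    (B := B) (ε := B * x ^ 4) (fun w hw => hB _ (by rw [norm_mul, h3r]; nlinarith))
    (fun s hs => by
      have := hε (3 * r * s) (by
        rw [abs_mul, abs_of_pos (by positivity : 0 < 3 * r)]; nlinarith)
      rwa [Complex.ofReal_mul] at this)
    (z := z / (3 * r : ℝ)) (by
      rw [norm_div, h3r, div_le_iff₀ (by positivity)]; linarith)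
  have h3 : ((3 * r : ℝ) : ℂ) ≠ 0 := by
    norm_cast; positivity
  simp only [mul_div_cancel₀ z h3] at h
  refine le_of_pow_le_pow_left₀ (n := 4) (by norm_num) (by positivity) (h.trans_eq ?_)
  ring

/-- `F` has a Taylor expansion at the origin if its powers `F ^ j` and `F ^ (j + 1)` are well
approximated by entire functions at all dyadic scales. -/
lemma exists_expansion_of_near_powers {j : ℕ} (hj : 1 ≤ j) {A : ℝ} (hA : 1 ≤ A) :
    ∃ B : ℝ, 1 ≤ B ∧ ∀ (F : ℝ → ℂ) (n : ℕ) (r b : ℝ), 0 < r → 0 ≤ b →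
      (∀ i : ℕ, ∃ (g h : ℂ → ℂ) (ν : ℝ), Differentiable ℂ g ∧ Differentiable ℂ h ∧ 0 < ν ∧ ν ≤ 1 ∧
        ν ≤ (b * (r / 2 ^ i) ^ (n + 2)) ^ 4 ∧
        (∀ z : ℂ, ‖z‖ ≤ 72 * (r / 2 ^ i) → ‖g z‖ ≤ A ∧ ‖h z‖ ≤ A) ∧
        (∀ s : ℝ, |s| ≤ 72 * (r / 2 ^ i) → ‖g s - F s ^ j‖ ≤ A * ν ^ (16 * j ^ 2 * (j + 1)) ∧
          ‖h s - F s ^ (j + 1)‖ ≤ A * ν ^ (16 * j ^ 2 * (j + 1)))) →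
      ∃ a : ℕ → ℂ, (∀ k ≤ n, ‖a k‖ ≤ B / r ^ k + 4 * B * b * r ^ (n + 2 - k)) ∧
        ∀ s : ℝ, |s| ≤ r / 2 → ‖F s - ∑ k ∈ Finset.range (n + 1), a k * (s : ℂ) ^ k‖ ≤
          (2 * B / r ^ (n + 1) + 18 * B * b * r * 4 ^ (n + 1)) * |s| ^ (n + 1) := by
  obtain ⟨B, hB, H⟩ := exists_entire_near_root hj hA
  refine ⟨B, hB, fun F n r b hr hb hyp => ?_⟩
  have hri : ∀ i : ℕ, 0 < r / 2 ^ i := fun i => by positivity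
  choose g h ν hg hh hν hν1 hνb hbd happ using hyp
  have hex := fun i => H (g i) (h i) F (hg i) (hh i) (ν i) (72 * (r / 2 ^ i)) (hν i) (hν1 i)
    (by linarith [hri i]) (hbd i) (happ i)
  choose u hu hub huF using hex
  have hνx : ∀ i, ν i ≤ b * (r / 2 ^ i) ^ (n + 2) := fun i => by
    have hx : 0 ≤ b * (r / 2 ^ i) ^ (n + 2) := by positivity
    rcases le_or_gt 1 (b * (r / 2 ^ i) ^ (n + 2)) with h1 | h1
    · exact (hν1 i).trans h1
    · exact (hνb i).trans (pow_le_of_le_one hx h1.le (by norm_num))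
  have hsucc : ∀ i : ℕ, r / 2 ^ (i + 1) = r / 2 ^ i / 2 := fun i => by rw [pow_succ, div_div]
  obtain ⟨a, ha1, ha2⟩ := exists_expansion_of_dyadic (F := F) hu hr (B := B) (β := 2 * B * b)
    (by positivity) n (fun z hz => hub 0 z (by simp only [pow_zero, div_one]; linarith))
    (fun i z hz => by
      rw [mul_assoc]
      refine norm_le_of_small_on_real ((hu (i + 1)).sub (hu i)) (hri i) (by positivity)
        (fun w hw => ?_) (fun s hs => ?_) hz
      · have h1 := hub (i + 1) w (by rw [hsucc]; linarith [hri i])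
        have h2 := hub i w (by linarith [hri i])
        have h3 := norm_sub_le (u (i + 1) w) (u i w)
        simp only [Pi.sub_apply]
        linarith
      · have h1 := huF (i + 1) s (by rw [hsucc]; linarith [hri i])
        have h2 := huF i s (by linarith [hri i])
        have h3 := norm_sub_le (u (i + 1) s - F s) (u i s - F s)
        rw [sub_sub_sub_cancel_right] at h3
        have h4 : ν (i + 1) ≤ (b * (r / 2 ^ i) ^ (n + 2)) ^ 4 := by
          refine (hνb (i + 1)).trans ?_
          have : r / 2 ^ (i + 1) ≤ r / 2 ^ i := by rw [hsucc]; linarith [hri i]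
          have := hri (i + 1)
          gcongr
        have h5 := hνb i
        simp only [Pi.sub_apply]
        nlinarith)
    (fun i s hs => by
      have h1 := huF i s (by linarith [hri i])
      have h2 : B * ν i ≤ B * (b * (r / 2 ^ i) ^ (n + 2)) :=
        mul_le_mul_of_nonneg_left (hνx i) (by linarith)
      have h3 : 0 ≤ B * (b * (r / 2 ^ i) ^ (n + 2)) := by positivity
      linarith)
  refine ⟨a, fun k hk => (ha1 k hk).trans_eq (by ring), fun s hs => (ha2 s hs).trans_eq (by ring)⟩

section Taylor
variable {E F : Type*} [NormedAddCommGroup E] [NormedSpace ℝ E]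
  [NormedAddCommGroup F] [NormedSpace ℝ F]

lemma coeff_zero_of_small {n : ℕ} {c : ℕ → F} {K r : ℝ} (hr : 0 < r)
    (h : ∀ s : ℝ, 0 < s → s ≤ r → ‖∑ i ∈ Finset.range (n + 1), s ^ i • c i‖ ≤ K * s ^ (n + 1)) :
    c 0 = 0 := by
  have h1 : Tendsto (fun s : ℝ => ‖∑ i ∈ Finset.range (n + 1), s ^ i • c i‖) (𝓝[>] 0)
      (𝓝 ‖c 0‖) := by
    have hc : Continuous fun s : ℝ => ‖∑ i ∈ Finset.range (n + 1), s ^ i • c i‖ := by fun_prop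
    have := (hc.tendsto 0).mono_left (nhdsWithin_le_nhds (s := Ioi 0))
    rw [Finset.sum_range_succ'] at this
    simpa using this
  have h2 : Tendsto (fun s : ℝ => K * s ^ (n + 1)) (𝓝[>] 0) (𝓝 0) := by
    have hc : Continuous fun s : ℝ => K * s ^ (n + 1) := by fun_prop
    have := (hc.tendsto 0).mono_left (nhdsWithin_le_nhds (s := Ioi 0))
    simpa using this
  have h3 : ‖c 0‖ ≤ 0 := by
    refine le_of_tendsto_of_tendsto h1 h2 ?_
    filter_upwards [Ioc_mem_nhdsGT hr] with s hs using h s hs.1 hs.2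
  simpa using h3

/-- Uniqueness of asymptotic expansions. -/
lemma coeff_eq_zero_of_small {n : ℕ} {c : ℕ → F} {K r : ℝ} (hr : 0 < r)
    (h : ∀ s : ℝ, 0 < s → s ≤ r → ‖∑ i ∈ Finset.range (n + 1), s ^ i • c i‖ ≤ K * s ^ (n + 1)) :
    ∀ i ≤ n, c i = 0 := by
  induction n generalizing c with
  | zero =>
    intro i hi
    obtain rfl : i = 0 := by omega
    exact coeff_zero_of_small hr h
  | succ n ih =>
    have h0 := coeff_zero_of_small hr h
    intro i hi
    rcases i with _ | i
    · exact h0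
    refine ih (c := fun i => c (i + 1)) (fun s hs hsr => ?_) i (by omega)
    have h1 := h s hs hsr
    rw [Finset.sum_range_succ', h0, smul_zero, add_zero] at h1
    simp only [pow_succ', mul_smul] at h1
    rw [← Finset.smul_sum, norm_smul, Real.norm_of_nonneg hs.le] at h1
    have h2 : s * ‖∑ i ∈ Finset.range (n + 1), s ^ i • c (i + 1)‖ ≤ s * (K * s ^ (n + 1)) :=
      h1.trans_eq (by ring)
    exact le_of_mul_le_mul_left h2 hs

lemma taylor_bound_nonneg {R K : ℝ} (p : ℕ) (d : ℕ → ℝ → F)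
    (hd : ∀ k < p, ∀ t ∈ Icc 0 R, HasDerivAt (d k) (d (k + 1) t) t)
    (hK : ∀ t ∈ Icc 0 R, ‖d p t‖ ≤ K) :
    ∀ s ∈ Icc 0 R, ‖d 0 s - ∑ k ∈ Finset.range p, (s ^ k / (k.factorial : ℝ)) • d k 0‖ ≤
      K * s ^ p / (p.factorial : ℝ) := by
  induction p generalizing d with
  | zero => intro s hs; simpa using hK s hs
  | succ p ih =>
    have h1 := ih (fun k => d (k + 1)) (fun k hk => hd (k + 1) (by omega)) hK
    intro s hs
    have hmon : ∀ (k : ℕ) (t : ℝ), HasDerivAt (fun t : ℝ => t ^ (k + 1) / ((k + 1).factorial : ℝ))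
        (t ^ k / (k.factorial : ℝ)) t := fun k t => by
      refine ((hasDerivAt_pow (k + 1) t).div_const _).congr_deriv ?_
      rw [Nat.factorial_succ, Nat.add_sub_cancel]
      have : (k.factorial : ℝ) ≠ 0 := by positivity
      push_cast
      field_simp
    have hder : ∀ t ∈ Icc 0 R, HasDerivAt
        (fun s => d 0 s - ∑ k ∈ Finset.range (p + 1), (s ^ k / (k.factorial : ℝ)) • d k 0)
        (d 1 t - ∑ k ∈ Finset.range p, (t ^ k / (k.factorial : ℝ)) • d (k + 1) 0) t := by
      intro t ht
      refine (hd 0 (by omega) t ht).sub ?_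
      simp only [Finset.sum_range_succ' _ p, pow_zero]
      exact (HasDerivAt.fun_sum fun k _ => (hmon k t).smul_const (d (k + 1) 0)).add_const _
    refine image_norm_le_of_norm_deriv_right_le_deriv_boundary' (a := 0) (b := R)
      (f := fun s => d 0 s - ∑ k ∈ Finset.range (p + 1), (s ^ k / (k.factorial : ℝ)) • d k 0)
      (B := fun s => K * s ^ (p + 1) / ((p + 1).factorial : ℝ))
      (B' := fun s => K * s ^ p / (p.factorial : ℝ))
      (fun t ht => (hder t ht).continuousAt.continuousWithinAt)
      (fun t ht => (hder t ⟨ht.1, ht.2.le⟩).hasDerivWithinAt) ?_ (by fun_prop) ?_ ?_ hs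
    · rw [Finset.sum_range_succ']; simp
    · intro t ht
      have := ((hmon p t).const_mul K).hasDerivWithinAt (s := Ici t)
      simpa only [mul_div_assoc] using this
    · intro t ht
      exact h1 t ⟨ht.1, ht.2.le⟩

lemma taylor_bound {R K : ℝ} (p : ℕ) (d : ℕ → ℝ → F)
    (hd : ∀ k < p, ∀ t, |t| ≤ R → HasDerivAt (d k) (d (k + 1) t) t)
    (hK : ∀ t, |t| ≤ R → ‖d p t‖ ≤ K) {s : ℝ} (hs : |s| ≤ R) :
    ‖d 0 s - ∑ k ∈ Finset.range p, (s ^ k / (k.factorial : ℝ)) • d k 0‖ ≤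
      K * |s| ^ p / (p.factorial : ℝ) := by
  rcases le_total 0 s with h | h
  · rw [abs_of_nonneg h] at hs ⊢
    exact taylor_bound_nonneg p d (fun k hk t ht => hd k hk t (by rw [abs_of_nonneg ht.1]; exact ht.2))
      (fun t ht => hK t (by rw [abs_of_nonneg ht.1]; exact ht.2)) s ⟨h, hs⟩
  · rw [abs_of_nonpos h] at hs ⊢
    have hn : ∀ t ∈ Icc 0 R, |(-t)| ≤ R := fun t ht => by
      rw [abs_neg, abs_of_nonneg ht.1]; exact ht.2
    have := taylor_bound_nonneg p (fun k t => (-1 : ℝ) ^ k • d k (-t)) (R := R) (K := K)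
      (fun k hk t ht => by
        have h1 := ((hd k hk (-t) (hn t ht)).scomp t (hasDerivAt_neg t)).const_smul ((-1 : ℝ) ^ k)
        refine h1.congr_deriv ?_
        rw [smul_smul, pow_succ])
      (fun t ht => by
        rw [norm_smul, norm_pow, norm_neg, norm_one, one_pow, one_mul]
        exact hK _ (hn t ht)) (-s) ⟨by linarith, hs⟩
    simp only [pow_zero, one_smul, neg_neg, neg_zero, smul_smul] at this
    convert this using 5 with k hk
    rw [neg_pow s, div_mul_eq_mul_div, mul_right_comm, ← mul_pow, neg_one_mul, neg_neg, one_pow,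
      one_mul]

lemma hasDerivAt_iteratedFDeriv_line {G : E → F} {U : Set E} (hU : IsOpen U)
    (hG : ContDiffOn ℝ (⊤ : ℕ∞) G U) {x w : E} {t : ℝ} (ht : x + t • w ∈ U) (k : ℕ) :
    HasDerivAt (fun t : ℝ => iteratedFDeriv ℝ k G (x + t • w) fun _ => w)
      (iteratedFDeriv ℝ (k + 1) G (x + t • w) fun _ => w) t := by
  have hGa : ContDiffAt ℝ (⊤ : ℕ∞) G (x + t • w) := hG.contDiffAt (hU.mem_nhds ht)
  have h1 : DifferentiableAt ℝ (iteratedFDeriv ℝ k G) (x + t • w) :=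
    hGa.differentiableAt_iteratedFDeriv (by exact_mod_cast WithTop.coe_lt_top k)
  have h2 : HasDerivAt (fun t : ℝ => x + t • w) w t := by
    simpa using ((hasDerivAt_id t).smul_const w).const_add x
  have h3 := h1.hasFDerivAt.comp_hasDerivAt t h2
  have h4 := ((ContinuousMultilinearMap.apply ℝ (fun _ : Fin k => E) F
    (fun _ => w)).hasFDerivAt).comp_hasDerivAt t h3
  exact h4.congr_deriv (by rw [iteratedFDeriv_succ_apply_left]; rfl)

lemma taylor_line {G : E → F} {U : Set E} (hU : IsOpen U)
    (hG : ContDiffOn ℝ (⊤ : ℕ∞) G U) {x w : E} {R K : ℝ} (p : ℕ)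
    (hR : ∀ t : ℝ, |t| ≤ R → x + t • w ∈ U)
    (hK : ∀ t : ℝ, |t| ≤ R → ‖iteratedFDeriv ℝ p G (x + t • w) fun _ => w‖ ≤ K) {s : ℝ}
    (hs : |s| ≤ R) :
    ‖G (x + s • w) - ∑ k ∈ Finset.range p, (s ^ k / (k.factorial : ℝ)) •
      iteratedFDeriv ℝ k G x (fun _ => w)‖ ≤ K * |s| ^ p / (p.factorial : ℝ) := by
  have := taylor_bound p (fun k t => iteratedFDeriv ℝ k G (x + t • w) fun _ => w)
    (fun k _ t ht => hasDerivAt_iteratedFDeriv_line hU hG (hR t ht) k) hK hs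
  simpa using this

end Taylor

section LineTaylor
variable {E F : Type*} [NormedAddCommGroup E] [NormedSpace ℝ E]
  [NormedAddCommGroup F] [NormedSpace ℝ F]

/-- `f` has Taylor expansions of order `n` along all lines, uniformly near `x₀`. -/
def HasLineTaylor (n : ℕ) (f : E → F) (x₀ : E) : Prop :=
  ∃ r > 0, ∃ C : ℝ, ∀ x ∈ ball x₀ r, ∀ w : E, ‖w‖ ≤ 1 → ∃ a : ℕ → F, (∀ i ≤ n, ‖a i‖ ≤ C) ∧
    ∀ s : ℝ, |s| ≤ r → ‖f (x + s • w) - ∑ i ∈ Finset.range (n + 1), s ^ i • a i‖ ≤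
      C * |s| ^ (n + 1)

lemma HasLineTaylor.of_succ {n : ℕ} {f : E → F} {x₀ : E} (h : HasLineTaylor (n + 1) f x₀) :
    HasLineTaylor n f x₀ := by
  obtain ⟨r, hr, C, H⟩ := h
  have hC : 0 ≤ C := by
    obtain ⟨a, ha, -⟩ := H x₀ (mem_ball_self hr) 0 (by simp)
    exact (norm_nonneg _).trans (ha 0 (by omega))
  refine ⟨r, hr, C + C * r, fun x hx w hw => ?_⟩
  obtain ⟨a, ha, hb⟩ := H x hx w hw
  refine ⟨a, fun i hi => (ha i (by omega)).trans (le_add_of_nonneg_right (by positivity)),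
    fun s hs => ?_⟩
  have h1 := hb s hs
  rw [Finset.sum_range_succ, ← sub_sub] at h1
  have h2 := norm_sub_norm_le (f (x + s • w) - ∑ i ∈ Finset.range (n + 1), s ^ i • a i)
    (s ^ (n + 1) • a (n + 1))
  rw [norm_smul, norm_pow, Real.norm_eq_abs] at h2
  have h3 : |s| ^ (n + 1) * ‖a (n + 1)‖ ≤ |s| ^ (n + 1) * C :=
    mul_le_mul_of_nonneg_left (ha _ le_rfl) (by positivity)
  have h4 : C * |s| ^ (n + 1 + 1) ≤ C * (|s| ^ (n + 1) * r) := by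
    rw [pow_succ |s|]
    exact mul_le_mul_of_nonneg_left (mul_le_mul_of_nonneg_left hs (by positivity)) hC
  nlinarith

lemma HasLineTaylor.one_of_succ {n : ℕ} {f : E → F} {x₀ : E} (h : HasLineTaylor (n + 1) f x₀) :
    HasLineTaylor 1 f x₀ := by
  induction n with
  | zero => exact h
  | succ n ih => exact ih h.of_succ

lemma expansion_zero {n : ℕ} {φ : ℝ → F} {a : ℕ → F} {C r : ℝ} (hr : 0 ≤ r)
    (h : ∀ s : ℝ, |s| ≤ r → ‖φ s - ∑ i ∈ Finset.range (n + 1), s ^ i • a i‖ ≤ C * |s| ^ (n + 1)) :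
    a 0 = φ 0 := by
  have := h 0 (by simpa using hr)
  rw [Finset.sum_range_succ'] at this
  simp only [pow_succ, mul_zero, zero_smul, Finset.sum_const_zero, zero_add, pow_zero, one_smul,
    abs_zero, norm_le_zero_iff] at this
  exact (sub_eq_zero.1 this).symm

lemma expansion_one {n : ℕ} {φ : ℝ → F} {a : ℕ → F} {C r : ℝ} (hr : 0 < r)
    (h : ∀ s : ℝ, |s| ≤ r → ‖φ s - ∑ i ∈ Finset.range (n + 1 + 1), s ^ i • a i‖ ≤
      C * |s| ^ (n + 1 + 1)) :
    HasDerivAt φ (a 1) 0 := by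
  set P : ℝ → F := fun s => ∑ i ∈ Finset.range (n + 1 + 1), s ^ i • a i with hP
  have h1 : HasDerivAt P (a 1) 0 := by
    have h2 : HasDerivAt P (∑ i ∈ Finset.range (n + 1 + 1), ((i : ℝ) * 0 ^ (i - 1)) • a i) 0 :=
      HasDerivAt.fun_sum fun i _ => (hasDerivAt_pow i (0 : ℝ)).smul_const (a i)
    refine h2.congr_deriv ?_
    rw [Finset.sum_eq_single 1]
    · simp
    · intro i _ hi
      rcases i with _ | _ | i
      · simp
      · exact absurd rfl hi
      · simp
    · intro h; exact absurd (Finset.mem_range.2 (by omega)) h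
  have h2 : HasFDerivAt (fun s => φ s - P s) (0 : ℝ →L[ℝ] F) 0 := by
    refine Asymptotics.IsBigO.hasFDerivAt (n := n + 1 + 1) ?_ (by omega)
    refine Asymptotics.IsBigO.of_bound C ?_
    filter_upwards [closedBall_mem_nhds (0 : ℝ) hr] with s hs
    have := h s (by simpa using hs)
    simpa using this
  have h3 : HasDerivAt (fun s => φ s - P s) 0 0 := by
    have := h2.hasDerivAt
    simpa using this
  have := h3.add h1
  simpa [Pi.add_def] using this

lemma HasLineTaylor.differentiableAt {f : E → F} {x₀ : E} (h : HasLineTaylor 1 f x₀) :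
    DifferentiableAt ℝ f x₀ := by
  obtain ⟨r, hr, C, H⟩ := h
  have hC : 0 ≤ C := by
    obtain ⟨a, ha, -⟩ := H x₀ (mem_ball_self hr) 0 (by simp)
    exact (norm_nonneg _).trans (ha 0 (by omega))
  have hsmall : ∀ x ∈ ball x₀ r, ∀ h : E, ‖h‖ ≤ r → ∃ b : F, HasLineDerivAt ℝ f b x h ∧
      ‖b‖ ≤ C * ‖h‖ ∧ ‖f (x + h) - f x - b‖ ≤ C * ‖h‖ ^ 2 ∧
      ‖f (x - h) - f x + b‖ ≤ C * ‖h‖ ^ 2 := by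
    intro x hx h hh
    have hw : ‖(‖h‖⁻¹ • h)‖ ≤ 1 := by
      rw [norm_smul, norm_inv, norm_norm]; exact inv_mul_le_one
    have hwh : ‖h‖ • (‖h‖⁻¹ • h) = h := by
      rcases eq_or_ne h 0 with rfl | h0
      · simp
      · rw [smul_smul, mul_inv_cancel₀ (norm_ne_zero_iff.2 h0), one_smul]
    obtain ⟨a, ha, hb⟩ := H x hx _ hw
    have h0 : a 0 = f x := by
      have := expansion_zero (φ := fun s => f (x + s • (‖h‖⁻¹ • h))) hr.le hb
      simpa using this
    have h1 : HasLineDerivAt ℝ f (a 1) x (‖h‖⁻¹ • h) := expansion_one (n := 0) hr hb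
    refine ⟨‖h‖ • a 1, ?_, ?_, ?_, ?_⟩
    · have := h1.smul ‖h‖
      rwa [hwh] at this
    · rw [norm_smul, norm_norm, mul_comm]
      exact mul_le_mul_of_nonneg_right (ha 1 le_rfl) (norm_nonneg _)
    · have := hb ‖h‖ (by simpa using hh)
      simpa [Finset.sum_range_succ, hwh, h0, sub_sub] using this
    · have := hb (-‖h‖) (by simpa using hh)
      rw [neg_smul, hwh] at this
      simpa [Finset.sum_range_succ, h0, sub_sub, ← sub_eq_add_neg, sub_add] using this
  have hx₀ := mem_ball_self (x := x₀) hr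
  have hall : ∀ v : E, ∃ b : F, HasLineDerivAt ℝ f b x₀ v ∧ ‖b‖ ≤ C * ‖v‖ := by
    intro v
    have hc : 0 < ‖v‖ + 1 := by positivity
    obtain ⟨b, hb1, hb2, -⟩ := hsmall x₀ hx₀ ((r / (‖v‖ + 1)) • v) (by
      rw [norm_smul, Real.norm_of_nonneg (by positivity), div_mul_eq_mul_div, div_le_iff₀ hc]
      nlinarith [norm_nonneg v])
    refine ⟨((‖v‖ + 1) / r) • b, ?_, ?_⟩
    · have := hb1.smul ((‖v‖ + 1) / r)
      have e : (‖v‖ + 1) / r * (r / (‖v‖ + 1)) = 1 := by field_simp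
      rwa [smul_smul, e, one_smul] at this
    · rw [norm_smul, Real.norm_of_nonneg (by positivity)] at hb2 ⊢
      calc _ ≤ (‖v‖ + 1) / r * (C * (r / (‖v‖ + 1) * ‖v‖)) :=
            mul_le_mul_of_nonneg_left hb2 (by positivity)
        _ = _ := by field_simp
  choose b hb hbC using hall
  have hhalf : ∀ v v' : E, b v + b v' = (2 : ℝ) • b ((1 / 2 : ℝ) • (v + v')) := by
    intro v v'
    set m := (1 / 2 : ℝ) • (v + v') with hm
    set e := (1 / 2 : ℝ) • (v - v') with he
    have hv : v = m + e := by rw [hm, he]; module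
    have hv' : v' = m - e := by rw [hm, he]; module
    have h1 : HasDerivAt (fun t : ℝ => f (x₀ + t • v) + f (x₀ + t • v') - (2 : ℝ) • f (x₀ + t • m))
        (b v + b v' - (2 : ℝ) • b m) 0 :=
      ((hb v).add (hb v')).sub (HasDerivAt.const_smul (2 : ℝ) (hb m))
    have h2 : HasFDerivAt
        (fun t : ℝ => f (x₀ + t • v) + f (x₀ + t • v') - (2 : ℝ) • f (x₀ + t • m))
        (0 : ℝ →L[ℝ] F) 0 := by
      refine Asymptotics.IsBigO.hasFDerivAt (n := 2) ?_ (by omega)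
      refine Asymptotics.IsBigO.of_bound (2 * C * ‖e‖ ^ 2) ?_
      have c1 : ∀ᶠ t : ℝ in 𝓝 0, x₀ + t • m ∈ ball x₀ r := by
        have : Continuous fun t : ℝ => x₀ + t • m := by fun_prop
        exact this.continuousAt.eventually_mem (isOpen_ball.mem_nhds (by simpa using hr))
      have c2 : ∀ᶠ t : ℝ in 𝓝 0, t • e ∈ ball (0 : E) r := by
        have : Continuous fun t : ℝ => t • e := by fun_prop
        exact this.continuousAt.eventually_mem (isOpen_ball.mem_nhds (by simpa using hr))
      filter_upwards [c1, c2] with t h1 h2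
      obtain ⟨β, -, -, q1, q2⟩ := hsmall _ h1 (t • e) (by simpa using (mem_ball_zero_iff.1 h2).le)
      have e1 : f (x₀ + t • v) + f (x₀ + t • v') - (2 : ℝ) • f (x₀ + t • m) =
          (f (x₀ + t • m + t • e) - f (x₀ + t • m) - β) +
          (f (x₀ + t • m - t • e) - f (x₀ + t • m) + β) := by
        rw [hv, hv', smul_add, smul_sub, ← add_assoc, ← add_sub_assoc, two_smul]; abel
      rw [e1]
      refine (norm_add_le _ _).trans ((add_le_add q1 q2).trans_eq ?_)
      rw [norm_smul, sub_zero, norm_pow, norm_norm]; ring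
    have h3 := h1.unique (by simpa using h2.hasDerivAt)
    exact sub_eq_zero.1 h3
  have hsm : ∀ (c : ℝ) (v : E), b (c • v) = c • b v := fun c v => (hb _).unique ((hb v).smul c)
  let L : E →L[ℝ] F := LinearMap.mkContinuous
    { toFun := b
      map_add' := fun v v' => by rw [hhalf, hsm, smul_smul]; norm_num
      map_smul' := hsm } C hbC
  have hL : HasFDerivAt f L x₀ := by
    rw [hasFDerivAt_iff_isLittleO_nhds_zero]
    refine Asymptotics.IsBigO.trans_isLittleO (g := fun h : E => ‖h‖ ^ 2) ?_ ?_
    · refine Asymptotics.IsBigO.of_bound C ?_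
      filter_upwards [closedBall_mem_nhds (0 : E) hr] with h hh
      obtain ⟨β, q0, -, q1, -⟩ := hsmall x₀ hx₀ h (by simpa using hh)
      have : L h = β := (hb h).unique q0
      rw [this, norm_pow, norm_norm]
      exact q1
    · have := Asymptotics.isLittleO_norm_pow_id (E' := E) (n := 2) (by norm_num)
      simpa using this
  exact hL.differentiableAt

/-- Pointwise expansions of a family of operators come from operator-valued expansions. -/
lemma exists_operator_expansion {n : ℕ} {L : ℝ → E →L[ℝ] F} {r C : ℝ} (hr : 0 < r)
    (h : ∀ y : E, ‖y‖ ≤ 1 → ∃ b : ℕ → F, (∀ i ≤ n, ‖b i‖ ≤ C) ∧ ∀ s : ℝ, |s| ≤ r →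
      ‖L s y - ∑ i ∈ Finset.range (n + 1), s ^ i • b i‖ ≤ C * |s| ^ (n + 1)) :
    ∃ B : ℕ → E →L[ℝ] F, (∀ i ≤ n, ‖B i‖ ≤ C) ∧ ∀ s : ℝ, |s| ≤ r →
      ‖L s - ∑ i ∈ Finset.range (n + 1), s ^ i • B i‖ ≤ C * |s| ^ (n + 1) := by
  have hC : 0 ≤ C := by
    obtain ⟨a, ha, -⟩ := h 0 (by simp)
    exact (norm_nonneg _).trans (ha 0 (by omega))
  have hall : ∀ y : E, ∃ b : ℕ → F, (∀ i ≤ n, ‖b i‖ ≤ C * ‖y‖) ∧ ∀ s : ℝ, |s| ≤ r →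
      ‖L s y - ∑ i ∈ Finset.range (n + 1), s ^ i • b i‖ ≤ C * ‖y‖ * |s| ^ (n + 1) := by
    intro y
    have hw : ‖(‖y‖⁻¹ • y)‖ ≤ 1 := by
      rw [norm_smul, norm_inv, norm_norm]; exact inv_mul_le_one
    have hwh : ‖y‖ • (‖y‖⁻¹ • y) = y := by
      rcases eq_or_ne y 0 with rfl | h0
      · simp
      · rw [smul_smul, mul_inv_cancel₀ (norm_ne_zero_iff.2 h0), one_smul]
    obtain ⟨b, hb1, hb2⟩ := h _ hw
    refine ⟨fun i => ‖y‖ • b i, fun i hi => ?_, fun s hs => ?_⟩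
    · rw [norm_smul, norm_norm, mul_comm]
      exact mul_le_mul_of_nonneg_right (hb1 i hi) (norm_nonneg _)
    · have e : L s y - ∑ i ∈ Finset.range (n + 1), s ^ i • ‖y‖ • b i =
          ‖y‖ • (L s (‖y‖⁻¹ • y) - ∑ i ∈ Finset.range (n + 1), s ^ i • b i) := by
        rw [smul_sub, ← map_smul, hwh, Finset.smul_sum]
        simp only [smul_comm ‖y‖]
      rw [e, norm_smul, norm_norm]
      exact (mul_le_mul_of_nonneg_left (hb2 s hs) (norm_nonneg _)).trans_eq (by ring)
  choose b hb1 hb2 using hall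
  have hadd : ∀ i ≤ n, ∀ y y', b (y + y') i = b y i + b y' i := by
    intro i hi y y'
    refine sub_eq_zero.1 (coeff_eq_zero_of_small (c := fun i => b (y + y') i - (b y i + b y' i))
      (K := C * ‖y + y'‖ + (C * ‖y‖ + C * ‖y'‖)) hr (fun s hs hsr => ?_) i hi)
    have hsr' : |s| ≤ r := by rwa [abs_of_pos hs]
    have e : ∑ i ∈ Finset.range (n + 1), s ^ i • (b (y + y') i - (b y i + b y' i)) =
        -(L s (y + y') - ∑ i ∈ Finset.range (n + 1), s ^ i • b (y + y') i) +
        ((L s y - ∑ i ∈ Finset.range (n + 1), s ^ i • b y i) +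
        (L s y' - ∑ i ∈ Finset.range (n + 1), s ^ i • b y' i)) := by
      simp only [smul_sub, smul_add, Finset.sum_sub_distrib, Finset.sum_add_distrib, map_add]
      abel
    rw [e, add_mul, add_mul]
    have h1 := hb2 (y + y') s hsr'
    have h2 := hb2 y s hsr'
    have h3 := hb2 y' s hsr'
    rw [abs_of_pos hs] at h1 h2 h3
    refine (norm_add_le _ _).trans (add_le_add ?_ ((norm_add_le _ _).trans (add_le_add h2 h3)))
    rwa [norm_neg]
  have hsmul : ∀ i ≤ n, ∀ (c : ℝ) (y : E), b (c • y) i = c • b y i := by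
    intro i hi c y
    refine sub_eq_zero.1 (coeff_eq_zero_of_small (c := fun i => b (c • y) i - c • b y i)
      (K := C * ‖c • y‖ + |c| * (C * ‖y‖)) hr (fun s hs hsr => ?_) i hi)
    have hsr' : |s| ≤ r := by rwa [abs_of_pos hs]
    have e : ∑ i ∈ Finset.range (n + 1), s ^ i • (b (c • y) i - c • b y i) =
        -(L s (c • y) - ∑ i ∈ Finset.range (n + 1), s ^ i • b (c • y) i) +
        c • (L s y - ∑ i ∈ Finset.range (n + 1), s ^ i • b y i) := by
      simp only [smul_sub, Finset.sum_sub_distrib, map_smul, Finset.smul_sum, smul_comm c]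
      abel
    rw [e, add_mul]
    have h1 := hb2 (c • y) s hsr'
    have h2 := hb2 y s hsr'
    rw [abs_of_pos hs] at h1 h2
    refine (norm_add_le _ _).trans (add_le_add (by rwa [norm_neg]) ?_)
    rw [norm_smul, Real.norm_eq_abs, mul_assoc]
    exact mul_le_mul_of_nonneg_left h2 (abs_nonneg _)
  have hB : ∀ i, ∃ B : E →L[ℝ] F, i ≤ n → ∀ y, B y = b y i := by
    intro i
    by_cases hi : i ≤ n
    · exact ⟨LinearMap.mkContinuous
        { toFun := fun y => b y i
          map_add' := hadd i hi
          map_smul' := hsmul i hi } C (fun y => hb1 y i hi), fun _ y => rfl⟩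
    · exact ⟨0, fun h => absurd h hi⟩
  choose B hB using hB
  refine ⟨B, fun i hi => ContinuousLinearMap.opNorm_le_bound _ hC fun y => ?_, fun s hs =>
    ContinuousLinearMap.opNorm_le_bound _ (by positivity) fun y => ?_⟩
  · rw [hB i hi]; exact hb1 y i hi
  · have h1 := hb2 y s hs
    have e : (L s - ∑ i ∈ Finset.range (n + 1), s ^ i • B i) y =
        L s y - ∑ i ∈ Finset.range (n + 1), s ^ i • b y i := by
      rw [sub_apply, sum_apply]
      congr 1
      refine Finset.sum_congr rfl fun i hi => ?_
      rw [smul_apply, hB i (by have := Finset.mem_range.1 hi; omega)]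
    rw [e]
    exact h1.trans_eq (by ring)

end LineTaylor

/-- Numerical differentiation at `0` that is exact on polynomials of degree at most `n`. -/
lemma exists_differentiation_nodes (n : ℕ) : ∃ lam c : ℕ → ℝ,
    (∀ l ∈ Finset.range (n + 1), |lam l| ≤ 1) ∧
    ∀ i ≤ n, ∑ l ∈ Finset.range (n + 1), c l * lam l ^ i = if i = 1 then 1 else 0 := by
  set lam : ℕ → ℝ := fun l => l / (n + 1) with hlam
  have hn : (0 : ℝ) < n + 1 := by positivity
  have hinj : Set.InjOn lam (Finset.range (n + 1) : Finset ℕ) := by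
    intro a _ b _ h
    simp only [hlam] at h
    rw [div_left_inj' hn.ne'] at h
    exact_mod_cast h
  refine ⟨lam, fun l => (Lagrange.basis (Finset.range (n + 1)) lam l).coeff 1, ?_, ?_⟩
  · intro l hl
    rw [abs_of_nonneg (by positivity), div_le_one hn]
    have := Finset.mem_range.1 hl
    exact_mod_cast this.le
  · intro i hi
    have h := Lagrange.eq_interpolate (f := (Polynomial.X ^ i : Polynomial ℝ)) hinj (by
      rw [Polynomial.degree_X_pow, Finset.card_range]
      exact_mod_cast Nat.lt_succ_of_le hi)
    have h2 := congrArg (fun p => Polynomial.coeff p 1) h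
    simp only [Lagrange.interpolate_apply, Polynomial.finsetSum_coeff, Polynomial.coeff_C_mul,
      Polynomial.eval_pow, Polynomial.eval_X, Polynomial.coeff_X_pow] at h2
    rw [show (if i = 1 then (1 : ℝ) else 0) = if 1 = i then 1 else 0 by simp only [eq_comm], h2]
    exact Finset.sum_congr rfl fun l _ => mul_comm _ _

section LineTaylor
variable {E F : Type*} [NormedAddCommGroup E] [NormedSpace ℝ E]
  [NormedAddCommGroup F] [NormedSpace ℝ F]

lemma hasLineTaylor_fderiv {n : ℕ} {f : E → F} {x₀ : E} (h : HasLineTaylor (n + 1) f x₀) :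
    HasLineTaylor n (fderiv ℝ f) x₀ := by
  obtain ⟨r, hr, C, H⟩ := h
  have hC : 0 ≤ C := by
    obtain ⟨a, ha, -⟩ := H x₀ (mem_ball_self hr) 0 (by simp)
    exact (norm_nonneg _).trans (ha 0 (by omega))
  have hdiff : ∀ x ∈ ball x₀ r, DifferentiableAt ℝ f x := by
    intro x hx
    have hd : 0 < r - dist x x₀ := sub_pos.2 hx
    have : HasLineTaylor (n + 1) f x := by
      refine ⟨_, hd, C, fun y hy w hw => ?_⟩
      obtain ⟨a, ha, hb⟩ := H y (ball_subset (by simp) hy) w hw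
      exact ⟨a, ha, fun s hs => hb s (hs.trans (by simp))⟩
    exact this.one_of_succ.differentiableAt
  have hone : ∀ x ∈ ball x₀ r, ∀ (w : E) (a : ℕ → F), (∀ s : ℝ, |s| ≤ r →
      ‖f (x + s • w) - ∑ i ∈ Finset.range (n + 1 + 1), s ^ i • a i‖ ≤ C * |s| ^ (n + 1 + 1)) →
      a 1 = fderiv ℝ f x w := by
    intro x hx w a ha
    have h1 : HasLineDerivAt ℝ f (a 1) x w := expansion_one hr ha
    exact h1.unique ((hdiff x hx).hasFDerivAt.hasLineDerivAt w)
  obtain ⟨lam, c, hlam, hc⟩ := exists_differentiation_nodes (n + 1)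
  set S := ∑ l ∈ Finset.range (n + 1 + 1), |c l| with hS
  have hS0 : 0 ≤ S := Finset.sum_nonneg fun _ _ => abs_nonneg _
  refine ⟨r / 4, by positivity, S * (C * (2 ^ (n + 2) + 1)), fun x hx w hw => ?_⟩
  refine exists_operator_expansion (L := fun s => fderiv ℝ f (x + s • w)) (by positivity)
    fun y hy => ?_
  have hxr : x ∈ ball x₀ r := ball_subset_ball (by linarith) hx
  have hdir : ∀ l ∈ Finset.range (n + 1 + 1), ‖(1 / 2 : ℝ) • (w + lam l • y)‖ ≤ 1 := by
    intro l hl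
    rw [norm_smul]
    have h1 := norm_add_le w (lam l • y)
    rw [norm_smul, Real.norm_eq_abs] at h1
    have h2 : |lam l| * ‖y‖ ≤ 1 := mul_le_one₀ (hlam l hl) (norm_nonneg _) hy
    rw [Real.norm_of_nonneg (by norm_num)]
    linarith
  have hα : ∀ l, ∃ a : ℕ → F, l ∈ Finset.range (n + 1 + 1) → (∀ i ≤ n + 1, ‖a i‖ ≤ C) ∧
      ∀ s : ℝ, |s| ≤ r → ‖f (x + s • ((1 / 2 : ℝ) • (w + lam l • y))) -
        ∑ i ∈ Finset.range (n + 1 + 1), s ^ i • a i‖ ≤ C * |s| ^ (n + 1 + 1) := by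
    intro l
    by_cases hl : l ∈ Finset.range (n + 1 + 1)
    · obtain ⟨a, ha⟩ := H x hxr _ (hdir l hl)
      exact ⟨a, fun _ => ha⟩
    · exact ⟨0, fun h => absurd h hl⟩
  choose α hα using hα
  set b : ℕ → F := fun i => (2 : ℝ) ^ i • ∑ l ∈ Finset.range (n + 1 + 1), c l • α l i with hb
  have hbnorm : ∀ i ≤ n + 1, ‖b i‖ ≤ 2 ^ (n + 1) * (S * C) := by
    intro i hi
    rw [hb]
    simp only
    rw [norm_smul, norm_pow, Real.norm_of_nonneg (by norm_num)]
    refine mul_le_mul (pow_le_pow_right₀ (by norm_num) hi) ?_ (norm_nonneg _) (by positivity)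
    rw [hS, Finset.sum_mul]
    refine (norm_sum_le _ _).trans (Finset.sum_le_sum fun l hl => ?_)
    rw [norm_smul, Real.norm_eq_abs]
    exact mul_le_mul_of_nonneg_left ((hα l hl).1 i hi) (abs_nonneg _)
  have hkey : ∀ s : ℝ, |s| ≤ r / 4 → ‖s • fderiv ℝ f (x + s • w) y -
      ∑ i ∈ Finset.range (n + 1 + 1), s ^ i • b i‖ ≤
      S * (C * (2 ^ (n + 2) + 1)) * |s| ^ (n + 1 + 1) := by
    intro s hs
    have hxs : x + s • w ∈ ball x₀ r := by
      rw [mem_ball, dist_eq_norm] at hx ⊢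
      have h1 : ‖s • w‖ ≤ r / 4 := by
        rw [norm_smul, Real.norm_eq_abs]
        exact (mul_le_of_le_one_right (abs_nonneg _) hw).trans hs
      calc ‖x + s • w - x₀‖ = ‖(x - x₀) + s • w‖ := by congr 1; abel
        _ ≤ _ := norm_add_le _ _
        _ < r := by linarith
    obtain ⟨β, -, hβ⟩ := H _ hxs y hy
    have hβ1 := hone _ hxs y β hβ
    have e1 : ∑ l ∈ Finset.range (n + 1 + 1), c l •
        ∑ i ∈ Finset.range (n + 1 + 1), (s * lam l) ^ i • β i = s • β 1 := by
      simp only [Finset.smul_sum]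
      rw [Finset.sum_comm]
      have : ∀ i ∈ Finset.range (n + 1 + 1), ∑ l ∈ Finset.range (n + 1 + 1),
          c l • (s * lam l) ^ i • β i = (s ^ i * if i = 1 then 1 else 0) • β i := by
        intro i hi
        rw [← hc i (by have := Finset.mem_range.1 hi; omega), Finset.mul_sum, Finset.sum_smul]
        refine Finset.sum_congr rfl fun l _ => ?_
        rw [smul_smul, mul_pow]; congr 1; ring
      rw [Finset.sum_congr rfl this, Finset.sum_eq_single 1]
      · simp
      · intro i _ hi; simp [hi]
      · intro h; exact absurd (Finset.mem_range.2 (by omega)) h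
    have e2 : ∑ l ∈ Finset.range (n + 1 + 1), c l •
        ∑ i ∈ Finset.range (n + 1 + 1), (2 * s) ^ i • α l i =
        ∑ i ∈ Finset.range (n + 1 + 1), s ^ i • b i := by
      simp only [Finset.smul_sum, hb]
      rw [Finset.sum_comm]
      refine Finset.sum_congr rfl fun i _ => Finset.sum_congr rfl fun l _ => ?_
      rw [smul_smul, smul_smul, smul_smul, mul_pow]; congr 1; ring
    rw [← hβ1, ← e1, ← e2, ← Finset.sum_sub_distrib, hS, Finset.sum_mul, Finset.sum_mul]
    refine (norm_sum_le _ _).trans (Finset.sum_le_sum fun l hl => ?_)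
    rw [← smul_sub, norm_smul, Real.norm_eq_abs, mul_assoc]
    refine mul_le_mul_of_nonneg_left ?_ (abs_nonneg _)
    have h1 := (hα l hl).2 (2 * s) (by rw [abs_mul, abs_two]; linarith [abs_nonneg s])
    have hsl : |s * lam l| ≤ |s| := by
      rw [abs_mul]; exact mul_le_of_le_one_right (abs_nonneg _) (hlam l hl)
    have h2 := hβ (s * lam l) (hsl.trans (by linarith))
    have e3 : x + (2 * s) • ((1 / 2 : ℝ) • (w + lam l • y)) = x + s • w + (s * lam l) • y := by
      module
    rw [e3] at h1
    have h3 : C * |s * lam l| ^ (n + 1 + 1) ≤ C * |s| ^ (n + 1 + 1) :=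
      mul_le_mul_of_nonneg_left (pow_le_pow_left₀ (abs_nonneg _) hsl _) hC
    have h4 : |2 * s| ^ (n + 1 + 1) = 2 ^ (n + 2) * |s| ^ (n + 1 + 1) := by
      rw [abs_mul, abs_two, mul_pow]
    rw [h4] at h1
    rw [← sub_sub_sub_cancel_left _ _ (f (x + s • w + (s * lam l) • y))]
    refine (norm_sub_le _ _).trans ((add_le_add h1 (h2.trans h3)).trans_eq ?_)
    ring
  have hb0 : b 0 = 0 := by
    have := hkey 0 (by simp only [abs_zero]; positivity)
    rw [Finset.sum_range_succ'] at this
    simpa [pow_succ] using this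
  have hb1 : b 1 = fderiv ℝ f x y := by
    have : ∀ l ∈ Finset.range (n + 1 + 1), c l • α l 1 =
        (1 / 2 * (c l * lam l ^ 0)) • fderiv ℝ f x w +
        (1 / 2 * (c l * lam l ^ 1)) • fderiv ℝ f x y := by
      intro l hl
      rw [hone x hxr _ (α l) (hα l hl).2, map_smul, map_add, map_smul]
      module
    simp only [hb]
    rw [Finset.sum_congr rfl this, Finset.sum_add_distrib, ← Finset.sum_smul, ← Finset.sum_smul,
      ← Finset.mul_sum, ← Finset.mul_sum, hc 0 (by omega), hc 1 (by omega)]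
    norm_num [smul_smul]
  have h2n : (2 : ℝ) ^ (n + 1) * (S * C) ≤ S * (C * (2 ^ (n + 2) + 1)) := by
    have : (0 : ℝ) ≤ S * C := by positivity
    have h3 : (0 : ℝ) < 2 ^ (n + 1) := by positivity
    rw [pow_succ 2 (n + 1)]
    nlinarith
  clear_value b
  refine ⟨fun i => b (i + 1), fun i hi => (hbnorm _ (by omega)).trans h2n, fun s hs => ?_⟩
  rcases eq_or_ne s 0 with rfl | hs0
  · rw [Finset.sum_range_succ']
    simp [pow_succ, hb1]
  · have h1 := hkey s hs
    rw [Finset.sum_range_succ', hb0, smul_zero, add_zero] at h1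
    have e : s • fderiv ℝ f (x + s • w) y -
        ∑ i ∈ Finset.range (n + 1), s ^ (i + 1) • b (i + 1) =
        s • (fderiv ℝ f (x + s • w) y - ∑ i ∈ Finset.range (n + 1), s ^ i • b (i + 1)) := by
      rw [smul_sub, Finset.smul_sum]
      congr 1
      exact Finset.sum_congr rfl fun i _ => by rw [smul_smul, pow_succ']
    rw [e, norm_smul, Real.norm_eq_abs, pow_succ' _ (n + 1)] at h1
    have hs' : 0 < |s| := abs_pos.2 hs0
    refine le_of_mul_le_mul_left (h1.trans_eq ?_) hs'
    ring

end LineTaylor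

universe u v

lemma contDiffOn_of_hasLineTaylor_aux {E : Type u} [NormedAddCommGroup E] [NormedSpace ℝ E]
    {U : Set E} (hU : IsOpen U) (n : ℕ) : ∀ {F : Type (max u v)} [NormedAddCommGroup F]
      [NormedSpace ℝ F] {f : E → F}, (∀ x ∈ U, HasLineTaylor (n + 1) f x) →
      ContDiffOn ℝ n f U := by
  induction n with
  | zero =>
    intro F _ _ f h
    refine contDiffOn_zero.2 fun x hx => ?_
    exact (h x hx).one_of_succ.differentiableAt.continuousAt.continuousWithinAt
  | succ n ih =>
    intro F _ _ f h
    rw [Nat.cast_succ, contDiffOn_succ_iff_fderiv_of_isOpen hU]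
    refine ⟨fun x hx => (h x hx).one_of_succ.differentiableAt.differentiableWithinAt, by simp,
      ih fun x hx => hasLineTaylor_fderiv (h x hx)⟩

lemma contDiffOn_of_hasLineTaylor {E : Type u} [NormedAddCommGroup E] [NormedSpace ℝ E]
    {F : Type v} [NormedAddCommGroup F] [NormedSpace ℝ F] {U : Set E} (hU : IsOpen U) {f : E → F}
    (h : ∀ x ∈ U, ∀ n, HasLineTaylor n f x) : ContDiffOn ℝ (⊤ : ℕ∞) f U := by
  have h1 : ContDiffOn ℝ (⊤ : ℕ∞) (fderiv ℝ f) U := contDiffOn_infty.2 fun n =>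
    contDiffOn_of_hasLineTaylor_aux.{u, v} hU n fun x hx => hasLineTaylor_fderiv (h x hx (n + 2))
  refine (contDiffOn_infty_iff_fderiv_of_isOpen hU).2
    ⟨fun x hx => (h x hx 1).differentiableAt.differentiableWithinAt, h1⟩

section LinePoly
variable {E : Type*} [NormedAddCommGroup E] [NormedSpace ℝ E]

/-- The Taylor polynomial of degree less than `p` of `t ↦ G (x + t • w)` at `0`, as an entire
function. -/
def linePoly (G : E → ℂ) (x w : E) (p : ℕ) (z : ℂ) : ℂ :=
  ∑ k ∈ Finset.range p, iteratedFDeriv ℝ k G x (fun _ => w) / (k.factorial : ℂ) * z ^ k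

lemma differentiable_linePoly (G : E → ℂ) (x w : E) (p : ℕ) :
    Differentiable ℂ (linePoly G x w p) := by
  unfold linePoly; fun_prop

lemma norm_iteratedFDeriv_diag_le {G : E → ℂ} {x w : E} (hw : ‖w‖ ≤ 1) (k : ℕ) :
    ‖iteratedFDeriv ℝ k G x (fun _ => w)‖ ≤ ‖iteratedFDeriv ℝ k G x‖ := by
  refine (ContinuousMultilinearMap.le_opNorm _ _).trans ?_
  refine mul_le_of_le_one_right (norm_nonneg _) ?_
  exact Finset.prod_le_one (fun _ _ => norm_nonneg _) fun _ _ => hw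

lemma norm_linePoly_le {G : E → ℂ} {x w : E} {p : ℕ} {A R : ℝ} (hw : ‖w‖ ≤ 1)
    (h : ∀ k < p, ‖iteratedFDeriv ℝ k G x‖ * (2 * R) ^ k ≤ A * k.factorial) (hA : 0 ≤ A)
    {z : ℂ} (hz : ‖z‖ ≤ R) : ‖linePoly G x w p z‖ ≤ 2 * A := by
  have hterm : ∀ k ∈ Finset.range p,
      ‖iteratedFDeriv ℝ k G x (fun _ => w) / (k.factorial : ℂ) * z ^ k‖ ≤ A * (1 / 2) ^ k := by
    intro k hk
    have hf : (0 : ℝ) < k.factorial := by positivity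
    have h1 := h k (Finset.mem_range.1 hk)
    have h2 : ‖z‖ ^ k ≤ R ^ k := pow_le_pow_left₀ (norm_nonneg _) hz k
    have h3 := norm_iteratedFDeriv_diag_le (G := G) (x := x) hw k
    rw [norm_mul, norm_div, norm_pow, Complex.norm_natCast, div_mul_eq_mul_div, div_le_iff₀ hf,
      one_div, inv_pow]
    rw [mul_pow] at h1
    have h4 : ‖iteratedFDeriv ℝ k G x (fun _ => w)‖ * ‖z‖ ^ k ≤
        ‖iteratedFDeriv ℝ k G x‖ * R ^ k := mul_le_mul h3 h2 (by positivity) (by positivity)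
    refine h4.trans ?_
    have h5 : (0 : ℝ) < 2 ^ k := by positivity
    rw [mul_right_comm, ← div_eq_mul_inv, le_div_iff₀ h5]
    linarith
  refine (norm_sum_le _ _).trans ((Finset.sum_le_sum hterm).trans ?_)
  rw [← Finset.mul_sum, mul_comm]
  exact mul_le_mul_of_nonneg_right (sum_geometric_two_le p) hA

lemma norm_linePoly_sub_le {U : Set E} (hU : IsOpen U) {G : E → ℂ}
    (hG : ContDiffOn ℝ (⊤ : ℕ∞) G U) {x w : E} {p : ℕ} {R K : ℝ} (hw : ‖w‖ ≤ 1)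
    (hR : ∀ t : ℝ, |t| ≤ R → x + t • w ∈ U)
    (hK : ∀ t : ℝ, |t| ≤ R → ‖iteratedFDeriv ℝ p G (x + t • w)‖ ≤ K) {s : ℝ} (hs : |s| ≤ R) :
    ‖linePoly G x w p s - G (x + s • w)‖ ≤ K * R ^ p / p.factorial := by
  have h := taylor_line hU hG p hR
    (fun t ht => (norm_iteratedFDeriv_diag_le hw p).trans (hK t ht)) hs
  have e : linePoly G x w p s =
      ∑ k ∈ Finset.range p, (s ^ k / (k.factorial : ℝ)) • iteratedFDeriv ℝ k G x fun _ => w := by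
    refine Finset.sum_congr rfl fun k _ => ?_
    rw [Complex.real_smul]; push_cast; ring
  have hK0 : 0 ≤ K := (norm_nonneg _).trans (hK s hs)
  rw [e, norm_sub_rev]
  refine h.trans ?_
  gcongr

lemma exists_local_derivative_bound {U : Set E} (hU : IsOpen U) {G : E → ℂ}
    (hG : ContDiffOn ℝ (⊤ : ℕ∞) G U) {x₀ : E} (hx₀ : x₀ ∈ U) (p : ℕ) :
    ∃ r > 0, ∃ A, ball x₀ r ⊆ U ∧ ∀ x ∈ ball x₀ r, ∀ k ≤ p, ‖iteratedFDeriv ℝ k G x‖ ≤ A := by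
  have hk : ∀ k : ℕ, ∀ᶠ x in 𝓝 x₀, ‖iteratedFDeriv ℝ k G x‖ < ‖iteratedFDeriv ℝ k G x₀‖ + 1 := by
    intro k
    have hc : ContinuousAt (iteratedFDeriv ℝ k G) x₀ := by
      have h1 : ContDiffAt ℝ (⊤ : ℕ∞) G x₀ := hG.contDiffAt (hU.mem_nhds hx₀)
      exact (h1.iteratedFDeriv_right (m := 0) (i := k)
        (by rw [zero_add]; exact_mod_cast le_top)).continuousAt
    exact hc.norm.eventually_lt_const (by linarith)
  have hall : ∀ᶠ x in 𝓝 x₀, x ∈ U ∧ ∀ k ∈ Finset.range (p + 1),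
      ‖iteratedFDeriv ℝ k G x‖ < ‖iteratedFDeriv ℝ k G x₀‖ + 1 :=
    (hU.eventually_mem hx₀).and ((Filter.eventually_all_finset _).2 fun k _ => hk k)
  obtain ⟨r, hr, hb⟩ := Metric.eventually_nhds_iff_ball.1 hall
  refine ⟨r, hr, ∑ k ∈ Finset.range (p + 1), (‖iteratedFDeriv ℝ k G x₀‖ + 1),
    fun x hx => (hb x hx).1, fun x hx k hkp => ?_⟩
  have hm : k ∈ Finset.range (p + 1) := Finset.mem_range.2 (by omega)
  exact ((hb x hx).2 k hm).le.trans
    (Finset.single_le_sum (f := fun k => ‖iteratedFDeriv ℝ k G x₀‖ + 1)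
      (fun i _ => by positivity) hm)

lemma hasLineTaylor_of_smooth_powers {U : Set E} (hU : IsOpen U) {f : E → ℂ} {j : ℕ} (hj : 1 ≤ j)
    (hG : ContDiffOn ℝ (⊤ : ℕ∞) (fun x => f x ^ j) U)
    (hH : ContDiffOn ℝ (⊤ : ℕ∞) (fun x => f x ^ (j + 1)) U) {x₀ : E} (hx₀ : x₀ ∈ U) (n : ℕ) :
    HasLineTaylor n f x₀ := by
  set D := 16 * j ^ 2 * (j + 1) with hD
  set p := 4 * (n + 2) * D with hp
  obtain ⟨r₁, hr₁, A₁, hU₁, hA₁⟩ := exists_local_derivative_bound hU hG hx₀ p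
  obtain ⟨r₂, hr₂, A₂, -, hA₂⟩ := exists_local_derivative_bound hU hH hx₀ p
  set A := max (max A₁ A₂) 1
  set r := min r₁ r₂
  have hr : 0 < r := lt_min hr₁ hr₂
  have hA1 : 1 ≤ A := le_max_right _ _
  have hrU : ball x₀ r ⊆ U := (ball_subset_ball (min_le_left _ _)).trans hU₁
  have hAG : ∀ x ∈ ball x₀ r, ∀ k ≤ p, ‖iteratedFDeriv ℝ k (fun x => f x ^ j) x‖ ≤ A :=
    fun x hx k hk => (hA₁ x (ball_subset_ball (min_le_left _ _) hx) k hk).trans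
      ((le_max_left _ _).trans (le_max_left _ _))
  have hAH : ∀ x ∈ ball x₀ r, ∀ k ≤ p, ‖iteratedFDeriv ℝ k (fun x => f x ^ (j + 1)) x‖ ≤ A :=
    fun x hx k hk => (hA₂ x (ball_subset_ball (min_le_right _ _) hx) k hk).trans
      ((le_max_right _ _).trans (le_max_left _ _))
  have h72 : (1 : ℝ) ≤ 72 ^ p := one_le_pow₀ (by norm_num)
  have hA' : 1 ≤ 2 * A * 72 ^ p := by nlinarith
  obtain ⟨B, hB, HB⟩ := exists_expansion_of_near_powers hj hA'
  set ρ := min (r / 144) (1 / 144) with hρ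
  have hρ0 : 0 < ρ := lt_min (by positivity) (by norm_num)
  have hρr : ρ ≤ r / 144 := min_le_left _ _
  have hρ1 : ρ ≤ 1 / 144 := min_le_right _ _
  refine ⟨ρ / 2, by positivity,
    B / ρ ^ n + 4 * B + (2 * B / ρ ^ (n + 1) + 18 * B * ρ * 4 ^ (n + 1)), fun x hx w hw => ?_⟩
  have hline : ∀ t : ℝ, |t| ≤ 72 * ρ → x + t • w ∈ ball x₀ r := by
    intro t ht
    rw [mem_ball, dist_eq_norm] at hx ⊢
    have h1 : ‖t • w‖ ≤ 72 * ρ := by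
      rw [norm_smul, Real.norm_eq_abs]
      exact (mul_le_of_le_one_right (abs_nonneg _) hw).trans ht
    calc ‖x + t • w - x₀‖ = ‖(x - x₀) + t • w‖ := by congr 1; abel
      _ ≤ _ := norm_add_le _ _
      _ < r := by linarith
  have hxr : x ∈ ball x₀ r := by
    have := hline 0 (by simp only [abs_zero]; positivity)
    simpa using this
  obtain ⟨a, ha, hb⟩ := HB (fun s => f (x + s • w)) n ρ 1 hρ0 zero_le_one (by
    intro i
    have h2i : (1 : ℝ) ≤ 2 ^ i := one_le_pow₀ (by norm_num)
    set ρi := ρ / 2 ^ i with hρi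
    have hρi0 : 0 < ρi := by positivity
    have hρi1 : ρi ≤ ρ := div_le_self hρ0.le h2i
    have hsub : ∀ t : ℝ, |t| ≤ 72 * ρi → x + t • w ∈ ball x₀ r :=
      fun t ht => hline t (ht.trans (by linarith))
    have hpoly : ∀ G : E → ℂ, ContDiffOn ℝ (⊤ : ℕ∞) G U →
        (∀ x ∈ ball x₀ r, ∀ k ≤ p, ‖iteratedFDeriv ℝ k G x‖ ≤ A) →
        (∀ z : ℂ, ‖z‖ ≤ 72 * ρi → ‖linePoly G x w p z‖ ≤ 2 * A * 72 ^ p) ∧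
        ∀ s : ℝ, |s| ≤ 72 * ρi →
          ‖linePoly G x w p s - G (x + s • w)‖ ≤ 2 * A * 72 ^ p * (ρi ^ (4 * (n + 2))) ^ D := by
      intro G hG hAG
      constructor
      · intro z hz
        refine (norm_linePoly_le (A := A) hw (fun k hk => ?_) (by linarith) hz).trans ?_
        · refine mul_le_mul (hAG x hxr k hk.le) ?_ (by positivity) (by linarith)
          have : (2 * (72 * ρi)) ^ k ≤ 1 := pow_le_one₀ (by positivity) (by linarith)
          exact this.trans (by exact_mod_cast Nat.one_le_iff_ne_zero.2 (Nat.factorial_ne_zero k))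
        · exact le_mul_of_one_le_right (by linarith) h72
      · intro s hs
        refine (norm_linePoly_sub_le hU hG hw (fun t ht => hrU (hsub t ht))
          (fun t ht => hAG _ (hsub t ht) p le_rfl) hs).trans ?_
        rw [← pow_mul, ← hp, mul_pow]
        refine (div_le_self (by positivity)
          (by exact_mod_cast Nat.one_le_iff_ne_zero.2 (Nat.factorial_ne_zero p))).trans ?_
        have : 0 ≤ A * (72 ^ p * ρi ^ p) := by positivity
        linarith
    obtain ⟨g1, g2⟩ := hpoly _ hG hAG
    obtain ⟨h1, h2⟩ := hpoly _ hH hAH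
    refine ⟨_, _, ρi ^ (4 * (n + 2)), differentiable_linePoly (fun x => f x ^ j) x w p,
      differentiable_linePoly (fun x => f x ^ (j + 1)) x w p, by positivity,
      pow_le_one₀ hρi0.le (by linarith), ?_, fun z hz => ⟨g1 z hz, h1 z hz⟩,
      fun s hs => ⟨g2 s hs, h2 s hs⟩⟩
    rw [one_mul, ← pow_mul, mul_comm 4])
  have hQ : 0 ≤ 2 * B / ρ ^ (n + 1) + 18 * B * ρ * 4 ^ (n + 1) := by positivity
  have hQ' : 0 ≤ B / ρ ^ n + 4 * B := by positivity
  refine ⟨a, fun k hk => (ha k hk).trans ?_, fun s hs => ?_⟩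
  · have h1 : B / ρ ^ k ≤ B / ρ ^ n :=
      div_le_div_of_nonneg_left (by linarith) (by positivity)
        (pow_le_pow_of_le_one hρ0.le (by linarith) hk)
    have h2 : 4 * B * 1 * ρ ^ (n + 2 - k) ≤ 4 * B :=
      (mul_le_of_le_one_right (by positivity) (pow_le_one₀ hρ0.le (by linarith))).trans_eq (by ring)
    linarith
  · have h1 := hb s hs
    simp only [Complex.real_smul, Complex.ofReal_pow]
    simp only [mul_comm (a _)] at h1
    refine h1.trans (mul_le_mul_of_nonneg_right ?_ (by positivity))
    rw [mul_one]
    linarith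

end LinePoly

lemma IsWeightSeq.lc_pos {M : ℕ → ℝ} (hM : IsWeightSeq M) (k : ℕ) : 0 < lc M k :=
  div_pos (hM.pos k) (by positivity)

lemma IsWeightSeq.lc_zero {M : ℕ → ℝ} (hM : IsWeightSeq M) : lc M 0 = 1 := by
  simp [lc, hM.first]

lemma eventually_pow_le_of_rootsTendsto {m : ℕ → ℝ} (hpos : ∀ k, 0 < m k) (hm : RootsTendsto m)
    {c : ℝ} (hc : 0 ≤ c) : ∀ᶠ k in atTop, c ^ k ≤ m k := by
  filter_upwards [hm.eventually_ge_atTop c, eventually_gt_atTop 0] with k hk hk0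
  have h := pow_le_pow_left₀ hc hk k
  rwa [one_div, Real.rpow_inv_natCast_pow (hpos k).le hk0.ne'] at h

lemma hfn_le {m : ℕ → ℝ} (hpos : ∀ k, 0 < m k) {t : ℝ} (ht : 0 < t) (k : ℕ) :
    hfn m t ≤ m k * t ^ k := by
  rw [hfn, if_neg (not_le.2 ht)]
  refine ciInf_le ⟨0, ?_⟩ k
  rintro _ ⟨i, rfl⟩
  exact (mul_pos (hpos i) (pow_pos ht i)).le

lemma exists_hfn_eq {m : ℕ → ℝ} (hpos : ∀ k, 0 < m k) (hm : RootsTendsto m) {t : ℝ}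
    (ht : 0 < t) : ∃ k, hfn m t = m k * t ^ k := by
  obtain ⟨K, hK⟩ := eventually_atTop.1
    (eventually_pow_le_of_rootsTendsto hpos hm (c := (max 1 (m 0)) / t) (by positivity))
  obtain ⟨k, -, hk⟩ := Finset.exists_min_image (Finset.range (K + 1)) (fun k => m k * t ^ k)
    ⟨0, Finset.mem_range.2 (by omega)⟩
  refine ⟨k, le_antisymm (hfn_le hpos ht k) ?_⟩
  rw [hfn, if_neg (not_le.2 ht)]
  refine le_ciInf fun i => ?_
  rcases lt_or_ge i (K + 1) with hi | hi
  · exact hk i (Finset.mem_range.2 hi)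
  · refine (hk 0 (Finset.mem_range.2 (by omega))).trans ?_
    have h1 := hK i (by omega)
    rw [div_pow, div_le_iff₀ (by positivity)] at h1
    refine le_trans ?_ h1
    rw [pow_zero, mul_one]
    exact (le_max_right _ _).trans (le_self_pow₀ (le_max_left _ _) (by omega))

lemma hfn_pos {m : ℕ → ℝ} (hpos : ∀ k, 0 < m k) (hm : RootsTendsto m) {t : ℝ}
    (ht : 0 < t) : 0 < hfn m t := by
  obtain ⟨k, hk⟩ := exists_hfn_eq hpos hm ht
  rw [hk]
  exact mul_pos (hpos k) (pow_pos ht k)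

lemma hfn_le_one {M : ℕ → ℝ} (hM : IsWeightSeq M) {t : ℝ} (ht : 0 < t) : hfn (lc M) t ≤ 1 := by
  simpa [hM.lc_zero] using hfn_le hM.lc_pos ht 0

lemma exists_hfn_le_sq {M N : ℕ → ℝ} (hM : IsWeightSeq M) (hN : IsWeightSeq N)
    (hm : RootsTendsto (lc M)) (h : mg N M < ⊤) :
    ∃ A : ℝ, 1 ≤ A ∧ ∀ t, 0 < t → hfn (lc N) t ≤ hfn (lc M) (A * t) ^ 2 := by
  set A := max 1 (mg N M).toReal with hA
  have hA1 : 1 ≤ A := le_max_left _ _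
  have hmul : ∀ j k, N (j + k) ≤ A ^ (j + k) * (M j * M k) := by
    intro j k
    have hMM : 0 < M j * M k := mul_pos (hM.pos j) (hM.pos k)
    rcases Nat.eq_zero_or_pos (j + k) with h0 | h0
    · obtain ⟨rfl, rfl⟩ : j = 0 ∧ k = 0 := by omega
      simp [hM.first, hN.first]
    · have hle : ENNReal.ofReal ((N (j + k) / (M j * M k)) ^ (((j : ℝ) + (k : ℝ))⁻¹)) ≤ mg N M :=
        le_iSup_of_le j (le_iSup_of_le k (le_iSup_of_le h0 le_rfl))
      have hq : 0 ≤ N (j + k) / (M j * M k) := (div_pos (hN.pos _) hMM).le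
      have h2 := ENNReal.toReal_mono h.ne hle
      rw [ENNReal.toReal_ofReal (Real.rpow_nonneg hq _)] at h2
      have h3 := pow_le_pow_left₀ (Real.rpow_nonneg hq _) (h2.trans (le_max_right 1 _)) (j + k)
      rw [← Nat.cast_add, Real.rpow_inv_natCast_pow hq h0.ne', div_le_iff₀ hMM] at h3
      exact h3
  refine ⟨A, hA1, fun t ht => ?_⟩
  have hAt : 0 < A * t := by positivity
  obtain ⟨k, hk⟩ := exists_hfn_eq hM.lc_pos hm hAt
  refine (hfn_le hN.lc_pos ht (k + k)).trans ?_
  rw [hk]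
  have h1 : lc N (k + k) ≤ A ^ (k + k) * (lc M k * lc M k) := by
    have hf : (0 : ℝ) < k.factorial * k.factorial := by positivity
    have hf2 : (k.factorial * k.factorial : ℝ) ≤ (k + k).factorial := by
      exact_mod_cast Nat.le_of_dvd (Nat.factorial_pos _)
        (Nat.factorial_mul_factorial_dvd_factorial_add k k)
    unfold lc
    calc N (k + k) / (k + k).factorial ≤ A ^ (k + k) * (M k * M k) / (k + k).factorial := by
          gcongr; exact hmul k k
      _ ≤ A ^ (k + k) * (M k * M k) / (k.factorial * k.factorial) := by
          refine div_le_div_of_nonneg_left ?_ hf hf2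
          have := hM.pos k
          positivity
      _ = _ := by field_simp
  calc lc N (k + k) * t ^ (k + k) ≤ A ^ (k + k) * (lc M k * lc M k) * t ^ (k + k) := by gcongr
    _ = _ := by rw [mul_pow]; ring

lemma exists_hfn_le_pow {W : Set (ℕ → ℝ)} (hW : BAdmissible W) (q : ℕ) : ∀ M ∈ W, ∃ N ∈ W,
    ∃ A : ℝ, 1 ≤ A ∧ ∀ t, 0 < t → hfn (lc N) t ≤ hfn (lc M) (A * t) ^ 2 ^ q := by
  induction q with
  | zero => exact fun M hM => ⟨M, hM, 1, le_rfl, fun t _ => by simp⟩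
  | succ q ih =>
    intro M hM
    obtain ⟨N₁, hN₁, hmg⟩ := hW.mgrowth M hM
    obtain ⟨A₁, hA₁, h₁⟩ := exists_hfn_le_sq (hW.matrix.weight M hM) (hW.matrix.weight N₁ hN₁)
      (hW.roots M hM) hmg
    obtain ⟨N, hN, A, hA, h⟩ := ih N₁ hN₁
    refine ⟨N, hN, A₁ * A, one_le_mul_of_one_le_of_one_le hA₁ hA, fun t ht => (h t ht).trans ?_⟩
    rw [pow_succ' 2 q, pow_mul, mul_assoc]
    refine pow_le_pow_left₀ ?_ (h₁ _ (by positivity)) _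
    exact (hfn_pos (hW.matrix.weight N₁ hN₁).lc_pos (hW.roots N₁ hN₁) (by positivity)).le

/-- Truncation orders: below `p` the terms of a second sequence of the matrix stay bounded, while at
`p` the term of a first one is smaller than a prescribed power of `h_m`. -/
lemma exists_truncation {W : Set (ℕ → ℝ)} (hW : BAdmissible W) {M : ℕ → ℝ} (hM : M ∈ W) (q : ℕ) :
    ∃ N ∈ W, ∃ N' ∈ W, ∃ A : ℝ, 1 ≤ A ∧ ∀ t, 0 < t → ∃ p : ℕ,
      (∀ k < p, lc N' k * t ^ k ≤ 1) ∧ lc N p * t ^ p ≤ hfn (lc M) (A * t) ^ q := by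
  obtain ⟨N, hN, A, hA, h⟩ := exists_hfn_le_pow hW q M hM
  obtain ⟨N', hN', C, hC, hΓ⟩ := hW.gamma N hN
  have wM := hW.matrix.weight M hM
  have wN := hW.matrix.weight N hN
  have wN' := hW.matrix.weight N' hN'
  refine ⟨N, hN, N', hN', A * C, one_le_mul_of_one_le_of_one_le hA hC, fun t ht =>
    ⟨GammaUpper (lc N) (C * t), ?_, ?_⟩⟩
  · have hlt : ∀ k < GammaUpper (lc N) (C * t), lc N' (k + 1) * t ≤ lc N' k := by
      intro k hk
      have h1 := Nat.notMem_of_lt_sInf (hk.trans_le (hΓ t ht))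
      rw [mem_ofPred_eq, not_le, div_lt_div_iff₀ (wN'.lc_pos k) ht, one_mul] at h1
      exact h1.le
    intro k
    induction k with
    | zero => intro _; simp [wN'.lc_zero]
    | succ k ih =>
      intro hk
      refine le_trans ?_ (ih (by omega))
      rw [pow_succ', ← mul_assoc]
      exact mul_le_mul_of_nonneg_right (hlt k (by omega)) (by positivity)
  · have hCt : 0 < C * t := by positivity
    have h1 : hfn (lc N) (C * t) = _ := Nat.sInf_mem (exists_hfn_eq wN.lc_pos (hW.roots N hN) hCt)
    have h2 : lc N (GammaUpper (lc N) (C * t)) * t ^ GammaUpper (lc N) (C * t) ≤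
        hfn (lc N) (C * t) := by
      rw [h1]
      refine mul_le_mul_of_nonneg_left (pow_le_pow_left₀ ht.le ?_ _) (wN.lc_pos _).le
      exact le_mul_of_one_le_left ht.le hC
    refine h2.trans ((h _ hCt).trans ?_)
    rw [mul_assoc]
    have hh : 0 < A * (C * t) := by positivity
    exact pow_le_pow_of_le_one (hfn_pos wM.lc_pos (hW.roots M hM) hh).le (hfn_le_one wM hh)
      Nat.lt_two_pow_self.le

lemma exists_pow_le_mul_of_rootsTendsto {m : ℕ → ℝ} (hpos : ∀ k, 0 < m k) (hm : RootsTendsto m)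
    {c : ℝ} (hc : 0 ≤ c) : ∃ C : ℝ, 0 ≤ C ∧ ∀ k, c ^ k ≤ C * m k := by
  obtain ⟨K, hK⟩ := eventually_atTop.1 (eventually_pow_le_of_rootsTendsto hpos hm hc)
  have hnn : ∀ k, 0 ≤ c ^ k / m k := fun k => div_nonneg (pow_nonneg hc k) (hpos k).le
  have hs : 0 ≤ ∑ k ∈ Finset.range K, c ^ k / m k := Finset.sum_nonneg fun k _ => hnn k
  refine ⟨1 + ∑ k ∈ Finset.range K, c ^ k / m k, by linarith, fun k => ?_⟩
  rcases lt_or_ge k K with hk | hk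
  · rw [← div_le_iff₀ (hpos k)]
    have := Finset.single_le_sum (f := fun k => c ^ k / m k) (fun i _ => hnn i)
      (Finset.mem_range.2 hk)
    linarith
  · exact (hK k hk).trans (le_mul_of_one_le_left (hpos k).le (by linarith))

section Local
variable {E : Type*} [NormedAddCommGroup E] [NormedSpace ℝ E]

lemma Beurling.exists_ball {W : Set (ℕ → ℝ)} (hW : IsWeightMatrix W) {U : Set E} (hU : IsOpen U)
    {G : E → ℂ} (hG : Beurling W U G) {x₀ : E} (hx₀ : x₀ ∈ U) {M : ℕ → ℝ} (hM : M ∈ W) {ρ : ℝ}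
    (hρ : 0 < ρ) : ∃ r > 0, ∃ C : ℝ, ball x₀ r ⊆ U ∧ ∀ x ∈ ball x₀ r, ∀ k,
      ‖iteratedFDeriv ℝ k G x‖ ≤ C * ρ ^ k * M k := by
  obtain ⟨r, hr, hrU⟩ := Metric.isOpen_iff.1 hU x₀ hx₀
  have wM := hW.weight M hM
  by_contra! hcon
  have hex : ∀ n : ℕ, ∃ x ∈ ball x₀ (r / (n + 1)), ∃ k,
      n * ρ ^ k * M k < ‖iteratedFDeriv ℝ k G x‖ := by
    intro n
    refine hcon (r / (n + 1)) (by positivity) n ((ball_subset_ball ?_).trans hrU)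
    exact div_le_self hr.le (by linarith [(Nat.cast_nonneg n : (0 : ℝ) ≤ n)])
  choose x hx k hk using hex
  have hxU : ∀ n, x n ∈ U := fun n => hrU (ball_subset_ball
    (div_le_self hr.le (by linarith [(Nat.cast_nonneg n : (0 : ℝ) ≤ n)])) (hx n))
  have hlim : Tendsto x atTop (𝓝 x₀) := by
    rw [tendsto_iff_dist_tendsto_zero]
    refine squeeze_zero (fun _ => dist_nonneg) (fun n => (mem_ball.1 (hx n)).le) ?_
    have := (tendsto_one_div_add_atTop_nhds_zero_nat (𝕜 := ℝ)).const_mul r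
    simpa [div_eq_mul_inv] using this
  obtain ⟨C, hC⟩ := hG.2 (insert x₀ (range x))
    (insert_subset hx₀ (range_subset_iff.2 hxU)) hlim.isCompact_insert_range M hM ρ hρ
  obtain ⟨n, hn⟩ := exists_nat_ge C
  have h1 := hC (x n) (mem_insert_of_mem _ ⟨n, rfl⟩) (k n)
  rw [iteratedFDerivWithin_of_isOpen (k n) hU (hxU n)] at h1
  have h2 : C * ρ ^ k n * M (k n) ≤ n * ρ ^ k n * M (k n) :=
    mul_le_mul_of_nonneg_right (mul_le_mul_of_nonneg_right hn (by positivity)) (wM.pos _).le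
  exact absurd (hk n) (not_lt.2 (h1.trans h2))

/-- The coefficients of an expansion along a line are the Taylor coefficients. -/
lemma iteratedFDeriv_diag_eq {U : Set E} (hU : IsOpen U) {f : E → ℂ}
    (hf : ContDiffOn ℝ (⊤ : ℕ∞) f U) {x w : E} (hx : x ∈ U) (hw : ‖w‖ ≤ 1) {n : ℕ} {r C : ℝ}
    (hr : 0 < r) {a : ℕ → ℂ}
    (ha : ∀ s : ℝ, |s| ≤ r →
      ‖f (x + s • w) - ∑ k ∈ Finset.range (n + 1), a k * (s : ℂ) ^ k‖ ≤ C * |s| ^ (n + 1)) :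
    iteratedFDeriv ℝ n f x (fun _ => w) = n.factorial * a n := by
  obtain ⟨δ, hδ, A, hδU, hA⟩ := exists_local_derivative_bound hU hf hx (n + 1)
  set R := min r (δ / 2)
  have hR : 0 < R := lt_min hr (by positivity)
  have hmem : ∀ t : ℝ, |t| ≤ R → x + t • w ∈ ball x δ := by
    intro t ht
    rw [mem_ball, dist_eq_norm, add_sub_cancel_left, norm_smul, Real.norm_eq_abs]
    have := (mul_le_of_le_one_right (abs_nonneg t) hw).trans (ht.trans (min_le_right _ _))
    linarith
  have hT : ∀ s : ℝ, |s| ≤ R → ‖f (x + s • w) - ∑ k ∈ Finset.range (n + 1),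
      (s ^ k / (k.factorial : ℝ)) • iteratedFDeriv ℝ k f x (fun _ => w)‖ ≤
      A * |s| ^ (n + 1) / ((n + 1).factorial : ℝ) := fun s hs =>
    taylor_line hU hf (n + 1) (fun t ht => hδU (hmem t ht))
      (fun t ht => (norm_iteratedFDeriv_diag_le hw _).trans (hA _ (hmem t ht) _ le_rfl)) hs
  have h0 := coeff_eq_zero_of_small (n := n)
    (c := fun k => a k - iteratedFDeriv ℝ k f x (fun _ => w) / (k.factorial : ℂ))
    (K := C + A / ((n + 1).factorial : ℝ)) hR (fun s hs hsR => by
      have hs' : |s| ≤ R := by rwa [abs_of_pos hs]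
      have h1 := ha s (hs'.trans (min_le_left _ _))
      have h2 := hT s hs'
      have e : ∑ k ∈ Finset.range (n + 1),
          s ^ k • (a k - iteratedFDeriv ℝ k f x (fun _ => w) / (k.factorial : ℂ)) =
          (f (x + s • w) - ∑ k ∈ Finset.range (n + 1),
            (s ^ k / (k.factorial : ℝ)) • iteratedFDeriv ℝ k f x (fun _ => w)) -
          (f (x + s • w) - ∑ k ∈ Finset.range (n + 1), a k * (s : ℂ) ^ k) := by
        rw [sub_sub_sub_cancel_left, ← Finset.sum_sub_distrib]
        refine Finset.sum_congr rfl fun k _ => ?_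
        simp only [Complex.real_smul]
        push_cast
        ring
      rw [e]
      refine (norm_sub_le _ _).trans ((add_le_add h2 h1).trans_eq ?_)
      rw [abs_of_pos hs]; ring) n le_rfl
  have hf0 : (n.factorial : ℂ) ≠ 0 := by exact_mod_cast n.factorial_ne_zero
  rw [sub_eq_zero] at h0
  rw [h0]
  field_simp

lemma exists_ball_diag_bound {W : Set (ℕ → ℝ)} (hW : BAdmissible W) {U : Set E} (hU : IsOpen U)
    {j : ℕ} (hj : 1 ≤ j) {f : E → ℂ} (hf : ContDiffOn ℝ (⊤ : ℕ∞) f U)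
    (h₁ : Beurling W U (fun x => f x ^ j)) (h₂ : Beurling W U (fun x => f x ^ (j + 1)))
    {x₀ : E} (hx₀ : x₀ ∈ U) {M : ℕ → ℝ} (hM : M ∈ W) {σ : ℝ} (hσ : 0 < σ) :
    ∃ r > 0, ∃ C : ℝ, ∀ x ∈ ball x₀ r, ∀ (k : ℕ) (w : E), ‖w‖ ≤ 1 →
      ‖iteratedFDeriv ℝ k f x (fun _ => w)‖ ≤ C * σ ^ k * M k := by
  set D := 16 * j ^ 2 * (j + 1) with hD
  obtain ⟨N, hN, N', hN', A₀, hA₀, htr⟩ := exists_truncation hW hM (8 * D)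
  have wM := hW.matrix.weight M hM
  have wN := hW.matrix.weight N hN
  have wN' := hW.matrix.weight N' hN'
  have rM := hW.roots M hM
  set τ := σ / (144 * A₀) with hτ
  have hτ0 : 0 < τ := by positivity
  have hloc : ∀ G : E → ℂ, Beurling W U G → ∃ r > 0, ∃ C : ℝ, ball x₀ r ⊆ U ∧
      ∀ x ∈ ball x₀ r, ∀ k, ‖iteratedFDeriv ℝ k G x‖ ≤ C * τ ^ k * N k ∧
        ‖iteratedFDeriv ℝ k G x‖ ≤ C * τ ^ k * N' k := by
    intro G hG
    obtain ⟨r, hr, C, hrU, hC⟩ := hG.exists_ball hW.matrix hU hx₀ hN hτ0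
    obtain ⟨r', hr', C', -, hC'⟩ := hG.exists_ball hW.matrix hU hx₀ hN' hτ0
    refine ⟨min r r', lt_min hr hr', max C C',
      (ball_subset_ball (min_le_left _ _)).trans hrU, fun x hx k => ⟨?_, ?_⟩⟩
    · refine (hC x (ball_subset_ball (min_le_left _ _) hx) k).trans ?_
      exact mul_le_mul_of_nonneg_right (mul_le_mul_of_nonneg_right (le_max_left _ _)
        (by positivity)) (wN.pos k).le
    · refine (hC' x (ball_subset_ball (min_le_right _ _) hx) k).trans ?_
      exact mul_le_mul_of_nonneg_right (mul_le_mul_of_nonneg_right (le_max_right _ _)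
        (by positivity)) (wN'.pos k).le
  obtain ⟨r₁, hr₁, A₁, hU₁, hA₁⟩ := hloc _ h₁
  obtain ⟨r₂, hr₂, A₂, -, hA₂⟩ := hloc _ h₂
  set A := max (max A₁ A₂) 1
  set r := min r₁ r₂
  have hr : 0 < r := lt_min hr₁ hr₂
  have hA1 : 1 ≤ A := le_max_right _ _
  have hrU : ball x₀ r ⊆ U := (ball_subset_ball (min_le_left _ _)).trans hU₁
  have hA' : 1 ≤ 2 * A := by linarith
  obtain ⟨B, hB, HB⟩ := exists_expansion_of_near_powers hj hA'
  set ρ := r / 144 with hρ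
  have hρ0 : 0 < ρ := by positivity
  obtain ⟨C', hC'0, hC'⟩ := exists_pow_le_mul_of_rootsTendsto wM.lc_pos rM (c := 1 / (ρ * σ))
    (by positivity)
  have hm2 := wM.lc_pos 2
  refine ⟨r / 2, by positivity, B * C' + 4 * B * lc M 2 * σ ^ 2 * ρ ^ 2, fun x hx n w hw => ?_⟩
  have hline : ∀ t : ℝ, |t| ≤ 72 * ρ → x + t • w ∈ ball x₀ r := by
    intro t ht
    rw [mem_ball, dist_eq_norm] at hx ⊢
    have h1 : ‖t • w‖ ≤ 72 * ρ := by
      rw [norm_smul, Real.norm_eq_abs]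
      exact (mul_le_of_le_one_right (abs_nonneg _) hw).trans ht
    calc ‖x + t • w - x₀‖ = ‖(x - x₀) + t • w‖ := by congr 1; abel
      _ ≤ _ := norm_add_le _ _
      _ < r := by linarith
  have hxr : x ∈ ball x₀ r := ball_subset_ball (by linarith) hx
  have hmn := wM.lc_pos n
  obtain ⟨a, ha, hb⟩ := HB (fun s => f (x + s • w)) n ρ (lc M n * lc M 2 * σ ^ (n + 2)) hρ0
    (by positivity) (by
    intro i
    have h2i : (1 : ℝ) ≤ 2 ^ i := one_le_pow₀ (by norm_num)
    set ρi := ρ / 2 ^ i with hρi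
    have hρi0 : 0 < ρi := by positivity
    have hρi1 : ρi ≤ ρ := div_le_self hρ0.le h2i
    have hsub : ∀ t : ℝ, |t| ≤ 72 * ρi → x + t • w ∈ ball x₀ r :=
      fun t ht => hline t (ht.trans (by linarith))
    set t := 2 * (72 * ρi) * τ with ht
    have ht0 : 0 < t := by positivity
    have hAt : A₀ * t = σ * ρi := by rw [ht, hτ]; field_simp; ring
    obtain ⟨p, hp1, hp2⟩ := htr t ht0
    set ν := hfn (lc M) (A₀ * t) with hν
    have hν0 : 0 < ν := hfn_pos wM.lc_pos rM (by positivity)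
    have hν1 : ν ≤ 1 := hfn_le_one wM (by positivity)
    have hpoly : ∀ G : E → ℂ, ContDiffOn ℝ (⊤ : ℕ∞) G U →
        (∀ x ∈ ball x₀ r, ∀ k, ‖iteratedFDeriv ℝ k G x‖ ≤ A * τ ^ k * N k ∧
          ‖iteratedFDeriv ℝ k G x‖ ≤ A * τ ^ k * N' k) →
        (∀ z : ℂ, ‖z‖ ≤ 72 * ρi → ‖linePoly G x w p z‖ ≤ 2 * A) ∧
        ∀ s : ℝ, |s| ≤ 72 * ρi →
          ‖linePoly G x w p s - G (x + s • w)‖ ≤ 2 * A * (ν ^ 8) ^ D := by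
      intro G hG hAG
      constructor
      · refine fun z hz => norm_linePoly_le hw (fun k hk => ?_) (by linarith) hz
        have h1 := (hAG x hxr k).2
        have h2 := hp1 k hk
        have hfac : (0 : ℝ) < k.factorial := by positivity
        calc _ ≤ A * τ ^ k * N' k * (2 * (72 * ρi)) ^ k :=
              mul_le_mul_of_nonneg_right h1 (by positivity)
          _ = A * (lc N' k * t ^ k) * k.factorial := by
              rw [ht, mul_pow _ τ, lc]; field_simp
          _ ≤ A * 1 * k.factorial := by
              exact mul_le_mul_of_nonneg_right
                (mul_le_mul_of_nonneg_left h2 (by linarith)) hfac.le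
          _ = _ := by ring
      · intro s hs
        refine (norm_linePoly_sub_le hU hG hw (fun t ht => hrU (hsub t ht))
          (fun t ht => (hAG _ (hsub t ht) p).1) hs).trans ?_
        rw [← pow_mul]
        have h3 : (τ * (72 * ρi)) ^ p ≤ t ^ p := by
          refine pow_le_pow_left₀ (by positivity) ?_ p
          rw [ht]; nlinarith [mul_pos hτ0 hρi0]
        have hNp := wN.lc_pos p
        calc A * τ ^ p * N p * (72 * ρi) ^ p / p.factorial
            = A * (lc N p * (τ * (72 * ρi)) ^ p) := by rw [lc, mul_pow τ]; ring
          _ ≤ A * (lc N p * t ^ p) := by gcongr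
          _ ≤ A * ν ^ (8 * D) := by gcongr
          _ ≤ 2 * A * ν ^ (8 * D) := by
            have : 0 < A * ν ^ (8 * D) := by positivity
            linarith
    obtain ⟨g1, g2⟩ := hpoly _ h₁.1 (fun x hx k => by
      have h := hA₁ x (ball_subset_ball (min_le_left _ _) hx) k
      have hle : A₁ ≤ A := (le_max_left _ _).trans (le_max_left _ _)
      have hn := wN.pos k
      have hn' := wN'.pos k
      exact ⟨h.1.trans (by gcongr), h.2.trans (by gcongr)⟩)
    obtain ⟨k1, k2⟩ := hpoly _ h₂.1 (fun x hx k => by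
      have h := hA₂ x (ball_subset_ball (min_le_right _ _) hx) k
      have hle : A₂ ≤ A := (le_max_right _ _).trans (le_max_left _ _)
      have hn := wN.pos k
      have hn' := wN'.pos k
      exact ⟨h.1.trans (by gcongr), h.2.trans (by gcongr)⟩)
    refine ⟨_, _, ν ^ 8, differentiable_linePoly (fun x => f x ^ j) x w p,
      differentiable_linePoly (fun x => f x ^ (j + 1)) x w p, by positivity,
      pow_le_one₀ hν0.le hν1, ?_, fun z hz => ⟨g1 z hz, k1 z hz⟩,
      fun s hs => ⟨g2 s hs, k2 s hs⟩⟩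
    have q1 : ν ≤ lc M n * (σ * ρi) ^ n := hAt ▸ hfn_le wM.lc_pos (by positivity) n
    have q2 : ν ≤ lc M 2 * (σ * ρi) ^ 2 := hAt ▸ hfn_le wM.lc_pos (by positivity) 2
    calc ν ^ 8 = (ν * ν) ^ 4 := by ring
      _ ≤ (lc M n * (σ * ρi) ^ n * (lc M 2 * (σ * ρi) ^ 2)) ^ 4 := by gcongr
      _ = _ := by congr 1; rw [mul_pow, mul_pow]; ring)
  have hUx : x ∈ U := hrU hxr
  rw [iteratedFDeriv_diag_eq hU hf hUx hw (half_pos hρ0) hb, norm_mul, Complex.norm_natCast]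
  have h1 := ha n le_rfl
  have h2 : 1 / ρ ^ n ≤ C' * lc M n * σ ^ n := by
    have := hC' n
    rw [div_pow, one_pow, mul_pow, div_le_iff₀ (by positivity)] at this
    rw [div_le_iff₀ (by positivity)]
    linarith
  have hfac : (0 : ℝ) < n.factorial := by positivity
  calc n.factorial * ‖a n‖ ≤ n.factorial * (B * (C' * lc M n * σ ^ n) +
        4 * B * (lc M n * lc M 2 * σ ^ (n + 2)) * ρ ^ 2) := by
        refine mul_le_mul_of_nonneg_left (h1.trans ?_) hfac.le
        rw [Nat.add_sub_cancel_left, div_eq_mul_one_div B]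
        gcongr
    _ = (B * C' + 4 * B * lc M 2 * σ ^ 2 * ρ ^ 2) * σ ^ n * (lc M n * n.factorial) := by ring
    _ = _ := by rw [show lc M n * n.factorial = M n from div_mul_cancel₀ _ hfac.ne']

end Local

section Symmetry
variable {E F : Type*} [NormedAddCommGroup E] [NormedSpace ℝ E]
  [NormedAddCommGroup F] [NormedSpace ℝ F]

lemma contDiffAt_iteratedFDeriv {U : Set E} (hU : IsOpen U) {f : E → F}
    (hf : ContDiffOn ℝ (⊤ : ℕ∞) f U) {x : E} (hx : x ∈ U) (n : ℕ) :
    ContDiffAt ℝ (⊤ : ℕ∞) (iteratedFDeriv ℝ n f) x :=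
  (hf.contDiffAt (hU.mem_nhds hx)).iteratedFDeriv_right (m := (⊤ : ℕ∞)) (i := n)
    (by exact_mod_cast le_top)

lemma iteratedFDeriv_comp_swap_zero_one {U : Set E} (hU : IsOpen U) {f : E → F}
    (hf : ContDiffOn ℝ (⊤ : ℕ∞) f U) {x : E} (hx : x ∈ U) (n : ℕ) (v : Fin (n + 2) → E) :
    iteratedFDeriv ℝ (n + 2) f x (v ∘ Equiv.swap 0 1) = iteratedFDeriv ℝ (n + 2) f x v := by
  have key : ∀ v : Fin (n + 2) → E, iteratedFDeriv ℝ (n + 2) f x v =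
      fderiv ℝ (fderiv ℝ (iteratedFDeriv ℝ n f)) x (v 0) (v 1) (Fin.tail (Fin.tail v)) := by
    intro v
    rw [iteratedFDeriv_succ_apply_left]
    have hd : DifferentiableAt ℝ (fderiv ℝ (iteratedFDeriv ℝ n f)) x :=
      ((contDiffAt_iteratedFDeriv hU hf hx n).fderiv_right (m := (⊤ : ℕ∞))
        (by exact_mod_cast le_top)).differentiableAt (by simp)
    have hd' : DifferentiableAt ℝ (iteratedFDeriv ℝ (n + 1) f) x :=
      (contDiffAt_iteratedFDeriv hU hf hx (n + 1)).differentiableAt (by simp)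
    have e1 : HasFDerivAt (fun y => iteratedFDeriv ℝ (n + 1) f y (Fin.tail v))
        ((ContinuousMultilinearMap.apply ℝ (fun _ : Fin (n + 1) => E) F (Fin.tail v)).comp
          (fderiv ℝ (iteratedFDeriv ℝ (n + 1) f) x)) x :=
      (ContinuousMultilinearMap.apply ℝ (fun _ : Fin (n + 1) => E) F
        (Fin.tail v)).hasFDerivAt.comp x hd'.hasFDerivAt
    have e2 := hd.hasFDerivAt.clm_apply (hasFDerivAt_const (v 1) x)
    have e4 := (ContinuousMultilinearMap.apply ℝ (fun _ : Fin n => E) F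
      (Fin.tail (Fin.tail v))).hasFDerivAt.comp x e2
    have e3 := DFunLike.congr_fun (e1.unique e4) (v 0)
    simpa using e3
  have hs : IsSymmSndFDerivAt ℝ (iteratedFDeriv ℝ n f) x :=
    (contDiffAt_iteratedFDeriv hU hf hx n).isSymmSndFDerivAt
      (by
        rw [minSmoothness_of_isRCLikeNormedField]
        exact WithTop.coe_le_coe.2 (le_top : (2 : ℕ∞) ≤ ⊤))
  rw [key, key, hs.eq]
  congr 1

lemma iteratedFDeriv_comp_perm_of_smooth {U : Set E} (hU : IsOpen U) {f : E → F}
    (hf : ContDiffOn ℝ (⊤ : ℕ∞) f U) (n : ℕ) : ∀ x ∈ U, ∀ (σ : Equiv.Perm (Fin n))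
      (v : Fin n → E), iteratedFDeriv ℝ n f x (v ∘ σ) = iteratedFDeriv ℝ n f x v := by
  induction n with
  | zero => intro x _ σ v; congr 1; exact Subsingleton.elim _ _
  | succ n ih =>
    intro x hx σ
    have hσ : σ ∈ Submonoid.closure (Set.range fun i : Fin n =>
        Equiv.swap i.castSucc i.succ) := by
      rw [Equiv.Perm.mclosure_swap_castSucc_succ]; trivial
    induction hσ using Submonoid.closure_induction with
    | one => intro v; rfl
    | mul σ τ _ _ h1 h2 =>
      intro v
      rw [Equiv.Perm.coe_mul, ← Function.comp_assoc, h2, h1]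
    | mem σ hσ =>
      obtain ⟨i, rfl⟩ := hσ
      intro v
      rcases n with _ | n
      · exact i.elim0
      · induction i using Fin.cases with
        | zero => exact iteratedFDeriv_comp_swap_zero_one hU hf hx n v
        | succ i =>
          have hd : DifferentiableAt ℝ (iteratedFDeriv ℝ (n + 1) f) x :=
            (contDiffAt_iteratedFDeriv hU hf hx (n + 1)).differentiableAt (by simp)
          have hap : ∀ w : Fin (n + 1) → E,
              HasFDerivAt (fun y => iteratedFDeriv ℝ (n + 1) f y w)
              ((ContinuousMultilinearMap.apply ℝ (fun _ : Fin (n + 1) => E) F w).comp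
                (fderiv ℝ (iteratedFDeriv ℝ (n + 1) f) x)) x := fun w =>
            (ContinuousMultilinearMap.apply ℝ (fun _ : Fin (n + 1) => E) F w).hasFDerivAt.comp x
              hd.hasFDerivAt
          set σ' : Equiv.Perm (Fin (n + 1)) := Equiv.swap i.castSucc i.succ with hσ'
          have e0 : (v ∘ (Equiv.swap i.succ.castSucc i.succ.succ)) 0 = v 0 := by
            simp only [Function.comp_apply]
            rw [Equiv.swap_apply_of_ne_of_ne]
            · rw [← Fin.succ_castSucc]; exact (Fin.succ_ne_zero _).symm
            · exact (Fin.succ_ne_zero _).symm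
          have et : Fin.tail (v ∘ (Equiv.swap i.succ.castSucc i.succ.succ)) =
              Fin.tail v ∘ σ' := by
            funext k
            simp only [Fin.tail, Function.comp_apply]
            rw [← Fin.succ_castSucc, (Fin.succ_injective _).swap_apply]
          rw [iteratedFDeriv_succ_apply_left, iteratedFDeriv_succ_apply_left, e0, et]
          have h1 := (hap (Fin.tail v)).congr_of_eventuallyEq
            (f₁ := fun y => iteratedFDeriv ℝ (n + 1) f y (Fin.tail v ∘ σ'))
            (Filter.eventuallyEq_of_mem (hU.mem_nhds hx) fun y hy => ih y hy σ' _)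
          exact DFunLike.congr_fun ((hap (Fin.tail v ∘ σ')).unique h1) (v 0)

end Symmetry

section Polarization
variable {E F : Type*} [NormedAddCommGroup E] [NormedSpace ℝ E]
  [NormedAddCommGroup F] [NormedSpace ℝ F]

lemma sum_sign_prod_eq_zero {k : ℕ} {r : Fin k → Fin k} (hr : ¬ Function.Surjective r) :
    ∑ ε : Fin k → ℤˣ, (((∏ i, ε i) * ∏ a, ε (r a) : ℤˣ) : ℤ) = 0 := by
  obtain ⟨i₀, hi₀⟩ := not_forall.1 hr
  have hi₀ : ∀ a, r a ≠ i₀ := fun a h => hi₀ ⟨a, h⟩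
  set δ : Fin k → ℤˣ := Pi.mulSingle i₀ (-1) with hδ
  have h := Fintype.sum_equiv (Equiv.mulLeft δ)
    (fun ε : Fin k → ℤˣ => -(((∏ i, ε i) * ∏ a, ε (r a) : ℤˣ) : ℤ))
    (fun ε : Fin k → ℤˣ => (((∏ i, ε i) * ∏ a, ε (r a) : ℤˣ) : ℤ)) (fun ε => by
      have h1 : ∏ a, δ (r a) = 1 :=
        Finset.prod_eq_one fun a _ => Pi.mulSingle_eq_of_ne (hi₀ a) _
      have h2 : ∏ i, δ i = -1 := by simp [hδ]
      simp only [Equiv.coe_mulLeft, Pi.mul_apply, Finset.prod_mul_distrib, h1, h2]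
      simp)
  rw [Finset.sum_neg_distrib] at h
  omega

lemma sum_sign_prod_of_surjective {k : ℕ} {r : Fin k → Fin k} (hr : Function.Surjective r) :
    ∑ ε : Fin k → ℤˣ, (((∏ i, ε i) * ∏ a, ε (r a) : ℤˣ) : ℤ) = 2 ^ k := by
  have hb : Function.Bijective r := Finite.surjective_iff_bijective.1 hr
  have : ∀ ε : Fin k → ℤˣ, (∏ i, ε i) * ∏ a, ε (r a) = 1 := by
    intro ε
    rw [hb.prod_comp ε]
    exact Int.units_mul_self _
  simp [this]

/-- Polarization for symmetric multilinear maps. -/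
lemma factorial_smul_eq_sum_sign {k : ℕ} (L : ContinuousMultilinearMap ℝ (fun _ : Fin k => E) F)
    (hL : ∀ (σ : Equiv.Perm (Fin k)) (v : Fin k → E), L (v ∘ σ) = L v) (v : Fin k → E) :
    (2 ^ k * k.factorial : ℝ) • L v =
      ∑ ε : Fin k → ℤˣ, (((∏ i, ε i : ℤˣ) : ℤ) : ℝ) • L fun _ => ∑ i, (((ε i : ℤ) : ℝ)) • v i := by
  have hexp : ∀ ε : Fin k → ℤˣ, (L fun _ => ∑ i, (((ε i : ℤ) : ℝ)) • v i) =
      ∑ r : Fin k → Fin k, (((∏ a, ε (r a) : ℤˣ) : ℤ) : ℝ) • L (v ∘ r) := by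
    intro ε
    have h1 := L.map_sum (fun (_ : Fin k) (i : Fin k) => (((ε i : ℤ) : ℝ)) • v i)
    rw [h1]
    refine Finset.sum_congr rfl fun r _ => ?_
    rw [L.map_smul_univ (fun a => ((ε (r a) : ℤ) : ℝ)) (fun a => v (r a))]
    push_cast
    rfl
  simp only [hexp, Finset.smul_sum]
  rw [Finset.sum_comm]
  have hin : ∀ r : Fin k → Fin k, ∑ ε : Fin k → ℤˣ, (((∏ i, ε i : ℤˣ) : ℤ) : ℝ) •
      (((∏ a, ε (r a) : ℤˣ) : ℤ) : ℝ) • L (v ∘ r) =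
      if Function.Bijective r then (2 ^ k : ℝ) • L v else 0 := by
    intro r
    simp only [smul_smul]
    rw [← Finset.sum_smul]
    have hc : ∑ ε : Fin k → ℤˣ, (((∏ i, ε i : ℤˣ) : ℤ) : ℝ) * (((∏ a, ε (r a) : ℤˣ) : ℤ) : ℝ) =
        ((∑ ε : Fin k → ℤˣ, (((∏ i, ε i) * ∏ a, ε (r a) : ℤˣ) : ℤ) : ℤ) : ℝ) := by
      push_cast
      rfl
    rw [hc]
    split_ifs with hr
    · rw [sum_sign_prod_of_surjective hr.surjective]
      have := hL (Equiv.ofBijective r hr) v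
      rw [Equiv.coe_ofBijective] at this
      rw [this]
      push_cast
      rfl
    · rw [sum_sign_prod_eq_zero fun h => hr (Finite.surjective_iff_bijective.1 h)]
      simp
  have hcard : Fintype.card {r : Fin k → Fin k // Function.Bijective r} = k.factorial := by
    rw [Fintype.card_congr (β := Equiv.Perm (Fin k))
      ⟨fun r => Equiv.ofBijective r.1 r.2, fun σ => ⟨σ, σ.bijective⟩,
        fun _ => rfl, fun _ => Equiv.ext fun _ => rfl⟩, Fintype.card_perm, Fintype.card_fin]
  rw [Finset.sum_congr rfl fun r _ => hin r, ← Finset.sum_filter, Finset.sum_const,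
    ← Fintype.card_subtype, hcard, mul_comm, mul_smul, Nat.cast_smul_eq_nsmul]

lemma opNorm_le_of_diag_le {k : ℕ} (L : ContinuousMultilinearMap ℝ (fun _ : Fin k => E) F)
    (hL : ∀ (σ : Equiv.Perm (Fin k)) (v : Fin k → E), L (v ∘ σ) = L v) {C : ℝ} (hC : 0 ≤ C)
    (h : ∀ w : E, ‖w‖ ≤ 1 → ‖L fun _ => w‖ ≤ C) : ‖L‖ ≤ Real.exp 1 ^ k * C := by
  have hdiag : ∀ u : E, ‖u‖ ≤ k → ‖L fun _ => u‖ ≤ k ^ k * C := by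
    intro u hu
    have e : u = (k : ℝ) • ((k : ℝ)⁻¹ • u) := by
      rcases Nat.eq_zero_or_pos k with rfl | hk
      · simpa using hu
      · rw [smul_smul, mul_inv_cancel₀ (by positivity), one_smul]
    have hw : ‖(k : ℝ)⁻¹ • u‖ ≤ 1 := by
      rw [norm_smul, norm_inv, Real.norm_of_nonneg (Nat.cast_nonneg k)]
      exact inv_mul_le_one_of_le₀ hu (Nat.cast_nonneg k)
    rw [e, L.map_smul_univ (fun _ => (k : ℝ)) (fun _ => (k : ℝ)⁻¹ • u), norm_smul]
    simp only [Finset.prod_const, Finset.card_univ, Fintype.card_fin, norm_pow,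
      Real.norm_of_nonneg (Nat.cast_nonneg k)]
    exact mul_le_mul_of_nonneg_left (h _ hw) (by positivity)
  have hunit : ∀ v : Fin k → E, (∀ i, ‖v i‖ ≤ 1) → ‖L v‖ ≤ Real.exp 1 ^ k * C := by
    intro v hv
    have h1 := congrArg norm (factorial_smul_eq_sum_sign L hL v)
    rw [norm_smul, Real.norm_of_nonneg (by positivity)] at h1
    have h2 : ‖∑ ε : Fin k → ℤˣ, (((∏ i, ε i : ℤˣ) : ℤ) : ℝ) •
        L fun _ => ∑ i, (((ε i : ℤ) : ℝ)) • v i‖ ≤ 2 ^ k * (k ^ k * C) := by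
      refine (norm_sum_le _ _).trans ?_
      have hu : ∀ u : ℤˣ, ‖((u : ℤ) : ℝ)‖ = 1 := by
        intro u
        rcases Int.units_eq_one_or u with rfl | rfl <;> simp
      have : ∀ ε ∈ (Finset.univ : Finset (Fin k → ℤˣ)), ‖(((∏ i, ε i : ℤˣ) : ℤ) : ℝ) •
          L fun _ => ∑ i, (((ε i : ℤ) : ℝ)) • v i‖ ≤ k ^ k * C := by
        intro ε _
        rw [norm_smul, hu, one_mul]
        refine hdiag _ ((norm_sum_le _ _).trans ?_)
        refine (Finset.sum_le_sum (g := fun _ => (1 : ℝ)) fun i _ => ?_).trans (by simp)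
        rw [norm_smul, hu, one_mul]
        exact hv i
      refine (Finset.sum_le_card_nsmul _ _ _ this).trans ?_
      simp
    rw [← h1, mul_assoc] at h2
    have h3 : (k.factorial : ℝ) * ‖L v‖ ≤ k ^ k * C := le_of_mul_le_mul_left h2 (by positivity)
    have h4 := Real.pow_div_factorial_le_exp (k : ℝ) (Nat.cast_nonneg k) k
    rw [← Real.exp_one_pow, div_le_iff₀ (by positivity)] at h4
    have hf : (0 : ℝ) < k.factorial := by positivity
    refine le_of_mul_le_mul_left (h3.trans ((mul_le_mul_of_nonneg_right h4 hC).trans_eq ?_)) hf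
    ring
  refine ContinuousMultilinearMap.opNorm_le_bound (by positivity) fun m => ?_
  have e : m = fun i => ‖m i‖ • (‖m i‖⁻¹ • m i) := by
    funext i
    rcases eq_or_ne (m i) 0 with h0 | h0
    · simp [h0]
    · rw [smul_smul, mul_inv_cancel₀ (norm_ne_zero_iff.2 h0), one_smul]
  have h1 := hunit (fun i => ‖m i‖⁻¹ • m i) (fun i => by
    rw [norm_smul, norm_inv, norm_norm]; exact inv_mul_le_one)
  have h2 : L m = (∏ i, ‖m i‖) • L fun i => ‖m i‖⁻¹ • m i := by
    conv_lhs => rw [e]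
    exact L.map_smul_univ _ _
  rw [h2, norm_smul, Real.norm_of_nonneg (by positivity), mul_comm]
  exact mul_le_mul_of_nonneg_right h1 (by positivity)

end Polarization

/-- Joris' theorem for Beurling classes on a Banach space. -/
theorem statement15 {E : Type*} [NormedAddCommGroup E] [NormedSpace ℝ E] [CompleteSpace E]
    (W : Set (ℕ → ℝ)) (hW : BAdmissible W)
    (U : Set E) (hU : IsOpen U)
    (j : ℕ) (hj : 1 ≤ j) (f : E → ℂ)
    (h1 : Beurling W U (fun x => f x ^ j))
    (h2 : Beurling W U (fun x => f x ^ (j + 1))) :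
    Beurling W U f := by
  have hf : ContDiffOn ℝ (⊤ : ℕ∞) f U := contDiffOn_of_hasLineTaylor hU fun x hx n =>
    hasLineTaylor_of_smooth_powers hU hj h1.1 h2.1 hx n
  refine ⟨hf, fun K hKU hK M hM ρ hρ => ?_⟩
  have wM := hW.matrix.weight M hM
  have hloc : ∀ x₀ ∈ K, ∃ s ∈ 𝓝[K] x₀, SeqBoundedOn M ρ f U s := by
    intro x₀ hx₀
    obtain ⟨r, hr, C, hC⟩ := exists_ball_diag_bound hW hU hj hf h1 h2 (hKU hx₀) hM
      (σ := ρ / Real.exp 1) (by positivity)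
    refine ⟨ball x₀ r ∩ U, mem_nhdsWithin_of_mem_nhds ((isOpen_ball.inter hU).mem_nhds
      ⟨mem_ball_self hr, hKU hx₀⟩), C, fun x hx k => ?_⟩
    rw [iteratedFDerivWithin_of_isOpen k hU hx.2]
    have hC0 : 0 ≤ C * (ρ / Real.exp 1) ^ k * M k :=
      (norm_nonneg _).trans (hC x hx.1 k 0 (by simp))
    refine (opNorm_le_of_diag_le _ (iteratedFDeriv_comp_perm_of_smooth hU hf k x hx.2) hC0
      (hC x hx.1 k)).trans_eq ?_
    rw [div_pow]
    field_simp
  refine hK.induction_on (p := SeqBoundedOn M ρ f U) ⟨0, fun x hx => absurd hx (notMem_empty x)⟩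
    (fun s t hst ⟨C, hC⟩ => ⟨C, fun x hx => hC x (hst hx)⟩) ?_ hloc
  rintro s t ⟨C, hC⟩ ⟨C', hC'⟩
  refine ⟨max C C', ?_⟩
  rintro x (hx | hx) k
  · refine (hC x hx k).trans (mul_le_mul_of_nonneg_right
      (mul_le_mul_of_nonneg_right (le_max_left _ _) (by positivity)) (wM.pos k).le)
  · refine (hC' x hx k).trans (mul_le_mul_of_nonneg_right
      (mul_le_mul_of_nonneg_right (le_max_right _ _) (by positivity)) (wM.pos k).le)

end JorisPaper
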